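/- Let G = G₁ ∗ ⋯ ∗ G_m be a free product of finitely many finitely generated groups, each of which is either virtually abelian or virtually free. Then every finitely generated subgroup H of G is conjugacy distinguished in G: for every g ∈ G such that no conjugate of g lies in H, there exist a finite group Q and a group homomorphism φ : G → Q such that no conjugate of φ(g) in Q lies in φ(H). -/

import Mathlib

/-- A group is virtually abelian if it has an abelian subgroup of finite
index. -/
def VirtuallyAbelian (G : Type) [Group G] : Prop :=
  ∃ A : Subgroup G, A.FiniteIndex ∧ ∀ x y : A, x * y = y * x

/-- A group is virtually free if it has a free subgroup of finite index. -/
def VirtuallyFree (G : Type) [Group G] : Prop :=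
  ∃ A : Subgroup G, A.FiniteIndex ∧ ∃ S : Type, Nonempty (A ≃* FreeGroup S)


open Equiv


def mkAct {Γ Z : Type} [Group Γ] (f : Γ → Z → Z) (h1 : ∀ z, f 1 z = z)
    (hm : ∀ γ γ' z, f (γ * γ') z = f γ (f γ' z)) : Γ →* Perm Z where
  toFun γ := ⟨f γ, f γ⁻¹, fun z => by rw [← hm, inv_mul_cancel, h1],
    fun z => by rw [← hm, mul_inv_cancel, h1]⟩
  map_one' := by ext z; exact h1 z
  map_mul' γ γ' := by ext z; exact hm γ γ' z

theorem mkAct_apply {Γ Z : Type} [Group Γ] (f : Γ → Z → Z) (h1 : ∀ z, f 1 z = z)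
    (hm : ∀ γ γ' z, f (γ * γ') z = f γ (f γ' z)) (γ : Γ) (z : Z) : mkAct f h1 hm γ z = f γ z := rfl

def LERF (Γ : Type) [Group Γ] : Prop :=
  ∀ H : Subgroup Γ, H.FG → ∀ γ, γ ∉ H → ∃ K : Subgroup Γ, H ≤ K ∧ K.FiniteIndex ∧ γ ∉ K

def CD (Γ : Type) [Group Γ] (g : Γ) : Prop :=
  ∀ H : Subgroup Γ, H.FG → (∀ x, x⁻¹ * g * x ∉ H) →
    ∃ K : Subgroup Γ, H ≤ K ∧ K.FiniteIndex ∧ ∀ x, x⁻¹ * g * x ∉ K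

def Apx {Γ X Z : Type} [Group Γ] (a : Γ →* Perm X) (C : Finset X) (S : Finset Γ)
    (b : Γ →* Perm Z) (ι : X → Z) : Prop :=
  ∀ s ∈ S, ∀ c ∈ C, ∀ c' ∈ C, b s (ι c) = ι c' ↔ a s c = c'

def Approx (Γ : Type) [Group Γ] : Prop :=
  ∀ (X : Type) (a : Γ →* Perm X) (C : Finset X) (S : Finset Γ),
    ∃ (Z : Type) (_ : Finite Z) (b : Γ →* Perm Z) (ι : X → Z), Apx a C S b ι

def CDX (Γ : Type) [Group Γ] (g : Γ) : Prop :=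
  ∀ (X : Type) (a : Γ →* Perm X) (C : Finset X) (S : Finset Γ), (∀ x, a g x ≠ x) →
    ∃ (Z : Type) (_ : Finite Z) (b : Γ →* Perm Z) (ι : X → Z), Apx a C S b ι ∧ ∀ z, b g z ≠ z

theorem finite_avoid {Γ : Type} [Group Γ] (h : LERF Γ) (L : Subgroup Γ) (hL : L.FG)
    (T : Finset Γ) (hT : ∀ t ∈ T, t ∉ L) :
    ∃ K : Subgroup Γ, L ≤ K ∧ K.FiniteIndex ∧ ∀ t ∈ T, t ∉ K := by
  classical
  induction T using Finset.induction_on with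
  | empty => exact ⟨⊤, le_top, inferInstance, by simp⟩
  | insert t T ht ih =>
    obtain ⟨K, h1, h2, h3⟩ := ih fun t ht => hT t (by simp [ht])
    obtain ⟨K', h1', h2', h3'⟩ := h L hL t (hT t (by simp))
    refine ⟨K ⊓ K', le_inf h1 h1', inferInstance, ?_⟩
    intro s hs
    rcases Finset.mem_insert.1 hs with rfl | hs
    · exact fun h => h3' h.2
    · exact fun h => h3 s hs h.1

theorem orbit_reps {Γ X : Type} [Group Γ] (a : Γ →* Perm X) :
    ∃ (rep : X → X) (u : X → Γ), (∀ x, a (u x) (rep x) = x) ∧ ∀ γ x, rep (a γ x) = rep x := by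
  letI : MulAction Γ X := MulAction.compHom X a
  have sm : ∀ (γ : Γ) (x : X), γ • x = a γ x := fun _ _ => rfl
  let rep : X → X := fun x => (Quotient.mk (MulAction.orbitRel Γ X) x).out
  have h : ∀ x, ∃ u : Γ, a u (rep x) = x := fun x => by
    have : MulAction.orbitRel Γ X x (rep x) := (MulAction.orbitRel Γ X).symm (Quotient.mk_out (s := MulAction.orbitRel Γ X) x)
    exact this
  choose u hu using h
  refine ⟨rep, u, hu, fun γ x => ?_⟩
  have : (Quotient.mk (MulAction.orbitRel Γ X) (a γ x)) = Quotient.mk (MulAction.orbitRel Γ X) x :=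
    Quotient.sound (s := MulAction.orbitRel Γ X) ⟨γ, rfl⟩
  simp only [rep, this]

theorem approx_core {Γ X : Type} [Group Γ] (h : LERF Γ) (a : Γ →* Perm X) (C : Finset X)
    (S : Finset Γ) (Ψ : Subgroup Γ → Prop) (hΨ : ∀ K K', K ≤ K' → Ψ K' → Ψ K)
    (hx : ∀ x, ∀ L : Subgroup Γ, L.FG → (∀ l ∈ L, a l x = x) → ∃ K, L ≤ K ∧ K.FiniteIndex ∧ Ψ K) :
    ∃ (Z : Type) (_ : Finite Z) (b : Γ →* Perm Z) (ι : X → Z), Apx a C S b ι ∧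
      ∀ z, ∃ (t : Γ) (K : Subgroup Γ), Ψ K ∧ ∀ γ, b γ z = z → t⁻¹ * γ * t ∈ K := by
  classical
  rcases isEmpty_or_nonempty X with hX | ⟨⟨x0⟩⟩
  · exact ⟨Empty, inferInstance, 1, fun x => (hX.false x).elim,
      fun _ _ c => (hX.false c).elim, fun z => z.elim⟩
  obtain ⟨rep, u, hu, hrep⟩ := orbit_reps a
  let P : Γ × X × X → Γ := fun q => (u q.2.2)⁻¹ * q.1 * u q.2.1
  let T : X → Finset (Γ × X × X) := fun r => (S ×ˢ C ×ˢ C).filter fun q => rep q.2.1 = r ∧ rep q.2.2 = r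
  have key : ∀ r, ∃ K : Subgroup Γ, K.FiniteIndex ∧ Ψ K ∧ ∀ q ∈ T r, P q ∈ K ↔ a q.1 q.2.1 = q.2.2 := by
    intro r
    let L := Subgroup.closure ((((T r).filter fun q => a q.1 q.2.1 = q.2.2).image P : Finset Γ) : Set Γ)
    have hLf : L.FG := ⟨_, rfl⟩
    have hP : ∀ q ∈ T r, a (P q) r = r ↔ a q.1 q.2.1 = q.2.2 := by
      intro q hq
      simp only [T, Finset.mem_filter] at hq
      have h1 := hu q.2.1
      have h2 := hu q.2.2
      rw [hq.2.1] at h1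
      rw [hq.2.2] at h2
      simp only [P, map_mul, Perm.mul_apply, map_inv, h1]
      rw [Perm.inv_eq_iff_eq, h2]
    have hLs : ∀ l ∈ L, a l r = r := by
      let St : Subgroup Γ := (MulAction.stabilizer (Perm X) r).comap a
      have : L ≤ St := by
        rw [Subgroup.closure_le]
        intro l hl
        simp only [Finset.coe_image, Set.mem_image, Finset.mem_coe, Finset.mem_filter] at hl
        obtain ⟨q, ⟨hq, hq2⟩, rfl⟩ := hl
        exact (hP q hq).2 hq2
      exact fun l hl => this hl
    obtain ⟨K1, h1, h2, h3⟩ := hx r L hLf hLs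
    obtain ⟨K2, h1', h2', h3'⟩ := finite_avoid h L hLf
      (((T r).filter fun q => a q.1 q.2.1 ≠ q.2.2).image P) (by
        intro t ht htL
        simp only [Finset.mem_image, Finset.mem_filter] at ht
        obtain ⟨q, ⟨hq, hq2⟩, rfl⟩ := ht
        exact hq2 ((hP q hq).1 (hLs _ htL)))
    refine ⟨K1 ⊓ K2, inferInstance, hΨ _ _ inf_le_left h3, fun q hq => ⟨fun hK => ?_, fun hK => ?_⟩⟩
    · by_contra hne
      exact h3' (P q) (Finset.mem_image_of_mem _ (Finset.mem_filter.2 ⟨hq, hne⟩)) hK.2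
    · have : P q ∈ L := Subgroup.subset_closure (Finset.mem_coe.2
        (Finset.mem_image_of_mem _ (Finset.mem_filter.2 ⟨hq, hK⟩)))
      exact ⟨h1 this, h1' this⟩
  choose K hK1 hK2 hK3 using key
  let R : Finset X := (insert x0 C).image rep
  let Z := Σ r : R, Γ ⧸ K r
  let b : Γ →* Perm Z :=
    mkAct (fun γ z => ⟨z.1, γ • z.2⟩) (fun z => by simp) (fun γ γ' z => by simp [mul_smul])
  have hb : ∀ γ r z, b γ ⟨r, z⟩ = ⟨r, γ • z⟩ := fun _ _ _ => rfl
  have hR : ∀ c ∈ C, rep c ∈ R := fun c hc => Finset.mem_image_of_mem _ (by simp [hc])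
  let ι : X → Z := fun x => if hx : rep x ∈ R then ⟨⟨rep x, hx⟩, (u x : Γ ⧸ K (rep x))⟩
    else ⟨⟨rep x0, Finset.mem_image_of_mem _ (by simp)⟩, ((1 : Γ) : Γ ⧸ _)⟩
  have hι : ∀ x (hx : rep x ∈ R), ι x = ⟨⟨rep x, hx⟩, (u x : Γ ⧸ K (rep x))⟩ := fun x hx => by
    simp only [ι, hx, dif_pos]
  have hf : ∀ r, Finite (Γ ⧸ K r) := fun r => by
    haveI := hK1 r
    exact Subgroup.finite_quotient_of_finiteIndex
  refine ⟨Z, inferInstance, b, ι, ?_, ?_⟩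
  · intro s hs c hc c' hc'
    rw [hι c (hR c hc), hι c' (hR c' hc'), hb]
    by_cases hr : rep c = rep c'
    · have h3 := hK3 (rep c) (s, c, c') (by simp [T, hs, hc, hc', hr])
      simp only at h3
      rw [← h3]
      have aux : ∀ (r r' : X) (hr : r ∈ R) (hr' : r' ∈ R) (e : r = r') (x y : Γ),
          ((⟨⟨r, hr⟩, (x : Γ ⧸ K r)⟩ : Z) = ⟨⟨r', hr'⟩, (y : Γ ⧸ K r')⟩) ↔ y⁻¹ * x ∈ K r := by
        intro r r' hr hr' e x y
        subst e
        simp only [Sigma.mk.injEq, heq_eq_eq, true_and]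
        rw [eq_comm, QuotientGroup.eq]
      have := aux (rep c) (rep c') (hR c hc) (hR c' hc') hr (s * u c) (u c')
      rw [← mul_assoc] at this
      exact this
    · constructor
      · intro h
        have := congrArg (fun z : Z => (z.1 : X)) h
        exact (hr this).elim
      · intro h
        exact (hr (by rw [← h, hrep])).elim
  · rintro ⟨r, z⟩
    obtain ⟨t, rfl⟩ := QuotientGroup.mk_surjective z
    refine ⟨t, K r, hK2 r, fun γ hγ => ?_⟩
    rw [hb] at hγ
    replace hγ := eq_of_heq (Sigma.mk.inj hγ).2
    have : ((t : Γ) : Γ ⧸ K r) = ((γ * t : Γ) : Γ ⧸ K r) := hγ.symm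
    rw [QuotientGroup.eq] at this
    rwa [mul_assoc]

theorem LERF.approx {Γ : Type} [Group Γ] (h : LERF Γ) : Approx Γ := by
  intro X a C S
  obtain ⟨Z, hZ, b, ι, h1, -⟩ := approx_core h a C S (fun _ => True) (fun _ _ _ _ => trivial)
    (fun x L _ _ => ⟨⊤, le_top, inferInstance, trivial⟩)
  exact ⟨Z, hZ, b, ι, h1⟩

theorem LERF.cdx {Γ : Type} [Group Γ] (h : LERF Γ) {g : Γ} (hg : CD Γ g) : CDX Γ g := by
  intro X a C S hx
  obtain ⟨Z, hZ, b, ι, h1, h2⟩ := approx_core h a C S (fun K => ∀ x, x⁻¹ * g * x ∉ K)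
    (fun K K' hK h x hx => h x (hK hx)) (fun x L hL hL2 => by
      refine hg L hL fun y hy => ?_
      have := hL2 _ hy
      rw [map_mul, map_mul, map_inv, Perm.mul_apply, Perm.mul_apply, Perm.inv_eq_iff_eq] at this
      exact hx _ this)
  refine ⟨Z, hZ, b, ι, h1, fun z hz => ?_⟩
  obtain ⟨t, K, hK, hK2⟩ := h2 z
  exact hK t (hK2 _ hz)

theorem cosetHom_exists {Γ : Type} [Group Γ] (H : Subgroup Γ) :
    ∃ a : Γ →* Perm (Γ ⧸ H), ∀ γ x, a γ x = γ • x := ⟨MulAction.toPermHom Γ (Γ ⧸ H), fun _ _ => rfl⟩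

theorem stab_fi {Γ Z : Type} [Group Γ] [Finite Z] (b : Γ →* Perm Z) (z : Z) :
    ((MulAction.stabilizer (Perm Z) z).comap b).FiniteIndex := by
  refine Subgroup.finiteIndex_of_le (H := b.ker) fun x hx => ?_
  rw [Subgroup.mem_comap, MonoidHom.mem_ker.1 hx]
  exact Subgroup.one_mem _

/-- from approximations to subgroups -/
theorem CDX.cd {Γ : Type} [Group Γ] {g : Γ} (h : CDX Γ g) : CD Γ g := by
  classical
  intro H ⟨S, hS⟩ hg
  obtain ⟨a, ha⟩ := cosetHom_exists H
  obtain ⟨Z, hZ, b, ι, h1, h2⟩ := h (Γ ⧸ H) a {((1 : Γ) : Γ ⧸ H)} S (by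
    intro x hx
    obtain ⟨t, rfl⟩ := QuotientGroup.mk_surjective x
    rw [ha, eq_comm] at hx
    have : ((t : Γ) : Γ ⧸ H) = ((g * t : Γ) : Γ ⧸ H) := hx
    rw [QuotientGroup.eq, ← mul_assoc] at this
    exact hg t this)
  refine ⟨_, ?_, stab_fi b (ι ((1 : Γ) : Γ ⧸ H)), ?_⟩
  · refine hS.ge.trans ((Subgroup.closure_le _).2 ?_)
    intro s hs
    refine (h1 s hs _ (Finset.mem_singleton_self _) _ (Finset.mem_singleton_self _)).2 ?_
    rw [ha, eq_comm]
    show ((1 : Γ) : Γ ⧸ H) = ((s * 1 : Γ) : Γ ⧸ H)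
    rw [QuotientGroup.eq]
    simpa [← hS] using Subgroup.subset_closure hs
  · intro x hx
    have hx : b (x⁻¹ * g * x) (ι ((1 : Γ) : Γ ⧸ H)) = ι ((1 : Γ) : Γ ⧸ H) := hx
    rw [map_mul, map_mul, map_inv, Perm.mul_apply, Perm.mul_apply, Perm.inv_eq_iff_eq] at hx
    exact h2 _ hx

theorem CD.final {Γ : Type} [Group Γ] {g : Γ} (h : CD Γ g) (H : Subgroup Γ) (hH : H.FG)
    (hg : ∀ x, x⁻¹ * g * x ∉ H) :
    ∃ (Q : Type) (_ : Group Q) (_ : Finite Q) (φ : Γ →* Q),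
      ∀ q : Q, q⁻¹ * φ g * q ∉ Subgroup.map φ H := by
  obtain ⟨K, h1, h2, h3⟩ := h H hH hg
  refine ⟨Γ ⧸ K.normalCore, inferInstance, Subgroup.finite_quotient_of_finiteIndex,
    QuotientGroup.mk' _, fun q => ?_⟩
  obtain ⟨x, rfl⟩ := QuotientGroup.mk'_surjective _ q
  rintro ⟨y, hy, hxy⟩
  rw [← map_inv, ← map_mul, ← map_mul, QuotientGroup.mk'_apply, QuotientGroup.mk'_apply,
    QuotientGroup.eq] at hxy
  have := K.mul_mem (h1 hy) (K.normalCore_le hxy)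
  rw [mul_inv_cancel_left] at this
  exact h3 x this

open Equiv

theorem comm_sep {A : Type} [CommGroup A] [Group.FG A] (q : A) (hq : q ≠ 1) :
    ∃ n : ℕ, n ≠ 0 ∧ ∀ x : A, x ^ n ≠ q := by
  classical
  obtain ⟨k, j, hj, p, hp, e, ⟨f⟩⟩ := AddCommGroup.equiv_free_prod_directSum_zmod (Additive A)
  have hq' : f (Additive.ofMul q) ≠ 0 := fun h => hq (by
    rw [f.map_eq_zero_iff] at h; exact h)
  have hpow : ∀ (n : ℕ) (x : A), x ^ n = q → n • f (Additive.ofMul x) = f (Additive.ofMul q) := by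
    rintro n x rfl
    rw [← map_nsmul]; rfl
  by_cases h1 : (f (Additive.ofMul q)).1 = 0
  · have h2 : (f (Additive.ofMul q)).2 ≠ 0 := fun h => hq' (Prod.ext h1 h)
    obtain ⟨i, hi⟩ : ∃ i, (f (Additive.ofMul q)).2 i ≠ 0 := by
      by_contra hc
      push Not at hc
      exact h2 (DFinsupp.ext hc)
    refine ⟨p i ^ e i, pow_ne_zero _ (hp i).ne_zero, fun x hx => hi ?_⟩
    rw [← hpow _ x hx]
    show ((p i ^ e i) • (f (Additive.ofMul x)).2) i = 0
    rw [DFinsupp.smul_apply, nsmul_eq_mul]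
    simp
  · obtain ⟨i, hi⟩ : ∃ i, (f (Additive.ofMul q)).1 i ≠ 0 := by
      by_contra hc
      push Not at hc
      exact h1 (Finsupp.ext hc)
    refine ⟨((f (Additive.ofMul q)).1 i).natAbs + 1, by omega, fun x hx => ?_⟩
    have := hpow _ x hx
    set v := (f (Additive.ofMul q)).1 i
    have h3 : (v.natAbs + 1) • (f (Additive.ofMul x)).1 i = v := by
      conv_rhs => rw [show v = (f (Additive.ofMul q)).1 i from rfl, ← this]
      rfl
    have h4 : v.natAbs + 1 ∣ v.natAbs := by
      have : ((v.natAbs + 1 : ℕ) : ℤ) ∣ v := ⟨_, by rw [← nsmul_eq_mul]; exact h3.symm⟩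
      exact Int.natCast_dvd.1 this
    have := Nat.le_of_dvd (Int.natAbs_pos.2 hi) h4
    omega

theorem abel_sep {Γ : Type} [Group Γ] (A M : Subgroup Γ) (hA : ∀ x ∈ A, ∀ y ∈ A, x * y = y * x)
    (hfg : A.FG) (hM : M ≤ A) (a : Γ) (ha : a ∈ A) (haM : a ∉ M) :
    ∃ n : ℕ, n ≠ 0 ∧ ∀ m ∈ M, ∀ b ∈ A, a ≠ m * b ^ n := by
  letI : CommGroup A := { A.toGroup with mul_comm := fun x y => Subtype.ext (hA _ x.2 _ y.2) }
  haveI : Group.FG A := (Group.fg_iff_subgroup_fg A).2 hfg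
  have : QuotientGroup.mk' (M.subgroupOf A) ⟨a, ha⟩ ≠ 1 := by
    rw [Ne, ← MonoidHom.mem_ker, QuotientGroup.ker_mk']
    exact haM
  obtain ⟨n, hn, h⟩ := comm_sep _ this
  refine ⟨n, hn, fun m hm b hb e => h (QuotientGroup.mk' _ ⟨b, hb⟩) ?_⟩
  rw [← map_pow, QuotientGroup.mk'_apply, QuotientGroup.mk'_apply, QuotientGroup.eq]
  show (b ^ n)⁻¹ * a ∈ M
  rw [e, hA m (hM hm) _ (A.pow_mem hb n)]
  simpa using hm

theorem va_core {Γ : Type} [Group Γ] [Group.FG Γ] (h : ∃ A : Subgroup Γ, A.FiniteIndex ∧ ∀ x y : A, x * y = y * x) :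
    ∃ A : Subgroup Γ, A.FiniteIndex ∧ A.Normal ∧ A.FG ∧ (∀ x ∈ A, ∀ y ∈ A, x * y = y * x) := by
  obtain ⟨A, h1, h2⟩ := h
  refine ⟨A.normalCore, inferInstance, inferInstance,
    (Group.fg_iff_subgroup_fg _).1 (Subgroup.fg_of_index_ne_zero _), fun x hx y hy => ?_⟩
  exact congrArg Subtype.val (h2 ⟨x, A.normalCore_le hx⟩ ⟨y, A.normalCore_le hy⟩)

/-- n-th powers -/
def pw {Γ : Type} [Group Γ] (A : Subgroup Γ) (hA : ∀ x ∈ A, ∀ y ∈ A, x * y = y * x) (n : ℕ) :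
    Subgroup Γ where
  carrier := {x | ∃ b ∈ A, b ^ n = x}
  one_mem' := ⟨1, A.one_mem, one_pow n⟩
  mul_mem' := by
    rintro _ _ ⟨x, hx, rfl⟩ ⟨y, hy, rfl⟩
    exact ⟨x * y, A.mul_mem hx hy, (show Commute x y from hA x hx y hy).mul_pow n⟩
  inv_mem' := by
    rintro _ ⟨x, hx, rfl⟩
    exact ⟨x⁻¹, A.inv_mem hx, inv_pow x n⟩

theorem pw_normal {Γ : Type} [Group Γ] (A : Subgroup Γ) (hA : ∀ x ∈ A, ∀ y ∈ A, x * y = y * x)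
    [hn : A.Normal] (n : ℕ) : (pw A hA n).Normal where
  conj_mem := by
    rintro _ ⟨x, hx, rfl⟩ g
    exact ⟨g * x * g⁻¹, hn.conj_mem x hx g, conj_pow⟩

theorem pw_fi {Γ : Type} [Group Γ] (A : Subgroup Γ) (hA : ∀ x ∈ A, ∀ y ∈ A, x * y = y * x)
    [hi : A.FiniteIndex] (hfg : A.FG) (n : ℕ) (hn : n ≠ 0) : (pw A hA n).FiniteIndex := by
  letI : CommGroup A := { A.toGroup with mul_comm := fun x y => Subtype.ext (hA _ x.2 _ y.2) }
  haveI : Group.FG A := (Group.fg_iff_subgroup_fg A).2 hfg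
  haveI := Subgroup.finiteIndex_range_powMonoidHom_of_fg A hn
  have hle : pw A hA n ≤ A := by
    rintro _ ⟨x, hx, rfl⟩
    exact A.pow_mem hx n
  have : (powMonoidHom n : A →* A).range ≤ (pw A hA n).subgroupOf A := by
    rintro _ ⟨⟨x, hx⟩, rfl⟩
    exact ⟨x, hx, rfl⟩
  have h2 := Subgroup.finiteIndex_of_le this
  refine ⟨?_⟩
  rw [← Subgroup.relIndex_mul_index hle]
  exact mul_ne_zero h2.index_ne_zero hi.index_ne_zero

theorem va_step {Γ : Type} [Group Γ] (A : Subgroup Γ) (hA : ∀ x ∈ A, ∀ y ∈ A, x * y = y * x)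
    [hi : A.Normal] (hfg : A.FG) (H R : Subgroup Γ) (hR : R ≤ A) (g : Γ)
    (hg : ∀ r ∈ R, g * r ∉ H) : ∃ n : ℕ, n ≠ 0 ∧ ∀ r ∈ R, g * r ∉ H ⊔ pw A hA n := by
  have hmem : ∀ n x, x ∈ H ⊔ pw A hA n ↔ ∃ h ∈ H, ∃ b ∈ A, h * b ^ n = x := by
    intro n x
    haveI := pw_normal A hA n
    rw [← SetLike.mem_coe, Subgroup.mul_normal]
    constructor
    · rintro ⟨h, hh, _, ⟨b, hb, rfl⟩, rfl⟩
      exact ⟨h, hh, b, hb, rfl⟩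
    · rintro ⟨h, hh, b, hb, rfl⟩
      exact ⟨h, hh, _, ⟨b, hb, rfl⟩, rfl⟩
  by_cases hga : ∃ h ∈ H, ∃ a ∈ A, h * a = g
  · obtain ⟨h, hh, a, ha, rfl⟩ := hga
    have hMle : (H ⊓ A) ⊔ R ≤ A := sup_le inf_le_right hR
    have hMmem : ∀ x, x ∈ (H ⊓ A) ⊔ R → ∃ m ∈ H ⊓ A, ∃ r ∈ R, m * r = x := by
      let T : Subgroup Γ := 
        { carrier := {x | ∃ m ∈ H ⊓ A, ∃ r ∈ R, m * r = x}
          one_mem' := ⟨1, one_mem _, 1, one_mem _, mul_one 1⟩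
          mul_mem' := by
            rintro _ _ ⟨m, hm, r, hr, rfl⟩ ⟨m', hm', r', hr', rfl⟩
            refine ⟨m * m', mul_mem hm hm', r * r', mul_mem hr hr', ?_⟩
            rw [mul_assoc, mul_assoc, ← mul_assoc m' r, ← mul_assoc r m', hA r (hR hr) m' hm'.2]
          inv_mem' := by
            rintro _ ⟨m, hm, r, hr, rfl⟩
            refine ⟨m⁻¹, inv_mem hm, r⁻¹, inv_mem hr, ?_⟩
            rw [mul_inv_rev, hA r⁻¹ (hR (inv_mem hr)) m⁻¹ (inv_mem hm.2)] }
      have : (H ⊓ A) ⊔ R ≤ T := sup_le (fun m hm => ⟨m, hm, 1, one_mem _, mul_one _⟩)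
        (fun r hr => ⟨1, one_mem _, r, hr, one_mul _⟩)
      exact fun x hx => this hx
    obtain ⟨n, hn, h2⟩ := abel_sep A ((H ⊓ A) ⊔ R) hA hfg hMle a ha (by
      intro haM
      obtain ⟨m, hm, r, hr, rfl⟩ := hMmem a haM
      apply hg r⁻¹ (inv_mem hr)
      simpa [mul_assoc] using H.mul_mem hh hm.1)
    refine ⟨n, hn, fun r hr hK => ?_⟩
    obtain ⟨h', hh', b, hb, e⟩ := (hmem _ _).1 hK
    have hbn := A.pow_mem hb n
    have e2 : h⁻¹ * h' = a * r * (b ^ n)⁻¹ := by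
      rw [eq_mul_inv_iff_mul_eq, mul_assoc, e]; group
    have hmA : h⁻¹ * h' ∈ A := by
      rw [e2]; exact A.mul_mem (A.mul_mem ha (hR hr)) (A.inv_mem hbn)
    refine h2 ((h⁻¹ * h') * r⁻¹) (mul_mem (Subgroup.mem_sup_left ⟨H.mul_mem (H.inv_mem hh) hh', hmA⟩)
      (Subgroup.mem_sup_right (inv_mem hr))) b hb ?_
    rw [mul_assoc, hA r⁻¹ (hR (inv_mem hr)) _ hbn, e2]; group
  · refine ⟨1, one_ne_zero, fun r hr hK => hga ?_⟩
    obtain ⟨h', hh', b, hb, e⟩ := (hmem _ _).1 hK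
    refine ⟨h', hh', b * r⁻¹, A.mul_mem hb (A.inv_mem (hR hr)), ?_⟩
    rw [← mul_assoc, ← pow_one b, e]; group

theorem va_lerf {Γ : Type} [Group Γ] [Group.FG Γ]
    (h : ∃ A : Subgroup Γ, A.FiniteIndex ∧ ∀ x y : A, x * y = y * x) : LERF Γ := by
  obtain ⟨A, hi, hN, hfg, hA⟩ := va_core h
  intro H _ γ hγ
  obtain ⟨n, hn, h2⟩ := va_step A hA hfg H ⊥ bot_le γ (by
    intro r hr; rw [Subgroup.mem_bot.1 hr, mul_one]; exact hγ)
  haveI := pw_fi A hA hfg n hn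
  refine ⟨H ⊔ pw A hA n, le_sup_left, Subgroup.finiteIndex_of_le (H := pw A hA n) le_sup_right, ?_⟩
  simpa using h2 1 (one_mem _)

theorem va_cd {Γ : Type} [Group Γ] [Group.FG Γ]
    (h : ∃ A : Subgroup Γ, A.FiniteIndex ∧ ∀ x y : A, x * y = y * x) (g : Γ) : CD Γ g := by
  classical
  obtain ⟨A, hi, hN, hfg, hA⟩ := va_core h
  intro H _ hg
  have hcom : ∀ (g' a : Γ), a ∈ A → g'⁻¹ * a * g' ∈ A := fun g' a ha => by
    simpa using hN.conj_mem a ha g'⁻¹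
  have key : ∀ t : Γ, ∃ n : ℕ, n ≠ 0 ∧ ∀ a ∈ A, (t * a)⁻¹ * g * (t * a) ∉ H ⊔ pw A hA n := by
    intro t
    set g' := t⁻¹ * g * t with hg'
    let R : Subgroup Γ :=
      { carrier := {x | ∃ a ∈ A, x = (g'⁻¹ * a⁻¹ * g') * a}
        one_mem' := ⟨1, A.one_mem, by group⟩
        mul_mem' := by
          rintro _ _ ⟨a, ha, rfl⟩ ⟨b, hb, rfl⟩
          refine ⟨b * a, A.mul_mem hb ha, ?_⟩
          have e := hA _ (A.mul_mem (hcom g' _ (A.inv_mem hb)) hb) a ha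
          calc _ = g'⁻¹ * a⁻¹ * g' * (a * (g'⁻¹ * b⁻¹ * g' * b)) := by group
            _ = _ := by rw [← e]; group
        inv_mem' := by
          rintro _ ⟨a, ha, rfl⟩
          refine ⟨a⁻¹, A.inv_mem ha, ?_⟩
          have e := hA _ (hcom g' _ ha) a⁻¹ (A.inv_mem ha)
          calc _ = a⁻¹ * (g'⁻¹ * a * g') := by group
            _ = _ := by rw [← e]; group }
    have hR : R ≤ A := by
      rintro _ ⟨a, ha, rfl⟩
      exact A.mul_mem (hcom g' _ (A.inv_mem ha)) ha
    have hconj : ∀ a, (t * a)⁻¹ * g * (t * a) = g' * (g'⁻¹ * a⁻¹ * g' * a) := by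
      intro a; rw [hg']; group
    obtain ⟨n, hn, h2⟩ := va_step A hA hfg H R hR g' (by
      rintro _ ⟨a, ha, rfl⟩
      rw [← hconj]
      exact hg _)
    refine ⟨n, hn, fun a ha => ?_⟩
    rw [hconj]
    exact h2 _ ⟨a, ha, rfl⟩
  choose n hn hn2 using key
  haveI : Fintype (Γ ⧸ A) := Fintype.ofFinite _
  let N := ∏ q : Γ ⧸ A, n q.out
  haveI := pw_fi A hA hfg N (Finset.prod_ne_zero_iff.2 fun q _ => hn _)
  refine ⟨H ⊔ pw A hA N, le_sup_left, Subgroup.finiteIndex_of_le (H := pw A hA N) le_sup_right, ?_⟩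
  intro x hx
  obtain ⟨a, ha⟩ := QuotientGroup.mk_out_eq_mul A x
  set t := (x : Γ ⧸ A).out with ht
  have hle : pw A hA N ≤ pw A hA (n t) := by
    rintro _ ⟨b, hb, rfl⟩
    obtain ⟨k, hk⟩ : n t ∣ N := Finset.dvd_prod_of_mem (fun q : Γ ⧸ A => n q.out) (Finset.mem_univ (x : Γ ⧸ A))
    refine ⟨b ^ k, A.pow_mem hb k, ?_⟩
    rw [hk, mul_comm, pow_mul]
  refine hn2 t (a : Γ)⁻¹ (A.inv_mem a.2) ?_
  rw [show t * (a : Γ)⁻¹ = x by rw [ha, mul_inv_cancel_right]]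
  exact (sup_le_sup_left hle H) hx

open Equiv Monoid

theorem coprod_letters {ι : Type} {G : ι → Type} [∀ i, Group (G i)] (s : CoprodI G) :
    ∃ l : List (Σ i, G i), (l.map fun p => (CoprodI.of p.2 : CoprodI G)).prod = s := by
  induction s using CoprodI.induction_on with
  | one => exact ⟨[], rfl⟩
  | of i m => exact ⟨[⟨i, m⟩], by simp⟩
  | mul x y hx hy =>
    obtain ⟨l, rfl⟩ := hx
    obtain ⟨l', rfl⟩ := hy
    exact ⟨l ++ l', by simp⟩

theorem ext_equiv {E W X : Type} [Finite E] [Finite W] (h : Nat.card E = Nat.card W)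
    (C : Finset X) (κ : X → E) (q : X → W) (h1 : Set.InjOn κ C) (h2 : Set.InjOn q C) :
    ∃ e : E ≃ W, ∀ c ∈ C, e (κ c) = q c := by
  classical
  haveI := Fintype.ofFinite E
  haveI := Fintype.ofFinite W
  haveI : DecidableEq X := Classical.decEq X
  let f : E → W := fun x => if hx : ∃ c ∈ C, κ c = x then q hx.choose else
    (Classical.choice (Finite.card_eq.1 h) : E ≃ W) x
  have hf : ∀ c ∈ C, f (κ c) = q c := fun c hc => by
    have h' : ∃ c' ∈ C, κ c' = κ c := ⟨c, hc, rfl⟩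
    simp only [f, h', dif_pos]
    rw [h1 h'.choose_spec.1 hc h'.choose_spec.2]
  obtain ⟨e, he⟩ := Set.MapsTo.exists_equiv_extend_of_card_eq (α := E) (β := W) (t := (Finset.univ : Finset W))
    (by rw [Finset.card_univ, ← Nat.card_eq_fintype_card, ← Nat.card_eq_fintype_card, h])
    (s := κ '' C) (f := f) (by intro x _; simp) (by
      rintro _ ⟨c, hc, rfl⟩ _ ⟨c', hc', rfl⟩ hcc
      rw [hf c hc, hf c' hc'] at hcc
      rw [h2 hc hc' hcc])
  refine ⟨e.trans (Equiv.subtypeUnivEquiv (by simp)), fun c hc => ?_⟩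
  rw [← hf c hc]
  exact he _ ⟨c, hc, rfl⟩

def pathPts {ι : Type} {G : ι → Type} [∀ i, Group (G i)] {X : Type} (a : CoprodI G →* Perm X)
    (l : List (Σ i, G i)) (c : X) : List X :=
  l.tails.map fun t => a (t.map fun p => (CoprodI.of p.2 : CoprodI G)).prod c

/-- finite sets controlling the action of `S` on `C`. -/
theorem path_control {ι : Type} {G : ι → Type} [∀ i, Group (G i)] {X : Type}
    (a : CoprodI G →* Perm X) (C : Finset X) (S : Finset (CoprodI G)) :
    ∃ (C1 : Finset X) (T : ∀ i, Finset (G i)), C ⊆ C1 ∧ (∀ i, 1 ∈ T i) ∧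
      ∀ (Z : Type) (b : CoprodI G →* Perm Z) (κ : X → Z), Set.InjOn κ C1 →
        (∀ i, ∀ s ∈ T i, ∀ c ∈ C1, a (CoprodI.of s) c ∈ C1 → b (CoprodI.of s) (κ c) = κ (a (CoprodI.of s) c)) →
        Apx a C S b κ := by
  classical
  choose l hl using fun s : CoprodI G => coprod_letters s
  let C1 : Finset X := C ∪ S.biUnion fun s => C.biUnion fun c => (pathPts a (l s) c).toFinset
  let T : ∀ i, Finset (G i) := fun i => insert 1 ((S.biUnion fun s => (l s).toFinset).preimage
    (fun g => (⟨i, g⟩ : Σ i, G i)) (fun _ _ _ _ h => eq_of_heq (Sigma.mk.inj h).2))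
  refine ⟨C1, T, Finset.subset_union_left, fun i => by simp [T], fun Z b κ hκ h => ?_⟩
  have key : ∀ (c : X) (t : List (Σ i, G i)), (∀ p ∈ t, p.2 ∈ T p.1) → (∀ x ∈ pathPts a t c, x ∈ C1) →
      a (t.map fun p => (CoprodI.of p.2 : CoprodI G)).prod c ∈ C1 ∧
      b (t.map fun p => (CoprodI.of p.2 : CoprodI G)).prod (κ c) =
        κ (a (t.map fun p => (CoprodI.of p.2 : CoprodI G)).prod c) := by
    intro c t
    induction t with
    | nil => intro _ h2; simpa [pathPts] using h2
    | cons p t ih =>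
      intro h1 h2
      have h2' : a ((p :: t).map fun p => (CoprodI.of p.2 : CoprodI G)).prod c ∈ C1 :=
        h2 _ (by simp [pathPts])
      obtain ⟨i1, i2⟩ := ih (fun p hp => h1 p (by simp [hp])) (fun x hx => h2 x (by
        simp only [pathPts, List.tails, List.map_cons, List.mem_cons]
        exact Or.inr hx))
      refine ⟨h2', ?_⟩
      simp only [List.map_cons, List.prod_cons, map_mul, Perm.mul_apply] at h2' ⊢
      rw [i2]
      exact h p.1 p.2 (h1 p (by simp)) _ i1 h2'
  intro s hs c hc c' hc'
  obtain ⟨k1, k2⟩ := key c (l s) (fun p hp => by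
      refine Finset.mem_insert_of_mem (Finset.mem_preimage.2 ?_)
      exact Finset.mem_biUnion.2 ⟨s, hs, by simpa using hp⟩)
    (fun x hx => Finset.mem_union_right _ (Finset.mem_biUnion.2 ⟨s, hs,
      Finset.mem_biUnion.2 ⟨c, hc, by simpa using hx⟩⟩))
  rw [hl] at k1 k2
  rw [k2]
  exact hκ.eq_iff k1 (Finset.mem_union_left _ hc')

theorem Apx.injOn {Γ X Z : Type} [Group Γ] {a : Γ →* Perm X} {C : Finset X} {S : Finset Γ}
    {b : Γ →* Perm Z} {ι : X → Z} (h : Apx a C S b ι) (h1 : 1 ∈ S) : Set.InjOn ι C := by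
  intro c hc c' hc' e
  have := h 1 h1 c hc c' hc'
  simp only [map_one, Perm.one_apply] at this
  exact this.1 e

theorem fp_core {ι : Type} [Finite ι] {G : ι → Type} [∀ i, Group (G i)] {X : Type} [Nonempty X]
    (a : CoprodI G →* Perm X) (C : Finset X) (S : Finset (CoprodI G)) :
    ∃ (C1 : Finset X) (T : ∀ i, Finset (G i)), ∀ (Z : ι → Type) (_ : ∀ i, Finite (Z i))
      (b : ∀ i, G i →* Perm (Z i)) (κ : ∀ i, X → Z i),
      (∀ i, Apx (a.comp CoprodI.of) C1 (T i) (b i) (κ i)) →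
      ∃ (E : Type) (_ : Finite E) (b' : CoprodI G →* Perm E) (κ' : X → E), Apx a C S b' κ' ∧
        ∀ i x, ∃ z, ∀ g, b' (CoprodI.of g) x = x → b i g z = z := by
  classical
  obtain ⟨C1, T, hC, hT, h⟩ := path_control a C S
  refine ⟨C1, T, fun Z hZ b κ hA => ?_⟩
  haveI := Fintype.ofFinite ι
  haveI hne : ∀ i, Nonempty (Z i) := fun i => ⟨κ i (Classical.arbitrary X)⟩
  let N := (C1.card + 1) * ∏ i, Nat.card (Z i)
  have hpos : 0 < ∏ i, Nat.card (Z i) := Finset.prod_pos fun i _ => Nat.card_pos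
  have hN : C1.card ≤ N := by
    calc C1.card ≤ (C1.card + 1) * 1 := by omega
      _ ≤ N := Nat.mul_le_mul_left _ hpos
  have hM : ∀ i, ∃ M, N = Nat.card (Z i) * (M + 1) := fun i => by
    obtain ⟨M, hM⟩ : Nat.card (Z i) ∣ N :=
      (Finset.dvd_prod_of_mem (fun i => Nat.card (Z i)) (Finset.mem_univ i)).mul_left _
    have : M ≠ 0 := by
      rintro rfl
      have : 0 < N := Nat.mul_pos (by omega) hpos
      omega
    exact ⟨M - 1, by rw [hM]; congr 1; omega⟩
  choose M hM using hM
  obtain ⟨κ', hκ'⟩ : ∃ κ' : X → Fin N, Set.InjOn κ' C1 := by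
    have hNp : 0 < N := Nat.mul_pos (by omega) hpos
    refine ⟨fun x => if hx : x ∈ C1 then Fin.castLE hN (C1.equivFin ⟨x, hx⟩) else ⟨0, hNp⟩, ?_⟩
    intro c hc c' hc' e
    have hc : c ∈ C1 := hc
    have hc' : c' ∈ C1 := hc'
    simp only [hc, hc', dif_pos] at e
    have := C1.equivFin.injective (Fin.castLE_injective hN e)
    exact congrArg Subtype.val this
  have he : ∀ i, ∃ e : Fin N ≃ Z i × Fin (M i + 1), ∀ c ∈ C1, e (κ' c) = (κ i c, 0) := fun i =>
    ext_equiv (by rw [Nat.card_prod, Nat.card_fin, Nat.card_fin, ← hM]) C1 κ' (fun c => (κ i c, 0)) hκ'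
      (fun c hc c' hc' e => (hA i).injOn (hT i) hc hc' (Prod.mk.inj e).1)
  choose e he using he
  let β : ∀ i, G i →* Perm (Fin N) := fun i =>
    mkAct (fun g x => (e i).symm (b i g (e i x).1, (e i x).2)) (fun z => by simp) (fun γ γ' z => by simp)
  have hβ : ∀ i g x, β i g x = (e i).symm (b i g (e i x).1, (e i x).2) := fun _ _ _ => rfl
  let b' : CoprodI G →* Perm (Fin N) := CoprodI.lift β
  have hb' : ∀ i (g : G i), b' (CoprodI.of g) = β i g := fun i g => CoprodI.lift_of _ _
  refine ⟨Fin N, inferInstance, b', κ', h _ b' κ' hκ' ?_, fun i x => ⟨(e i x).1, fun g hg => ?_⟩⟩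
  · intro i s hs c hc hsc
    rw [hb', hβ, he i c hc]
    have := (hA i s hs c hc _ hsc).2 rfl
    simp only [this]
    rw [← he i _ hsc, symm_apply_apply]
  · rw [hb', hβ, symm_apply_eq] at hg
    exact congrArg Prod.fst hg

theorem approx_of_isEmpty {Γ X : Type} [Group Γ] [hX : IsEmpty X] (a : Γ →* Perm X) (C : Finset X)
    (S : Finset Γ) (g : Γ) :
    ∃ (Z : Type) (_ : Finite Z) (b : Γ →* Perm Z) (ι : X → Z), Apx a C S b ι ∧ ∀ z, b g z ≠ z :=
  ⟨Empty, inferInstance, 1, fun x => (hX.false x).elim,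
      fun _ _ c => (hX.false c).elim, fun z => z.elim⟩

theorem fp_approx {ι : Type} [Finite ι] {G : ι → Type} [∀ i, Group (G i)] (h : ∀ i, Approx (G i)) :
    Approx (CoprodI G) := by
  intro X a C S
  rcases isEmpty_or_nonempty X with hX | hX
  · obtain ⟨Z, hZ, b, κ, h, -⟩ := approx_of_isEmpty a C S 1
    exact ⟨Z, hZ, b, κ, h⟩
  obtain ⟨C1, T, hc⟩ := fp_core a C S
  choose Z hZ b κ hA using fun i => h i X (a.comp CoprodI.of) C1 (T i)
  obtain ⟨E, hE, b', κ', h1, -⟩ := hc Z hZ b κ hA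
  exact ⟨E, hE, b', κ', h1⟩

theorem fp_cdx {ι : Type} [Finite ι] {G : ι → Type} [∀ i, Group (G i)] (h : ∀ i, Approx (G i))
    (i : ι) (g : G i) (hg : CDX (G i) g) : CDX (CoprodI G) (CoprodI.of g) := by
  intro X a C S hx
  rcases isEmpty_or_nonempty X with hX | hX
  · exact approx_of_isEmpty a C S _
  obtain ⟨C1, T, hc⟩ := fp_core a C S
  have : ∀ j, ∃ (Z : Type) (_ : Finite Z) (b : G j →* Perm Z) (κ : X → Z),
      Apx (a.comp CoprodI.of) C1 (T j) b κ ∧ ∀ e : i = j, ∀ z, b (e ▸ g) z ≠ z := by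
    intro j
    by_cases e : i = j
    · subst e
      obtain ⟨Z, hZ, b, κ, h1, h2⟩ := hg X (a.comp CoprodI.of) C1 (T i) hx
      exact ⟨Z, hZ, b, κ, h1, fun _ => h2⟩
    · obtain ⟨Z, hZ, b, κ, h1⟩ := h j X (a.comp CoprodI.of) C1 (T j)
      exact ⟨Z, hZ, b, κ, h1, fun e' => (e e').elim⟩
  choose Z hZ b κ hA hB using this
  obtain ⟨E, hE, b', κ', h1, h2⟩ := hc Z hZ b κ hA
  refine ⟨E, hE, b', κ', h1, fun z hz => ?_⟩
  obtain ⟨y, hy⟩ := h2 i z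
  exact hB i rfl y (hy g hz)

open Equiv Monoid

theorem loop_false {ι E A : Type} [Group A] (Cp : E → Prop) (idx : ℕ → ι) (x : ℕ → E) (s : ℕ → A)
    (q : FreeGroup (ι × E) →* A) (hidx : ∀ k, idx k ≠ idx (k + 1))
    (hs1 : ∀ k, Cp (x (k + 1)) → s (k + 1) = s k)
    (hs2 : ∀ k, ¬ Cp (x (k + 1)) → s (k + 1) = q ((FreeGroup.of (idx (k + 1), x (k + 1)))⁻¹ *
      FreeGroup.of (idx k, x (k + 1))) * s k) (l n : ℕ)
    (h1 : ∀ k, l < k → k < l + n → x (k + 1) ≠ x k ∧ (Cp (x k) → ¬ Cp (x (k + 1))))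
    (hne : ∃ k, l ≤ k ∧ k < l + n ∧ ¬ Cp (x (k + 1)))
    (hq : ∀ L : List ((ι × E) × Bool), L.length ≤ 2 * n → FreeGroup.IsReduced L → L ≠ [] →
      q (FreeGroup.mk L) ≠ 1) : s (l + n) ≠ s l := by
  have key : ∀ m, m ≤ n → ∃ L : List ((ι × E) × Bool), L.length ≤ 2 * m ∧ FreeGroup.IsReduced L ∧
      s (l + m) = q (FreeGroup.mk L) * s l ∧
      ((L = [] ∧ ∀ k, l ≤ k → k < l + m → Cp (x (k + 1))) ∨
       (¬ Cp (x (l + m)) ∧ ∃ R, L = ((idx (l + m), x (l + m)), false) :: R) ∨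
       (m ≠ 0 ∧ Cp (x (l + m)) ∧ ∃ j y R, j ≠ idx (l + m) ∧ L = ((j, y), false) :: R)) := by
    intro m
    induction m with
    | zero =>
      intro _
      refine ⟨[], by simp, FreeGroup.IsReduced.nil, ?_, Or.inl ⟨rfl, fun k h1 h2 => by omega⟩⟩
      rw [show FreeGroup.mk ([] : List ((ι × E) × Bool)) = 1 from rfl]; simp
    | succ m ih =>
      intro hm
      obtain ⟨L, hL1, hL2, hL3, hL4⟩ := ih (by omega)
      have hm0 : L ≠ [] → m ≠ 0 := by
        rintro h rfl
        exact h (List.length_eq_zero_iff.1 (by omega))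
      by_cases hC : Cp (x (l + m + 1))
      · refine ⟨L, by omega, hL2, by rw [← hL3]; exact hs1 _ hC, ?_⟩
        rcases hL4 with ⟨rfl, h⟩ | ⟨h, R, rfl⟩ | ⟨hm, h, j, y, R, hj, rfl⟩
        · refine Or.inl ⟨rfl, fun k hk1 hk2 => ?_⟩
          rcases Nat.lt_or_ge k (l + m) with hk | hk
          · exact h k hk1 hk
          · rw [show k = l + m by omega]; exact hC
        · exact Or.inr (Or.inr ⟨by omega, hC, _, _, R, hidx _, rfl⟩)
        · exact ((h1 (l + m) (by omega) (by omega)).2 h hC).elim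
      · refine ⟨((idx (l + m + 1), x (l + m + 1)), false) :: ((idx (l + m), x (l + m + 1)), true) :: L,
          by simp; omega, ?_, ?_, Or.inr (Or.inl ⟨hC, _, rfl⟩)⟩
        · rw [FreeGroup.isReduced_cons_cons]
          refine ⟨fun h => (hidx _ (congrArg Prod.fst h).symm).elim, ?_⟩
          rcases hL4 with ⟨rfl, h⟩ | ⟨h, R, rfl⟩ | ⟨hm, h, j, y, R, hj, rfl⟩
          · exact FreeGroup.IsReduced.singleton
          · rw [FreeGroup.isReduced_cons_cons]
            refine ⟨fun h => ?_, hL2⟩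
            have := hm0 (by simp)
            exact ((h1 (l + m) (by omega) (by omega)).1 (congrArg Prod.snd h)).elim
          · rw [FreeGroup.isReduced_cons_cons]
            exact ⟨fun h => (hj (congrArg Prod.fst h).symm).elim, hL2⟩
        · rw [show l + (m + 1) = l + m + 1 by omega, hs2 _ hC, hL3, ← mul_assoc, ← map_mul]
          rfl
  obtain ⟨L, hL1, hL2, hL3, hL4⟩ := key n le_rfl
  intro he
  rw [hL3] at he
  have h0 := hq L hL1 hL2
  have : L ≠ [] := by
    rcases hL4 with ⟨rfl, h⟩ | ⟨h, R, rfl⟩ | ⟨hm, h, j, y, R, hj, rfl⟩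
    · obtain ⟨k, h1, h2, h3⟩ := hne
      exact (h3 (h k h1 h2)).elim
    · simp
    · simp
  exact h0 this (by simpa using he)

theorem Approx.resfin {Γ : Type} [Group Γ] (h : Approx Γ) (S : Finset Γ) :
    ∃ (A : Type) (_ : Group A) (_ : Finite A) (q : Γ →* A), ∀ s ∈ S, s ≠ 1 → q s ≠ 1 := by
  obtain ⟨Z, hZ, b, ι, h1⟩ := h Γ (MulAction.toPermHom Γ Γ) {1} S
  refine ⟨Perm Z, inferInstance, inferInstance, b, fun s hs hs1 hb => hs1 ?_⟩
  have := h1 s hs 1 (by simp) 1 (by simp)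
  rw [hb] at this
  simpa using this

theorem Approx.of_equiv {Γ Δ : Type} [Group Γ] [Group Δ] (h : Approx Γ) (e : Δ ≃* Γ) : Approx Δ := by
  classical
  intro X a C S
  obtain ⟨Z, hZ, b, ι, h1⟩ := h X (a.comp e.symm.toMonoidHom) C (S.image e)
  refine ⟨Z, hZ, b.comp e.toMonoidHom, ι, fun s hs c hc c' hc' => ?_⟩
  simpa using h1 (e s) (Finset.mem_image_of_mem _ hs) c hc c' hc'

theorem free_unit_lerf : LERF (FreeGroup Unit) := by
  apply va_lerf
  refine ⟨⊤, inferInstance, fun x y => Subtype.ext ?_⟩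
  have : ∀ x y : FreeGroup Unit, x * y = y * x := fun x y => by
    apply FreeGroup.freeGroupUnitEquivInt.injective
    obtain ⟨m, rfl⟩ := FreeGroup.freeGroupUnitEquivInt.symm.surjective x
    obtain ⟨n, rfl⟩ := FreeGroup.freeGroupUnitEquivInt.symm.surjective y
    simp only [FreeGroup.freeGroupUnitEquivInt, Equiv.coe_fn_symm_mk]
    rw [← zpow_add, ← zpow_add, add_comm]
  exact this _ _

theorem free_approx (α : Type) [Finite α] : Approx (FreeGroup α) :=
  (fp_approx fun _ => free_unit_lerf.approx).of_equiv freeGroupEquivCoprodI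

/-- partial products -/
def pprod {ι : Type} {G : ι → Type} [∀ i, Group (G i)] (w : ℕ → Σ i, G i) : ℕ → CoprodI G
  | 0 => 1
  | k + 1 => CoprodI.of (w k).2 * pprod w k

theorem cyc_reduced {ι : Type} {G : ι → Type} [∀ i, Group (G i)] (g : CoprodI G) (h1 : g ≠ 1)
    (hg : ∀ t : CoprodI G, ∀ i, ∀ y : G i, t * g * t⁻¹ ≠ CoprodI.of y) :
    ∃ (t : CoprodI G) (n : ℕ) (w : ℕ → Σ i, G i), 2 ≤ n ∧ (∀ k, w (k + n) = w k) ∧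
      (∀ k, (w k).1 ≠ (w (k + 1)).1) ∧ (∀ k, (w k).2 ≠ 1) ∧ t * g * t⁻¹ = pprod w n := by
  classical
  let pr : List (Σ i, G i) → CoprodI G := fun l => (l.map fun p => (CoprodI.of p.2 : CoprodI G)).prod
  have prc : ∀ p l, pr (p :: l) = CoprodI.of p.2 * pr l := fun p l => by simp [pr]
  have pra : ∀ l l', pr (l ++ l') = pr l * pr l' := fun l l' => by simp [pr]
  have hex : ∃ n, ∃ l : List (Σ i, G i), l.length = n ∧ ∃ t, t * g * t⁻¹ = pr l := by
    obtain ⟨l, hl⟩ := coprod_letters g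
    exact ⟨_, l, rfl, 1, by simp [pr, hl]⟩
  obtain ⟨l, hln, t, ht⟩ := Nat.find_spec hex
  have hmin : ∀ l' : List (Σ i, G i), ∀ t', t' * g * t'⁻¹ = pr l' → l.length ≤ l'.length := by
    intro l' t' h'
    rw [hln]
    exact Nat.find_min' hex ⟨l', rfl, t', h'⟩
  have hrot : ∀ l1 l2, ∀ t', t' * g * t'⁻¹ = pr (l1 ++ l2) → ∃ t', t' * g * t'⁻¹ = pr (l2 ++ l1) := by
    intro l1 l2 t' h'
    refine ⟨(pr l1)⁻¹ * t', ?_⟩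
    rw [pra] at h' ⊢
    calc _ = (pr l1)⁻¹ * (t' * g * t'⁻¹) * pr l1 := by group
      _ = _ := by rw [h']; group
  have hone : ∀ p r t', t' * g * t'⁻¹ = pr (p :: r) → r.length + 1 = l.length → p.2 ≠ 1 := by
    intro p r t' h' hr hp
    rw [prc, hp, map_one, one_mul] at h'
    have := hmin r t' h'
    omega
  have htwo : ∀ p p' r t', t' * g * t'⁻¹ = pr (p :: p' :: r) → r.length + 2 = l.length → p.1 ≠ p'.1 := by
    rintro ⟨i, p⟩ ⟨j, p'⟩ r t' h' hr hp
    simp only at hp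
    subst hp
    rw [prc, prc, ← mul_assoc, ← map_mul] at h'
    have := hmin (⟨i, p * p'⟩ :: r) t' (by rw [h', prc])
    simp at this
    omega
  have hlen : 2 ≤ l.length := by
    rcases l with _ | ⟨p, _ | ⟨p', r⟩⟩
    · exfalso
      apply h1
      have h2 : t * g * t⁻¹ = 1 := ht
      have : g = t⁻¹ * (t * g * t⁻¹) * t := by group
      rw [this, h2]; group
    · exact (hg t _ p.2 (by rw [ht, prc]; simp [pr])).elim
    · simp
  set n := l.length with hn
  have hn0 : 0 < n := by omega
  -- letters in order of application : w k = l[n-1-k]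
  let v : ℕ → Σ i, G i := fun k => l.reverse[k % n]'(by simpa [← hn] using Nat.mod_lt k hn0)
  have hrot2 : ∀ k, k < n → ∃ t', t' * g * t'⁻¹ = pr (l.rotate k) := by
    intro k hk
    rw [List.rotate_eq_drop_append_take (by omega)]
    exact hrot (l.take k) (l.drop k) t (by rw [List.take_append_drop]; exact ht)
  have hv : ∀ k, k < n → v k = l[n - 1 - k]'(by omega) := by
    intro k hk
    simp only [v, Nat.mod_eq_of_lt hk, List.getElem_reverse]
    rfl
  have hone' : ∀ k (hk : k < n), (l[k]'(by omega)).2 ≠ 1 := by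
    intro k hk
    obtain ⟨t', h'⟩ := hrot2 k hk
    rw [List.rotate_eq_drop_append_take (by omega), List.drop_eq_getElem_cons (by omega), List.cons_append] at h'
    exact hone _ _ t' h' (by simp; omega)
  have htwo' : ∀ k (hk : k < n), (l[k]'(by omega)).1 ≠ (l[(k + 1) % n]'(Nat.mod_lt _ hn0)).1 := by
    intro k hk
    obtain ⟨t', h'⟩ := hrot2 k hk
    have hlr : (l.rotate k).length = n := by simp [← hn]
    rcases hr : l.rotate k with _ | ⟨p, _ | ⟨p', r⟩⟩
    · simp [hr] at hlr; omega
    · simp [hr] at hlr; omega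
    · have e0 : (l.rotate k)[0]'(by omega) = p := by simp [hr]
      have e1 : (l.rotate k)[1]'(by omega) = p' := by simp [hr]
      rw [List.getElem_rotate] at e0 e1
      simp only [Nat.zero_add, ← hn, Nat.mod_eq_of_lt hk] at e0 e1
      rw [hr] at h' hlr
      have := htwo p p' r t' h' (by simpa using hlr)
      rw [← e0, ← e1] at this
      simpa only [Nat.add_comm 1 k] using this
  refine ⟨t, n, v, hlen, fun k => by simp [v], fun k => ?_, fun k => ?_, ?_⟩
  · have e1 : v k = v (k % n) := by simp [v]
    have e2 : v (k + 1) = v ((k + 1) % n) := by simp [v]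
    have hk := Nat.mod_lt k hn0
    rw [e1, e2, hv _ hk, hv _ (Nat.mod_lt _ hn0)]
    by_cases hkn : k % n + 1 = n
    · have : (k + 1) % n = 0 := by rw [Nat.add_mod, Nat.mod_eq_of_lt (show 1 < n by omega), hkn, Nat.mod_self]
      have h3 := htwo' (n - 1) (by omega)
      simp only [show n - 1 + 1 = n by omega, Nat.mod_self] at h3
      simp only [this, show n - 1 - k % n = 0 by omega, Nat.sub_zero]
      exact h3.symm
    · have : (k + 1) % n = k % n + 1 := by
        rw [Nat.add_mod, Nat.mod_eq_of_lt (show 1 < n by omega), Nat.mod_eq_of_lt (by omega)]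
      have h3 := htwo' (n - 1 - (k % n + 1)) (by omega)
      have h4 : (n - 1 - (k % n + 1) + 1) % n = n - 1 - k % n := by
        rw [Nat.mod_eq_of_lt (by omega)]; omega
      simp only [h4] at h3
      simp only [this]
      exact h3.symm
  · have e1 : v k = v (k % n) := by simp [v]
    rw [e1, hv _ (Nat.mod_lt k hn0)]
    exact hone' _ (by omega)
  · have : ∀ k, k ≤ n → pprod v k = pr (l.drop (n - k)) := by
      intro k
      induction k with
      | zero => intro _; simp [pprod, pr, hn]
      | succ k ih =>
        intro hk
        rw [pprod, ih (by omega), hv k (by omega), List.drop_eq_getElem_cons (by omega) (i := n - (k + 1)), prc]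
        have e : l[n - 1 - k]'(by omega) = l[n - (k + 1)]'(by omega) := by congr 1; omega
        rw [e, show n - (k + 1) + 1 = n - k by omega]
    rw [this n le_rfl, Nat.sub_self, List.drop_zero, ht]

open Equiv Monoid

def RB (Γ : Type) [Group Γ] (g : Γ) : Prop :=
  ∀ (X : Type) (a : Γ →* Perm X) (C : Finset X) (S : Finset Γ), ∃ D : Finset X,
    (∀ x ∈ D, a g x = x) ∧ ∀ (B : Type) (_ : Finite B) (β : Γ →* Perm B) (π : X → B),
      (∀ γ x, π (a γ x) = β γ (π x)) →
      ∃ (Z : Type) (_ : Finite Z) (b : Γ →* Perm Z) (ρ : Z → B) (κ : X → Z),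
        (∀ γ z, ρ (b γ z) = β γ (ρ z)) ∧ (∀ c ∈ C, ρ (κ c) = π c) ∧ Apx a C S b κ ∧
        ∀ z, b g z = z → ∃ x ∈ D, π x = ρ z

theorem two_structs {ι : Type} [Finite ι] {G : ι → Type} [∀ i, Group (G i)] {X : Type} [Nonempty X]
    (a : CoprodI G →* Perm X) (C1 : Finset X) (T : ∀ i, Finset (G i)) (hT : ∀ i, 1 ∈ T i)
    (h : ∀ i, Approx (G i)) :
    ∃ (N : ℕ) (κ : X → Fin N) (α0 α1 : ∀ i, G i →* Perm (Fin N)), Set.InjOn κ C1 ∧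
      (∀ i, Apx (a.comp CoprodI.of) C1 (T i) (α0 i) κ) ∧
      ∀ i, ∀ s ∈ T i, s ≠ 1 → (∀ x, α1 i s x ≠ x) ∧ ∀ c ∈ C1, ∀ c' ∈ C1, α1 i s (κ c) ≠ κ c' := by
  classical
  choose Z hZ b κ hA using fun i => h i X (a.comp CoprodI.of) C1 (T i)
  choose F hF1 hF2 q hq using fun i => (h i).resfin (T i)
  haveI := Fintype.ofFinite ι
  haveI hne : ∀ i, Nonempty (Z i) := fun i => ⟨κ i (Classical.arbitrary X)⟩
  haveI hne' : ∀ i, Nonempty (F i) := fun i => ⟨1⟩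
  let N := (C1.card + 1) * ((∏ i, Nat.card (Z i)) * ∏ i, Nat.card (F i))
  have hpos : 0 < ∏ i, Nat.card (Z i) := Finset.prod_pos fun i _ => Nat.card_pos
  have hpos' : 0 < ∏ i, Nat.card (F i) := Finset.prod_pos fun i _ => Nat.card_pos
  have hNp : 0 < N := Nat.mul_pos (by omega) (Nat.mul_pos hpos hpos')
  have hN : C1.card ≤ N := by
    calc C1.card ≤ (C1.card + 1) * 1 := by omega
      _ ≤ N := Nat.mul_le_mul_left _ (Nat.mul_pos hpos hpos')
  have hM : ∀ i, ∃ M, N = Nat.card (Z i) * (M + 1) := fun i => by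
    obtain ⟨M, hM⟩ : Nat.card (Z i) ∣ N :=
      ((Finset.dvd_prod_of_mem (fun i => Nat.card (Z i)) (Finset.mem_univ i)).mul_right _).mul_left _
    have : M ≠ 0 := by
      rintro rfl
      omega
    exact ⟨M - 1, by rw [hM]; congr 1; omega⟩
  have hM' : ∀ i, ∃ M, C1.card ≤ M ∧ N = Nat.card (F i) * (M + 1) := fun i => by
    obtain ⟨M, hM⟩ : Nat.card (F i) ∣ ∏ i, Nat.card (F i) :=
      Finset.dvd_prod_of_mem (fun i => Nat.card (F i)) (Finset.mem_univ i)
    have hM1 : 0 < M := Nat.pos_of_ne_zero (by rintro rfl; omega)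
    have hP : 0 < (∏ i, Nat.card (Z i)) * M := Nat.mul_pos hpos hM1
    have : C1.card + 1 ≤ (C1.card + 1) * ((∏ i, Nat.card (Z i)) * M) := Nat.le_mul_of_pos_right _ hP
    refine ⟨(C1.card + 1) * ((∏ i, Nat.card (Z i)) * M) - 1, by omega, ?_⟩
    rw [Nat.sub_add_cancel (by omega)]
    simp only [N]
    rw [hM]; ring
  choose M hM using hM
  choose M' hM'1 hM'2 using hM'
  let emb : ∀ K, C1.card ≤ K → 0 < K → X → Fin K := fun K hK h0 x =>
    if hx : x ∈ C1 then Fin.castLE hK (C1.equivFin ⟨x, hx⟩) else ⟨0, h0⟩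
  have hemb : ∀ K hK h0, Set.InjOn (emb K hK h0) C1 := by
    intro K hK h0 c hc c' hc' e
    have hc : c ∈ C1 := hc
    have hc' : c' ∈ C1 := hc'
    simp only [emb, hc, hc', dif_pos] at e
    have := C1.equivFin.injective (Fin.castLE_injective hK e)
    exact congrArg Subtype.val this
  let κ' := emb N hN hNp
  have hκ' := hemb N hN hNp
  have he : ∀ i, ∃ e : Fin N ≃ Z i × Fin (M i + 1), ∀ c ∈ C1, e (κ' c) = (κ i c, 0) := fun i =>
    ext_equiv (by rw [Nat.card_prod, Nat.card_fin, Nat.card_fin, ← hM]) C1 κ' (fun c => (κ i c, 0)) hκ'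
      (fun c hc c' hc' e => (hA i).injOn (hT i) hc hc' (Prod.mk.inj e).1)
  let j : ∀ i, X → Fin (M' i + 1) := fun i => emb _ ((hM'1 i).trans (by omega)) (by omega)
  have hj : ∀ i, Set.InjOn (j i) C1 := fun i => hemb _ _ _
  have he' : ∀ i, ∃ e : Fin N ≃ F i × Fin (M' i + 1), ∀ c ∈ C1, e (κ' c) = (1, j i c) := fun i =>
    ext_equiv (by rw [Nat.card_prod, Nat.card_fin, Nat.card_fin, ← hM'2]) C1 κ' (fun c => (1, j i c)) hκ'
      (fun c hc c' hc' e => hj i hc hc' (Prod.mk.inj e).2)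
  choose e he using he
  choose e' he' using he'
  let α0 : ∀ i, G i →* Perm (Fin N) := fun i =>
    mkAct (fun g x => (e i).symm (b i g (e i x).1, (e i x).2)) (fun z => by simp) (fun γ γ' z => by simp)
  have hα0 : ∀ i g x, α0 i g x = (e i).symm (b i g (e i x).1, (e i x).2) := fun _ _ _ => rfl
  let α1 : ∀ i, G i →* Perm (Fin N) := fun i =>
    mkAct (fun g x => (e' i).symm (q i g * (e' i x).1, (e' i x).2)) (fun z => by simp)
      (fun γ γ' z => by simp [mul_assoc])
  have hα1 : ∀ i g x, α1 i g x = (e' i).symm (q i g * (e' i x).1, (e' i x).2) := fun _ _ _ => rfl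
  refine ⟨N, κ', α0, α1, hκ', fun i s hs c hc c' hc' => ?_, fun i s hs hs1 => ⟨fun x hx => ?_, ?_⟩⟩
  · rw [hα0, symm_apply_eq, he i c hc, he i c' hc', ← hA i s hs c hc c' hc']
    simp
  · rw [hα1, symm_apply_eq] at hx
    exact hq i s hs hs1 (by simpa using congrArg Prod.fst hx)
  · intro c hc c' hc' hx
    rw [hα1, symm_apply_eq, he' i c hc, he' i c' hc'] at hx
    exact hq i s hs hs1 (by simpa using congrArg Prod.fst hx)

theorem RB.conj {Γ : Type} [Group Γ] {g : Γ} (t : Γ) (h : RB Γ (t * g * t⁻¹)) : RB Γ g := by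
  classical
  intro X a C S
  obtain ⟨D, hD, h⟩ := h X a C S
  refine ⟨D.image (a t⁻¹), ?_, fun B hB β π hπ => ?_⟩
  · intro x hx
    obtain ⟨y, hy, rfl⟩ := Finset.mem_image.1 hx
    have := hD y hy
    simp only [map_mul, Perm.mul_apply] at this
    conv_rhs => rw [← this]
    simp
  · obtain ⟨Z, hZ, b, ρ, κ, h1, h2, h3, h4⟩ := h B hB β π hπ
    refine ⟨Z, hZ, b, ρ, κ, h1, h2, h3, fun z hz => ?_⟩
    obtain ⟨x, hx, hxz⟩ := h4 (b t z) (by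
      simp [map_mul, Perm.mul_apply, hz])
    refine ⟨_, Finset.mem_image_of_mem _ hx, ?_⟩
    rw [hπ, hxz, h1]
    simp

theorem fp_rb_aux {ι : Type} [Finite ι] {G : ι → Type} [∀ i, Group (G i)] (h : ∀ i, Approx (G i))
    (n : ℕ) (w : ℕ → Σ i, G i) (hn : 2 ≤ n) (hper : ∀ k, w (k + n) = w k)
    (hidx : ∀ k, (w k).1 ≠ (w (k + 1)).1) (hw1 : ∀ k, (w k).2 ≠ 1) : RB (CoprodI G) (pprod w n) := by
  classical
  intro X a C S
  rcases isEmpty_or_nonempty X with hX | hX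
  · exact ⟨∅, by simp, fun B hB β π hπ => ⟨Empty, inferInstance, 1, fun x => x.elim, fun x => (hX.false x).elim,
      fun _ z => z.elim, fun c => (hX.false c).elim, fun _ _ c => (hX.false c).elim, fun z => z.elim⟩⟩
  obtain ⟨C1, T0, hC, hT0, hcontrol⟩ := path_control a C S
  let T : ∀ i, Finset (G i) := fun i => T0 i ∪ (Finset.range n).image fun k =>
    if h : (w k).1 = i then h ▸ (w k).2 else 1
  have hper' : ∀ k m, w (k + m * n) = w k := by
    intro k m
    induction m with
    | zero => simp
    | succ m ih => rw [Nat.succ_mul, ← add_assoc, hper, ih]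
  have hTw : ∀ k, (w k).2 ∈ T (w k).1 := by
    intro k
    rw [show w k = w (k % n) by
      conv_lhs => rw [← Nat.mod_add_div' k n]
      rw [hper']]
    refine Finset.mem_union_right _ (Finset.mem_image.2 ⟨k % n, Finset.mem_range.2 (Nat.mod_lt _ (by omega)), ?_⟩)
    simp
  obtain ⟨N, κ, α0, α1, hκ, hα0, hα1⟩ := two_structs a C1 T
    (fun i => Finset.mem_union_left _ (hT0 i)) h
  refine ⟨C1.filter fun x => a (pprod w n) x = x, fun x hx => (Finset.mem_filter.1 hx).2, ?_⟩
  intro B hB β π hπ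
  let E := Fin N × B
  let Cp : E → Prop := fun x => ∃ c ∈ C1, x = (κ c, π c)
  haveI : Fintype (ι × E) := Fintype.ofFinite _
  -- separating quotient
  obtain ⟨A, hA, hAf, q, hq⟩ : ∃ (A : Type) (_ : Group A) (_ : Finite A) (q : FreeGroup (ι × E) →* A),
      ∀ L : List ((ι × E) × Bool), L.length ≤ 2 * n → FreeGroup.IsReduced L → L ≠ [] →
      q (FreeGroup.mk L) ≠ 1 := by
    have hfin : {L : List ((ι × E) × Bool) | L.length ≤ 2 * n}.Finite := List.finite_length_le _ _
    obtain ⟨A, hA, hAf, q, hq⟩ := (free_approx (ι × E)).resfin (hfin.toFinset.image FreeGroup.mk)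
    refine ⟨A, hA, hAf, q, fun L hL hr hne => hq _ (Finset.mem_image_of_mem _ (by simpa using hL)) ?_⟩
    intro h1
    have := congrArg FreeGroup.toWord h1
    rw [FreeGroup.toWord_mk, FreeGroup.toWord_one, hr.reduce_eq] at this
    exact hne this
  let f : ι → E → A := fun i x => if Cp x then 1 else q (FreeGroup.of (i, x))
  have hf1 : ∀ i x, Cp x → f i x = 1 := fun i x hx => if_pos hx
  have hf2 : ∀ i x, ¬ Cp x → f i x = q (FreeGroup.of (i, x)) := fun i x hx => if_neg hx
  let αB : A → ∀ i, G i → E → E := fun s i γ x =>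
    (if s = 1 then α0 i γ x.1 else α1 i γ x.1, β (CoprodI.of γ) x.2)
  have hαB1 : ∀ s i x, αB s i 1 x = x := fun s i x => by simp [αB]
  have hαBm : ∀ s i γ γ' x, αB s i (γ * γ') x = αB s i γ (αB s i γ' x) := fun s i γ γ' x => by
    by_cases hs : s = 1 <;> simp [αB, hs]
  let F : ∀ i, G i → E × A → E × A := fun i γ z =>
    (αB ((f i z.1)⁻¹ * z.2) i γ z.1, f i (αB ((f i z.1)⁻¹ * z.2) i γ z.1) * ((f i z.1)⁻¹ * z.2))
  let bi : ∀ i, G i →* Perm (E × A) := fun i => mkAct (F i)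
    (fun z => by simp [F, hαB1]) (fun γ γ' z => by simp [F, hαBm])
  let b : CoprodI G →* Perm (E × A) := CoprodI.lift bi
  have hb : ∀ i (g : G i) z, b (CoprodI.of g) z = F i g z := fun i g z => by
    simp only [b, CoprodI.lift_of]; rfl
  have hFρ : ∀ i (g : G i) z, (F i g z).1.2 = β (CoprodI.of g) z.1.2 := fun i g z => rfl
  let κ' : X → E × A := fun x => ((κ x, π x), 1)
  refine ⟨E × A, inferInstance, b, fun z => z.1.2, κ', ?_, fun c _ => rfl, ?_, ?_⟩
  · intro γ
    induction γ using CoprodI.induction_on with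
    | one => intro z; simp
    | of i g => intro z; rw [hb]
    | mul x y hx hy => intro z; rw [map_mul, map_mul, Perm.mul_apply, Perm.mul_apply, hx, hy]
  · refine hcontrol _ b κ' (fun c hc c' hc' e => hκ hc hc' ?_) ?_
    · exact congrArg (fun z : E × A => z.1.1) e
    · intro i s hs c hc hsc
      have hc1 : Cp (κ c, π c) := ⟨c, hc, rfl⟩
      have hc2 : Cp (κ (a (CoprodI.of s) c), π (a (CoprodI.of s) c)) := ⟨_, hsc, rfl⟩
      have h0 : α0 i s (κ c) = κ (a (CoprodI.of s) c) :=
        (hα0 i s (Finset.mem_union_left _ hs) c hc _ hsc).2 rfl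
      have h1 : αB 1 i s (κ c, π c) = (κ (a (CoprodI.of s) c), π (a (CoprodI.of s) c)) := by
        simp [αB, h0, hπ]
      rw [hb]
      simp only [F, κ', hf1 i _ hc1, inv_one, one_mul, h1, hf1 i _ hc2]
  · intro z0 hz0
    let z : ℕ → E × A := fun k => b (pprod w k) z0
    have hz : ∀ k, z (k + 1) = F (w k).1 (w k).2 (z k) := fun k => by
      simp only [z, pprod, map_mul, Perm.mul_apply, hb]
    have hzper : ∀ k, z (k + n) = z k := by
      intro k
      induction k with
      | zero => simp only [Nat.zero_add, z, hz0, pprod, map_one, Perm.one_apply]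
      | succ k ih => rw [show k + 1 + n = k + n + 1 by omega, hz, hz, ih, hper]
    let x : ℕ → E := fun k => (z k).1
    let s : ℕ → A := fun k => (f (w k).1 (x k))⁻¹ * (z k).2
    have hx : ∀ k, x (k + 1) = αB (s k) (w k).1 (w k).2 (x k) := fun k => by
      simp only [x, hz k]; rfl
    have ha : ∀ k, (z (k + 1)).2 = f (w k).1 (x (k + 1)) * s k := fun k => by
      rw [hx k, hz k]
    have hs : ∀ k, s (k + 1) = (f (w (k + 1)).1 (x (k + 1)))⁻¹ * f (w k).1 (x (k + 1)) * s k := fun k => by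
      simp only [s]; rw [ha k]; simp only [s, mul_assoc]
    have hsper : ∀ k, s (k + n) = s k := fun k => by simp only [s, x, hzper, hper]
    have hs1 : ∀ k, Cp (x (k + 1)) → s (k + 1) = s k := fun k hk => by
      rw [hs, hf1 _ _ hk, hf1 _ _ hk]; simp
    have hs2 : ∀ k, ¬ Cp (x (k + 1)) → s (k + 1) = q ((FreeGroup.of ((w (k + 1)).1, x (k + 1)))⁻¹ *
        FreeGroup.of ((w k).1, x (k + 1))) * s k := fun k hk => by
      rw [hs, hf2 _ _ hk, hf2 _ _ hk, map_mul, map_inv]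
    have hmove : ∀ k, s k ≠ 1 → x (k + 1) ≠ x k ∧ (Cp (x k) → ¬ Cp (x (k + 1))) := by
      intro k hk
      obtain ⟨m1, m2⟩ := hα1 _ _ (hTw k) (hw1 k)
      rw [hx]
      constructor
      · intro e
        have := congrArg Prod.fst e
        simp only [αB, if_neg hk] at this
        exact m1 _ this
      · rintro ⟨c, hc, e⟩ ⟨c', hc', e'⟩
        have := congrArg Prod.fst e'
        simp only [αB, if_neg hk, e] at this
        exact m2 c hc c' hc' this
    have loop : ∀ l m, m ≤ n → (∀ k, l < k → k < l + m → s k ≠ 1) →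
        (∃ k, l ≤ k ∧ k < l + m ∧ ¬ Cp (x (k + 1))) → s (l + m) ≠ s l := by
      intro l m hm h1 h2
      exact loop_false Cp (fun k => (w k).1) x s q hidx hs1 hs2 l m (fun k hk1 hk2 => hmove k (h1 k hk1 hk2)) h2
        (fun L hL => hq L (by omega))
    have step : ∀ k, s k = 1 → Cp (x (k + 1)) := by
      intro k hk
      by_contra hc
      have hex : ∃ m, s (k + 1 + m) = 1 := ⟨n - 1, by rw [show k + 1 + (n - 1) = k + n by omega, hsper, hk]⟩
      have hle : Nat.find hex ≤ n - 1 :=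
        Nat.find_min' hex (by rw [show k + 1 + (n - 1) = k + n by omega, hsper, hk])
      refine loop k (Nat.find hex + 1) (by omega) (fun j hj1 hj2 hj => ?_) ⟨k, le_rfl, by omega, hc⟩ ?_
      · exact Nat.find_min hex (m := j - (k + 1)) (by omega) (by rw [show k + 1 + (j - (k + 1)) = j by omega]; exact hj)
      · have := Nat.find_spec hex
        rw [show k + (Nat.find hex + 1) = k + 1 + Nat.find hex by omega, this, hk]
    obtain ⟨k0, hk0⟩ : ∃ k, s k = 1 := by
      by_contra hno
      push Not at hno
      refine loop 0 n le_rfl (fun k _ _ => hno k) ?_ (by rw [hsper])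
      by_contra hc
      push Not at hc
      exact (hmove 1 (hno 1)).2 (hc 0 le_rfl (by omega)) (hc 1 (by omega) (by omega))
    have hall : ∀ m, s (k0 + m) = 1 := by
      intro m
      induction m with
      | zero => exact hk0
      | succ m ih => rw [← add_assoc, hs1 _ (step _ ih), ih]
    have hzper' : ∀ k m, s (k + m * n) = s k := by
      intro k m
      induction m with
      | zero => simp
      | succ m ih => rw [Nat.succ_mul, ← add_assoc, hsper, ih]
    have hall' : ∀ k, s k = 1 := by
      intro k
      rw [← hzper' k k0]
      have : k0 ≤ k + k0 * n := by nlinarith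
      rw [show k + k0 * n = k0 + (k + k0 * n - k0) by omega]
      exact hall _
    have hCp : ∀ k, Cp (x k) := by
      intro k
      have h1 := step (k + (n - 1)) (hall' _)
      have h2 : x (k + (n - 1) + 1) = x k := by
        rw [show k + (n - 1) + 1 = k + n by omega]; simp only [x, hzper]
      rwa [h2] at h1
    choose c hc hxc using hCp
    have hcs : ∀ k, a (CoprodI.of (w k).2) (c k) = c (k + 1) := by
      intro k
      refine (hα0 _ _ (hTw k) _ (hc k) _ (hc (k + 1))).1 ?_
      have := congrArg Prod.fst (hx k)
      rw [hxc, hxc k] at this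
      simp only [αB, hall' k, if_pos] at this
      exact this.symm
    have hcp : ∀ k, a (pprod w k) (c 0) = c k := by
      intro k
      induction k with
      | zero => simp [pprod]
      | succ k ih => rw [pprod, map_mul, Perm.mul_apply, ih, hcs]
    refine ⟨c 0, Finset.mem_filter.2 ⟨hc 0, ?_⟩, ?_⟩
    · rw [hcp n]
      apply hκ (hc n) (hc 0)
      have : x n = x 0 := by simpa [x] using congrArg Prod.fst (hzper 0)
      rw [hxc n, hxc 0] at this
      exact congrArg Prod.fst this
    · have : x 0 = z0.1 := by simp [x, z, pprod]
      show π (c 0) = z0.1.2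
      rw [← this, hxc 0]

theorem fp_rb {ι : Type} [Finite ι] {G : ι → Type} [∀ i, Group (G i)] (h : ∀ i, Approx (G i))
    (g : CoprodI G) (h1 : g ≠ 1)
    (hg : ∀ t : CoprodI G, ∀ i, ∀ y : G i, t * g * t⁻¹ ≠ CoprodI.of y) : RB (CoprodI G) g := by
  obtain ⟨t, n, w, hn, h2, h3, h4, h5⟩ := cyc_reduced g h1 hg
  refine RB.conj t ?_
  rw [h5]
  exact fp_rb_aux h n w hn h2 h3 h4

theorem RB.cdx {Γ : Type} [Group Γ] {g : Γ} (h : RB Γ g) : CDX Γ g := by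
  intro X a C S hx
  obtain ⟨D, hD, h⟩ := h X a C S
  obtain ⟨Z, hZ, b, ρ, κ, -, -, h1, h2⟩ := h Unit inferInstance 1 (fun _ => ()) (by simp)
  refine ⟨Z, hZ, b, κ, h1, fun z hz => ?_⟩
  obtain ⟨x, hxD, -⟩ := h2 z hz
  exact hx x (hD x hxD)

theorem RB.of_equiv {Γ Δ : Type} [Group Γ] [Group Δ] (e : Δ ≃* Γ) {g : Δ} (h : RB Γ (e g)) : RB Δ g := by
  classical
  intro X a C S
  obtain ⟨D, hD, h⟩ := h X (a.comp e.symm.toMonoidHom) C (S.image e)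
  refine ⟨D, by simpa using hD, fun B hB β π hπ => ?_⟩
  obtain ⟨Z, hZ, b, ρ, κ, h1, h2, h3, h4⟩ := h B hB (β.comp e.symm.toMonoidHom) π (fun γ x => hπ _ _)
  refine ⟨Z, hZ, b.comp e.toMonoidHom, ρ, κ, fun γ z => ?_, h2, fun s hs c hc c' hc' => ?_, h4⟩
  · simpa using h1 (e γ) z
  · simpa using h3 (e s) (Finset.mem_image_of_mem _ hs) c hc c' hc'

/-- retracts -/
theorem RB.retract {Γ Δ : Type} [Group Γ] [Group Δ] (j : Δ →* Γ) (r : Γ →* Δ) (hr : ∀ x, r (j x) = x)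
    {g : Δ} (h : RB Γ (j g)) : RB Δ g := by
  classical
  intro X a C S
  obtain ⟨D, hD, h⟩ := h X (a.comp r) C (S.image j)
  refine ⟨D, by simpa [hr] using hD, fun B hB β π hπ => ?_⟩
  obtain ⟨Z, hZ, b, ρ, κ, h1, h2, h3, h4⟩ := h B hB (β.comp r) π (fun γ x => hπ _ _)
  refine ⟨Z, hZ, b.comp j, ρ, κ, fun γ z => ?_, h2, fun s hs c hc c' hc' => ?_, h4⟩
  · simpa [hr] using h1 (j γ) z
  · simpa [hr] using h3 (j s) (Finset.mem_image_of_mem _ hs) c hc c' hc'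

theorem free_rb (α : Type) [Finite α] (g : FreeGroup α) (hg : g ≠ 1) : RB (FreeGroup α) g := by
  classical
  let j : FreeGroup α →* FreeGroup (α × Bool) :=
    FreeGroup.lift fun a => FreeGroup.of (a, true) * FreeGroup.of (a, false)
  let r : Bool → FreeGroup (α × Bool) →* FreeGroup α := fun ε =>
    FreeGroup.lift fun p => if p.2 = ε then FreeGroup.of p.1 else 1
  have hr : ∀ ε x, r ε (j x) = x := by
    intro ε x
    have : (r ε).comp j = MonoidHom.id _ := by
      ext a
      cases ε <;> simp [r, j]
    exact DFunLike.congr_fun this x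
  refine RB.retract j (r true) (hr true) (RB.of_equiv freeGroupEquivCoprodI (fp_rb
    (fun _ => free_unit_lerf.approx) _ ?_ ?_))
  · intro h
    rw [map_eq_one_iff _ freeGroupEquivCoprodI.injective] at h
    apply hg
    rw [← hr true g, h, map_one]
  · rintro t ⟨i, ε⟩ y e
    have e2 := congrArg (fun z => r (!ε) (freeGroupEquivCoprodI.symm z)) e
    have h3 : ∀ y : FreeGroup Unit, r (!ε) (freeGroupEquivCoprodI.symm
        (CoprodI.of (M := fun _ : α × Bool => FreeGroup Unit) (i := (i, ε)) y)) = 1 := by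
      intro y
      have : ((r (!ε)).comp (freeGroupEquivCoprodI.symm.toMonoidHom)).comp
          (CoprodI.of (M := fun _ : α × Bool => FreeGroup Unit) (i := (i, ε))) = 1 := by
        ext u
        simp [freeGroupEquivCoprodI, r]
      exact DFunLike.congr_fun this y
    simp only [h3, map_mul, map_inv, MulEquiv.symm_apply_apply, hr] at e2
    rw [mul_inv_eq_one, mul_eq_left] at e2
    exact hg e2

open Equiv Monoid

theorem fg_comap {Δ Γ : Type} [Group Δ] [Group Γ] (j : Δ →* Γ) (hj : Function.Injective j)
    (hr : j.range.FiniteIndex) (L : Subgroup Γ) (hL : L.FG) : (L.comap j).FG := by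
  haveI : Group.FG L := (Group.fg_iff_subgroup_fg _).2 hL
  haveI h1 : Group.FG (j.range.subgroupOf L) := Subgroup.fg_of_index_ne_zero _
  rw [← Group.fg_iff_subgroup_fg]
  have hmem : ∀ x : j.range.subgroupOf L, ∃ y : Δ, j y = (x : L) := fun x => x.2
  choose f hf using hmem
  let F : j.range.subgroupOf L →* L.comap j :=
    { toFun := fun x => ⟨f x, by show j (f x) ∈ L; rw [hf]; exact x.1.2⟩
      map_one' := by ext; apply hj; simp [hf]
      map_mul' := fun x y => by ext; apply hj; simp [hf] }
  refine Group.fg_of_surjective (f := F) fun y => ?_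
  refine ⟨⟨⟨j y, y.2⟩, ⟨y, rfl⟩⟩, ?_⟩
  ext; apply hj; simp [F, hf]

theorem ext_map {Δ Γ : Type} [Group Δ] [Group Γ] (j : Δ →* Γ) (hj : Function.Injective j)
    (hr : j.range.FiniteIndex) (H : Subgroup Γ) (hH : H.FG) (A : Γ →* Perm (Γ ⧸ H))
    (hA : ∀ γ x, A γ x = γ • x) (C0 : Finset (Γ ⧸ H)) :
    ∃ (C : Finset (Γ ⧸ H)) (S : Finset Δ), C0 ⊆ C ∧ 1 ∈ S ∧
      ∀ (Z : Type) (b : Δ →* Perm Z) (κ : Γ ⧸ H → Z), Apx (A.comp j) C S b κ →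
        ∃ θ : Γ ⧸ H → Z, (∀ γ x, θ (A (j γ) x) = b γ (θ x)) ∧ (∀ c ∈ C0, θ c = κ c) ∧
          ∀ x, ∃ u, ∃ r ∈ C, A (j u) r = x ∧ θ x = b u (κ r) := by
  classical
  obtain ⟨rep, u, hu, hrep⟩ := orbit_reps (A.comp j)
  simp only [MonoidHom.comp_apply] at hu hrep
  -- finitely many reps
  have hfin : (Set.range rep).Finite := by
    haveI : Finite (Γ ⧸ j.range) := Subgroup.finite_quotient_of_finiteIndex
    have : ∀ q : Γ ⧸ j.range, ∃ r, ∀ γ : Γ, ((γ⁻¹ : Γ) : Γ ⧸ j.range) = q → rep (γ : Γ ⧸ H) = r := by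
      intro q
      induction q using QuotientGroup.induction_on with
      | H q =>
        refine ⟨rep ((q⁻¹ : Γ) : Γ ⧸ H), fun γ h => ?_⟩
        have h := QuotientGroup.eq.1 h
        obtain ⟨k, hk⟩ := h
        have : A (j k) ((q⁻¹ : Γ) : Γ ⧸ H) = (γ : Γ ⧸ H) := by
          rw [hA, hk]
          show ((_ : Γ) : Γ ⧸ H) = _
          congr 1
          show γ⁻¹⁻¹ * q * q⁻¹ = γ
          group
        rw [← this, hrep]
    choose r hr using this
    refine (Set.finite_range r).subset ?_
    rintro _ ⟨x, rfl⟩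
    induction x using QuotientGroup.induction_on with
    | H x => exact ⟨_, (hr _ x rfl).symm⟩
  -- stabilizers
  have hst : ∀ x : Γ ⧸ H, ∃ T : Finset Δ, (∀ t ∈ T, A (j t) x = x) ∧
      ∀ γ, A (j γ) x = x → γ ∈ Subgroup.closure (T : Set Δ) := by
    intro x
    induction x using QuotientGroup.induction_on with
    | H x =>
      have hK : (H.map (MulAut.conj x).toMonoidHom).FG := by
        obtain ⟨T, hT⟩ := hH
        refine ⟨T.image (MulAut.conj x).toMonoidHom, ?_⟩
        rw [Finset.coe_image, ← MonoidHom.map_closure, hT]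
      obtain ⟨T, hT⟩ := fg_comap j hj hr _ hK
      have key : ∀ γ, A (j γ) (x : Γ ⧸ H) = x ↔ γ ∈ Subgroup.closure (T : Set Δ) := by
        intro γ
        rw [hT, hA]
        change ((j γ * x : Γ) : Γ ⧸ H) = _ ↔ _
        rw [eq_comm, QuotientGroup.eq, Subgroup.mem_comap, Subgroup.mem_map]
        constructor
        · intro h; exact ⟨_, h, by simp [mul_assoc]⟩
        · rintro ⟨h, hh, e⟩
          rw [← e]; simpa [mul_assoc] using hh
      exact ⟨T, fun t ht => (key t).2 (Subgroup.subset_closure ht), fun γ => (key γ).1⟩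
  choose T hT1 hT2 using hst
  let R := hfin.toFinset
  refine ⟨C0 ∪ R, insert 1 (R.biUnion T ∪ C0.image u), Finset.subset_union_left, by simp, ?_⟩
  intro Z b κ hap
  have hRm : ∀ x, rep x ∈ C0 ∪ R := fun x => by simp [R]
  have hstab : ∀ x γ, A (j γ) (rep x) = rep x → b γ (κ (rep x)) = κ (rep x) := by
    intro x γ h
    have : Subgroup.closure (T (rep x) : Set Δ) ≤ (MulAction.stabilizer (Perm Z) (κ (rep x))).comap b := by
      rw [Subgroup.closure_le]
      intro t ht
      refine (hap t ?_ _ (hRm x) _ (hRm x)).2 (hT1 _ t ht)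
      exact Finset.mem_insert_of_mem (Finset.mem_union_left _ (Finset.mem_biUnion.2 ⟨rep x, by simp [R], ht⟩))
    exact this (hT2 _ _ h)
  have hgen : ∀ x γ, A (j γ) (rep x) = x → b γ (κ (rep x)) = b (u x) (κ (rep x)) := by
    intro x γ h
    have := hstab x ((u x)⁻¹ * γ) (by
      rw [map_mul, map_mul, Perm.mul_apply, h, map_inv, map_inv, Perm.inv_eq_iff_eq, hu])
    rw [map_mul, Perm.mul_apply, map_inv, Perm.inv_eq_iff_eq] at this
    exact this
  refine ⟨fun x => b (u x) (κ (rep x)), ?_, ?_, fun x => ⟨u x, rep x, hRm x, hu x, rfl⟩⟩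
  · intro γ x
    show b (u (A (j γ) x)) (κ (rep (A (j γ) x))) = _
    rw [← hgen (A (j γ) x) (γ * u x)]
    · rw [hrep, map_mul, Perm.mul_apply]
    · rw [hrep, map_mul, map_mul, Perm.mul_apply, hu]
  · intro c hc
    refine (hap (u c) ?_ _ (hRm c) c (by simp [hc])).2 (hu c)
    exact Finset.mem_insert_of_mem (Finset.mem_union_right _ (Finset.mem_image_of_mem _ hc))

theorem core_exists {Δ Γ Z : Type} [Group Δ] [Group Γ] [Finite Z] (j : Δ →* Γ)
    (hr : j.range.FiniteIndex) (b : Δ →* Perm Z) :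
    ∃ N : Subgroup Γ, N.Normal ∧ N.FiniteIndex ∧ ∀ n ∈ N, ∃ k, j k = n ∧ b k = 1 := by
  have h1 : b.ker.FiniteIndex := inferInstance
  have h2 : (b.ker.map j).FiniteIndex := by
    constructor
    rw [Subgroup.index_map]
    haveI : (b.ker ⊔ j.ker).FiniteIndex := Subgroup.finiteIndex_of_le le_sup_left
    exact mul_ne_zero Subgroup.FiniteIndex.index_ne_zero Subgroup.FiniteIndex.index_ne_zero
  refine ⟨(b.ker.map j).normalCore, inferInstance, inferInstance, fun n hn => ?_⟩
  obtain ⟨k, hk, e⟩ := Subgroup.normalCore_le _ hn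
  exact ⟨k, e, hk⟩

theorem sup_mem {Γ : Type} [Group Γ] (H N : Subgroup Γ) (hN : N.Normal) (A : Γ →* Perm (Γ ⧸ H))
    (hA : ∀ γ x, A γ x = γ • x) (x γ : Γ) (h : x⁻¹ * γ * x ∈ H ⊔ N) :
    ∃ n ∈ N, A γ (x : Γ ⧸ H) = A n (x : Γ ⧸ H) := by
  rw [sup_comm, Subgroup.mem_sup_of_normal_left] at h
  obtain ⟨n, hn, k, hk, e⟩ := h
  refine ⟨x * n * x⁻¹, hN.conj_mem n hn x, ?_⟩
  rw [hA, hA]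
  change ((γ * x : Γ) : Γ ⧸ H) = ((x * n * x⁻¹ * x : Γ) : Γ ⧸ H)
  rw [eq_comm, QuotientGroup.eq]
  have : (x * n * x⁻¹ * x)⁻¹ * (γ * x) = n⁻¹ * (x⁻¹ * γ * x) := by group
  rw [this, ← e]; simpa using hk

theorem lerf_of_fi {Δ Γ : Type} [Group Δ] [Group Γ] (j : Δ →* Γ) (hj : Function.Injective j)
    (hr : j.range.FiniteIndex) (h : Approx Δ) : LERF Γ := by
  classical
  intro H hH γ hγ
  obtain ⟨A, hA⟩ := cosetHom_exists H
  obtain ⟨C, S, hC, hS, hext⟩ := ext_map j hj hr H hH A hA {((1 : Γ) : Γ ⧸ H), (γ : Γ ⧸ H)}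
  obtain ⟨Z, hZ, b, κ, hap⟩ := h _ (A.comp j) C S
  obtain ⟨θ, h1, h2, -⟩ := hext Z b κ hap
  obtain ⟨N, hN1, hN2, hN3⟩ := core_exists j hr b
  refine ⟨H ⊔ N, le_sup_left, Subgroup.finiteIndex_of_le le_sup_right, fun hm => ?_⟩
  obtain ⟨n, hn, e⟩ := sup_mem H N hN1 A hA 1 γ (by simpa using hm)
  obtain ⟨k, rfl, hk⟩ := hN3 n hn
  have e1 : A γ ((1 : Γ) : Γ ⧸ H) = (γ : Γ ⧸ H) := by
    rw [hA]; change ((γ * 1 : Γ) : Γ ⧸ H) = _; rw [mul_one]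
  have e2 := congrArg θ e
  rw [e1, h1, hk, h2 _ (by simp), h2 _ (by simp)] at e2
  have := (hap 1 hS _ (hC (by simp)) _ (hC (by simp))).1 (e2.symm ▸ (by simp) : b 1 (κ (γ : Γ ⧸ H)) = κ ((1 : Γ) : Γ ⧸ H))
  simp only [map_one, Perm.coe_one, id] at this
  rw [eq_comm, QuotientGroup.eq] at this
  exact hγ (by simpa using this)

theorem fix_coset {Γ : Type} [Group Γ] (H : Subgroup Γ) (A : Γ →* Perm (Γ ⧸ H))
    (hA : ∀ γ x, A γ x = γ • x) (γ x : Γ) : A γ (x : Γ ⧸ H) = x ↔ x⁻¹ * γ * x ∈ H := by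
  rw [hA]
  change ((γ * x : Γ) : Γ ⧸ H) = _ ↔ _
  rw [eq_comm, QuotientGroup.eq, mul_assoc]

theorem cd_of_fi_cdx {Δ Γ : Type} [Group Δ] [Group Γ] (j : Δ →* Γ) (hj : Function.Injective j)
    (hr : j.range.FiniteIndex) (t : Δ) (h : CDX Δ t) : CD Γ (j t) := by
  intro H hH hx
  obtain ⟨A, hA⟩ := cosetHom_exists H
  obtain ⟨C, S, hC, hS, hext⟩ := ext_map j hj hr H hH A hA ∅
  obtain ⟨Z, hZ, b, κ, hap, hfix⟩ := h _ (A.comp j) C S (fun x => by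
    induction x using QuotientGroup.induction_on with
    | H x => exact fun e => hx x ((fix_coset H A hA _ _).1 e))
  obtain ⟨θ, h1, h2, -⟩ := hext Z b κ hap
  obtain ⟨N, hN1, hN2, hN3⟩ := core_exists j hr b
  refine ⟨H ⊔ N, le_sup_left, Subgroup.finiteIndex_of_le le_sup_right, fun x hm => ?_⟩
  obtain ⟨n, hn, e⟩ := sup_mem H N hN1 A hA x _ hm
  obtain ⟨k, rfl, hk⟩ := hN3 n hn
  have e2 := congrArg θ e
  rw [h1, h1, hk] at e2
  exact hfix _ e2

theorem cd_of_fi_rb {Δ Γ : Type} [Group Δ] [Group Γ] (j : Δ →* Γ) (hj : Function.Injective j)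
    (hr : j.range.FiniteIndex) (hL : LERF Γ) (g : Γ) (d : ℕ) (w : Δ) (hw : j w = g ^ d) (h : RB Δ w) :
    CD Γ g := by
  classical
  intro H hH hx
  obtain ⟨A, hA⟩ := cosetHom_exists H
  obtain ⟨C, S, hC, hS, hext⟩ := ext_map j hj hr H hH A hA ∅
  obtain ⟨D, hD, hRB⟩ := h _ (A.comp j) C S
  obtain ⟨K0, hK1, hK2, hK3⟩ := finite_avoid hL H hH (D.image fun x => x.out⁻¹ * g * x.out) (by
    intro t ht
    obtain ⟨x, -, rfl⟩ := Finset.mem_image.1 ht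
    exact hx _)
  obtain ⟨A0, hA0⟩ := cosetHom_exists K0
  let π : Γ ⧸ H → Γ ⧸ K0 := Subgroup.quotientMapOfLE hK1
  have hπ : ∀ γ x, π (A γ x) = A0 γ (π x) := by
    intro γ x
    induction x using QuotientGroup.induction_on with
    | H x => rw [hA, hA0]; rfl
  obtain ⟨Z, hZ, b, ρ, κ, h1, h2, h3, h4⟩ := hRB (Γ ⧸ K0) Subgroup.finite_quotient_of_finiteIndex
    (A0.comp j) π (fun γ x => hπ _ _)
  obtain ⟨θ, k1, -, k3⟩ := hext Z b κ h3
  have hρ : ∀ x, ρ (θ x) = π x := by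
    intro x
    obtain ⟨u, r, hr, e1, e2⟩ := k3 x
    rw [e2, h1, h2 r hr, ← e1, hπ]; rfl
  obtain ⟨N, hN1, hN2, hN3⟩ := core_exists j hr b
  let M := N ⊓ K0.normalCore
  refine ⟨H ⊔ M, le_sup_left, Subgroup.finiteIndex_of_le (H := M) le_sup_right, fun x hm => ?_⟩
  obtain ⟨n, hn, e⟩ := sup_mem H M inferInstance A hA x _ hm
  have hpow : ∀ i : ℕ, ∃ n ∈ M, A (g ^ i) (x : Γ ⧸ H) = A n (x : Γ ⧸ H) := by
    intro i
    induction i with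
    | zero => exact ⟨1, one_mem _, by simp⟩
    | succ i ih =>
      obtain ⟨n', hn', e'⟩ := ih
      refine ⟨(g ^ i * n * (g ^ i)⁻¹) * n', mul_mem (Subgroup.Normal.conj_mem inferInstance n hn _) hn', ?_⟩
      rw [pow_succ, map_mul, Perm.mul_apply, e, map_mul A (_ * _ * _), Perm.mul_apply, ← e']
      simp [map_mul]
  obtain ⟨n', hn', e'⟩ := hpow d
  obtain ⟨k, hk, hbk⟩ := hN3 n' hn'.1
  have e2 := congrArg θ e'
  rw [← hw, k1, ← hk, k1, hbk] at e2
  obtain ⟨x', hx', e3⟩ := h4 _ e2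
  rw [hρ] at e3
  have e4 : A0 g (π x) = π x := by
    rw [← hπ, e, hπ]
    have : π (x : Γ ⧸ H) = (x : Γ ⧸ K0) := rfl
    rw [this, fix_coset K0 A0 hA0]
    exact K0.normalCore_le (by simpa using Subgroup.Normal.conj_mem inferInstance n hn.2 x⁻¹)
  rw [← e3] at e4
  refine hK3 _ (Finset.mem_image_of_mem _ hx') ?_
  rw [← fix_coset K0 A0 hA0]
  have : π x' = (x'.out : Γ ⧸ K0) := by
    conv_lhs => rw [← QuotientGroup.out_eq' x']
    rfl
  rw [← this]; exact e4

open Equiv Monoid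

def TreeLike {V : Type} (E : V → V → Prop) : Prop :=
  (∀ u v, E u v → ¬ E v u) ∧ ∀ r, ∃ n : V → ℕ, (∀ v, v ≠ r → ∃ u, (E u v ∨ E v u) ∧ n u < n v) ∧
    (∀ u v, E u v → n u ≠ n v) ∧ n r = 0 ∧
    ∀ v u u', (E u v ∨ E v u) → (E u' v ∨ E v u') → n u < n v → n u' < n v → u = u'

def Ult {P : Type} [PartialOrder P] (st : P → P) (o : Set P) : Prop :=
  (∀ a, a ∈ o ↔ st a ∉ o) ∧ ∀ a ∈ o, ∀ b, a ≤ b → b ∈ o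

def flip1 {P : Type} (st : P → P) (o : Set P) (a : P) : Set P := (o \ {a}) ∪ {st a}

theorem ult_diff {P : Type} [PartialOrder P] {st : P → P} (st2 : ∀ a, st (st a) = a)
    {o o' : Set P} (ho : Ult st o) (ho' : Ult st o') (h : (o \ o').Finite) : (o' \ o).Finite := by
  refine (h.image st).subset ?_
  rintro a ⟨h1, h2⟩
  refine ⟨st a, ⟨?_, ?_⟩, st2 a⟩
  · by_contra h; exact h2 ((ho.1 a).2 h)
  · exact (ho'.1 a).1 h1

theorem flip_ult {P : Type} [PartialOrder P] {st : P → P} (st2 : ∀ a, st (st a) = a)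
    (anti : ∀ a b, a ≤ b → st b ≤ st a) (ne : ∀ a, ¬ a ≤ st a) {o : Set P} (ho : Ult st o) {m : P}
    (hm : m ∈ o) (hmin : ∀ b ∈ o, b ≤ m → b = m) : Ult st (flip1 st o m) := by
  have nes : ∀ a, st a ≠ a := fun a h => ne a (by rw [h])
  have sti : ∀ a b, st a = st b → a = b := fun a b h => by rw [← st2 a, h, st2]
  constructor
  · intro a
    simp only [flip1, Set.mem_union, Set.mem_sdiff, Set.mem_singleton_iff]
    have h1 := ho.1 a
    have h2 := sti a m
    have h3 : st a = m ↔ a = st m := ⟨fun h => by rw [← h, st2], fun h => by rw [h, st2]⟩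
    by_cases ha : a = m
    · subst ha
      simp [nes, (nes a).symm, hm, h1.1 hm]
    · by_cases hb : a = st m
      · subst hb
        simp [st2, nes, (nes m).symm]
      · have : ¬ st a = st m := fun h => ha (h2 h)
        have : ¬ st a = m := fun h => hb (h3.1 h)
        tauto
  · rintro b (⟨hb, hbm⟩ | hb) c hbc
    · by_cases hc : c = m
      · subst hc; exact absurd (hmin b hb hbc) hbm
      · exact Or.inl ⟨ho.2 b hb c hbc, hc⟩
    · have hb : b = st m := hb
      subst hb
      by_cases hc : c ∈ o
      · refine Or.inl ⟨hc, fun h => ?_⟩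
        have h : c = m := h
        subst h
        exact ne (st c) (by rwa [st2])
      · right
        have h1 : st c ∈ o := by by_contra h; exact hc ((ho.1 c).2 h)
        have h2 := hmin _ h1 (by have := anti _ _ hbc; rwa [st2] at this)
        show c = st m
        rw [← h2, st2]

theorem flip_min {P : Type} [PartialOrder P] {st : P → P} (ne : ∀ a, ¬ a ≤ st a) {o : Set P}
    {m : P} (ho' : Ult st (flip1 st o m)) :
    ∀ b ∈ o, b ≤ m → b = m := by
  intro b hb hbm
  by_contra hne
  rcases ho'.2 b (Or.inl ⟨hb, hne⟩) m hbm with h | h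
  · exact h.2 rfl
  · have h : m = st m := h
    exact ne m h.le

theorem flip1_flip1 {P : Type} [PartialOrder P] {st : P → P} (st2 : ∀ a, st (st a) = a)
    {o : Set P} (ho : Ult st o) {m : P} (hm : m ∈ o) : flip1 st (flip1 st o m) (st m) = o := by
  ext a
  simp only [flip1, Set.mem_union, Set.mem_sdiff, Set.mem_singleton_iff, st2]
  constructor
  · rintro (⟨h1 | h1, h2⟩ | h)
    · exact h1.1
    · exact absurd h1 h2
    · rwa [h]
  · intro h
    by_cases ha : a = m
    · exact Or.inr ha
    · refine Or.inl ⟨Or.inl ⟨h, ha⟩, ?_⟩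
      rintro rfl
      exact (ho.1 m).1 hm h

theorem pocset_tree {Γ P : Type} [Group Γ] [PartialOrder P] (st : P → P) (st2 : ∀ a, st (st a) = a)
    (anti : ∀ a b, a ≤ b → st b ≤ st a) (ne : ∀ a, ¬ a ≤ st a)
    (nest : ∀ a b, a ≤ b ∨ b ≤ a ∨ a ≤ st b ∨ st b ≤ a) (lab : P → Bool)
    (hlab : ∀ a, lab (st a) = !lab a) (act : Γ →* Perm P) (amono : ∀ γ a b, a ≤ b → act γ a ≤ act γ b)
    (ast : ∀ γ a, act γ (st a) = st (act γ a)) (alab : ∀ γ a, lab (act γ a) = lab a)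
    (base : Set P) (hbase : Ult st base) (abase : ∀ γ, (act γ '' base \ base).Finite) :
    ∃ (V : Type) (aV : Γ →* Perm V) (E : V → V → Prop) (val : V → Set P), TreeLike E ∧
      (∀ γ u v, E u v → E (aV γ u) (aV γ v)) ∧ (∀ v, Ult st (val v) ∧ (val v \ base).Finite) ∧
      (∀ γ v, val (aV γ v) = act γ '' val v) ∧
      (∀ o, Ult st o → (o \ base).Finite → ∃ v, val v = o) ∧ Function.Injective val := by
  classical
  have aUlt : ∀ γ o, Ult st o → Ult st (act γ '' o) := by
    intro γ o ho
    have hm : ∀ a, a ∈ act γ '' o ↔ act γ⁻¹ a ∈ o := by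
      intro a
      constructor
      · rintro ⟨b, hb, rfl⟩; simpa using hb
      · intro h; exact ⟨_, h, by simp⟩
    constructor
    · intro a; rw [hm, hm, ast]; exact ho.1 _
    · intro a ha b hab
      rw [hm] at ha ⊢
      exact ho.2 _ ha _ (amono _ _ _ hab)
  let V := {o : Set P // Ult st o ∧ (o \ base).Finite}
  have afin : ∀ γ, ∀ v : V, (act γ '' v.1 \ base).Finite := by
    intro γ v
    refine ((v.2.2.image (act γ)).union (abase γ)).subset ?_
    rintro _ ⟨⟨a, ha, rfl⟩, h⟩
    by_cases hb : a ∈ base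
    · exact Or.inr ⟨⟨a, hb, rfl⟩, h⟩
    · exact Or.inl ⟨a, ⟨ha, hb⟩, rfl⟩
  let aV : Γ →* Perm V := mkAct (fun γ v => ⟨act γ '' v.1, aUlt γ _ v.2.1, afin γ v⟩)
    (fun v => by ext; simp) (fun γ γ' v => by
      apply Subtype.ext
      show act (γ * γ') '' v.1 = act γ '' (act γ' '' v.1)
      rw [Set.image_image]; simp)
  have haV : ∀ γ v, (aV γ v).1 = act γ '' v.1 := fun γ v => rfl
  let E : V → V → Prop := fun u v => ∃ a ∈ u.1, lab a = true ∧ v.1 = flip1 st u.1 a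
  have nes : ∀ a, st a ≠ a := fun a h => ne a (by rw [h])
  have adj : ∀ u v : V, (E u v ∨ E v u) → ∃ a ∈ v.1, u.1 = flip1 st v.1 a := by
    rintro u v (⟨a, ha, -, h⟩ | ⟨a, ha, -, h⟩)
    · refine ⟨st a, ?_, ?_⟩
      · rw [h]; exact Or.inr rfl
      · rw [h, flip1_flip1 st2 u.2.1 ha]
    · exact ⟨a, ha, h⟩
  have adj' : ∀ u v : V, ∀ a ∈ v.1, u.1 = flip1 st v.1 a → (E u v ∨ E v u) := by
    intro u v a ha h
    cases hl : lab a with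
    | true => exact Or.inr ⟨a, ha, hl, h⟩
    | false =>
      refine Or.inl ⟨st a, by rw [h]; exact Or.inr rfl, by rw [hlab, hl]; rfl, ?_⟩
      rw [h, flip1_flip1 st2 v.2.1 ha]
  refine ⟨V, aV, E, Subtype.val, ⟨?_, ?_⟩, ?_, fun v => v.2, haV, fun o h1 h2 => ⟨⟨o, h1, h2⟩, rfl⟩, Subtype.val_injective⟩
  · rintro u v ⟨a, ha, hla, hv⟩ ⟨b, hb, hlb, hu⟩
    have : a = st b := by
      rw [hu] at ha
      rcases ha with h | h
      · have := h.1
        rw [hv] at this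
        rcases this with h | h
        · exact absurd rfl h.2
        · exact absurd (show a = st a from h).symm (nes a)
      · exact h
    rw [this, hlab, hlb] at hla
    exact absurd hla (by simp)
  · intro r
    have hfin : ∀ v : V, (v.1 \ r.1).Finite := by
      intro v
      refine (v.2.2.union (ult_diff st2 r.2.1 hbase r.2.2)).subset ?_
      rintro a ⟨h1, h2⟩
      by_cases hb : a ∈ base
      · exact Or.inr ⟨hb, h2⟩
      · exact Or.inl ⟨h1, hb⟩
    -- rank change
    have hup : ∀ u v : V, ∀ a ∈ v.1, u.1 = flip1 st v.1 a → a ∈ r.1 →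
        (u.1 \ r.1).ncard = (v.1 \ r.1).ncard + 1 := by
      intro u v a ha h har
      have hs : st a ∉ r.1 := (r.2.1.1 a).1 har
      have hs' : st a ∉ v.1 := (v.2.1.1 a).1 ha
      have : u.1 \ r.1 = insert (st a) (v.1 \ r.1) := by
        rw [h]
        ext b
        simp only [flip1, Set.mem_union, Set.mem_sdiff, Set.mem_singleton_iff, Set.mem_insert_iff]
        constructor
        · rintro ⟨h1 | h1, h2⟩
          · exact Or.inr ⟨h1.1, h2⟩
          · exact Or.inl h1
        · rintro (rfl | ⟨h1, h2⟩)
          · exact ⟨Or.inr rfl, hs⟩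
          · exact ⟨Or.inl ⟨h1, fun e => h2 (e ▸ har)⟩, h2⟩
      rw [this, Set.ncard_insert_of_notMem (fun h => hs' h.1) (hfin v)]
    have hdown : ∀ u v : V, ∀ a ∈ v.1, u.1 = flip1 st v.1 a → a ∉ r.1 →
        (v.1 \ r.1).ncard = (u.1 \ r.1).ncard + 1 := by
      intro u v a ha h har
      refine hup v u (st a) (by rw [h]; exact Or.inr rfl) (by rw [h, flip1_flip1 st2 v.2.1 ha]) ?_
      by_contra h; exact har ((r.2.1.1 a).2 h)
    refine ⟨fun v => (v.1 \ r.1).ncard, ?_, ?_, by simp, ?_⟩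
    · intro v hv
      have hne : (v.1 \ r.1).Nonempty := by
        rw [Set.nonempty_iff_ne_empty]
        intro h
        have h := Set.sdiff_eq_empty.1 h
        refine hv (Subtype.ext (h.antisymm fun a ha => ?_))
        by_contra hav
        have : st a ∈ v.1 := by by_contra h'; exact hav ((v.2.1.1 a).2 h')
        exact (r.2.1.1 a).1 ha (h this)
      obtain ⟨m, hm⟩ := (hfin v).exists_minimal hne
      have hmin : ∀ b ∈ v.1, b ≤ m → b = m := fun b hb hbm => by
        refine le_antisymm hbm (hm.2 ⟨hb, fun hbr => hm.1.2 (r.2.1.2 b hbr m hbm)⟩ hbm)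
      have hu := flip_ult st2 anti ne v.2.1 hm.1.1 hmin
      refine ⟨⟨_, hu, (v.2.2.union (Set.finite_singleton (st m))).subset ?_⟩, adj' _ v m hm.1.1 rfl, ?_⟩
      · rintro a ⟨h1 | h1, h2⟩
        · exact Or.inl ⟨h1.1, h2⟩
        · exact Or.inr h1
      · have := hdown ⟨_, hu, (v.2.2.union (Set.finite_singleton (st m))).subset (by
          rintro a ⟨h1 | h1, h2⟩
          · exact Or.inl ⟨h1.1, h2⟩
          · exact Or.inr h1)⟩ v m hm.1.1 rfl hm.1.2
        show (flip1 st v.1 m \ r.1).ncard < (v.1 \ r.1).ncard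
        simp only at this
        omega
    · intro u v h
      obtain ⟨a, ha, e⟩ := adj u v (Or.inl h)
      by_cases har : a ∈ r.1
      · have := hup u v a ha e har
        simp only; omega
      · have := hdown u v a ha e har
        simp only; omega
    · intro v u u' h h' hl hl'
      obtain ⟨a, ha, e⟩ := adj u v h
      obtain ⟨b, hb, e'⟩ := adj u' v h'
      simp only at hl hl'
      have har : a ∉ r.1 := fun har => by have := hup u v a ha e har; omega
      have hbr : b ∉ r.1 := fun har => by have := hup u' v b hb e' har; omega
      have hma := flip_min (o := v.1) (m := a) ne (e ▸ u.2.1)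
      have hmb := flip_min (o := v.1) (m := b) ne (e' ▸ u'.2.1)
      have : a = b := by
        rcases nest a b with h | h | h | h
        · exact hmb a ha h
        · exact (hma b hb h).symm
        · exact absurd (v.2.1.2 a ha _ h) ((v.2.1.1 b).1 hb)
        · exfalso
          have hs : st b ∈ r.1 := by by_contra h'; exact hbr ((r.2.1.1 b).2 h')
          exact har (r.2.1.2 _ hs _ h)
      exact Subtype.ext (by rw [e, e', this])
  · rintro γ u v ⟨a, ha, hl, e⟩
    refine ⟨act γ a, ⟨a, ha, rfl⟩, by rw [alab, hl], ?_⟩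
    rw [haV, haV, e, flip1, flip1, Set.image_union, Set.image_sdiff (act γ).injective]
    simp [ast]

open Equiv Monoid

structure Wall {X : Type} (O : Set (Set X)) where
  c : Set X
  h : c ∈ O
  i : Bool

theorem Wall.ext' {X : Type} {O : Set (Set X)} {a b : Wall O} (h : a.c = b.c) (h' : a.i = b.i) : a = b := by
  cases a; cases b; cases h; cases h'; rfl

instance {X : Type} (O : Set (Set X)) : PartialOrder (Wall O) where
  le a b := a.c ⊂ b.c ∨ (a.c = b.c ∧ (a.i = true → b.i = true))
  le_refl a := Or.inr ⟨rfl, id⟩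
  le_trans a b c h h' := by
    rcases h with h | h <;> rcases h' with h' | h'
    · exact Or.inl (h.trans h')
    · exact Or.inl (h'.1 ▸ h)
    · exact Or.inl (h.1 ▸ h')
    · exact Or.inr ⟨h.1.trans h'.1, h'.2 ∘ h.2⟩
  le_antisymm a b h h' := by
    rcases h with h | h <;> rcases h' with h' | h'
    · exact absurd h' h.asymm
    · exact absurd h'.1.symm h.ne
    · exact absurd h.1.symm h'.ne
    · refine Wall.ext' h.1 ?_
      have h1 := h.2
      have h2 := h'.2
      cases ha : a.i <;> cases hb : b.i <;> simp_all

theorem wall_le {X : Type} {O : Set (Set X)} (a b : Wall O) :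
    a ≤ b ↔ a.c ⊂ b.c ∨ (a.c = b.c ∧ (a.i = true → b.i = true)) := Iff.rfl

theorem wall_fin {X : Type} {O : Set (Set X)} (S : Set (Wall O)) (T : Set (Set X)) (hT : T.Finite)
    (h : ∀ a ∈ S, a.c ∈ T) : S.Finite := by
  have : Set.InjOn (fun a : Wall O => (a.c, a.i)) S := fun a _ b _ e =>
    Wall.ext' (congrArg Prod.fst e) (congrArg Prod.snd e)
  refine Set.Finite.of_finite_image ((hT.prod (Set.finite_univ (α := Bool))).subset ?_) this
  rintro _ ⟨a, ha, rfl⟩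
  exact ⟨h a ha, trivial⟩

theorem compl_ssub {X : Type} {C D : Set X} : Cᶜ ⊂ Dᶜ ↔ D ⊂ C := compl_lt_compl_iff_lt

theorem img_ssub {X Y : Type} {f : X → Y} (hf : Function.Injective f) {C D : Set X} :
    f '' C ⊂ f '' D ↔ C ⊂ D := by
  rw [ssubset_iff_subset_not_subset, ssubset_iff_subset_not_subset, Set.image_subset_image_iff hf,
    Set.image_subset_image_iff hf]

theorem cuts_tree {Γ X : Type} [Group Γ] (act : Γ →* Perm X) (O : Set (Set X))
    (hcompl : ∀ C ∈ O, Cᶜ ∈ O) (hinv : ∀ γ, ∀ C ∈ O, act γ '' C ∈ O) (hne : ∅ ∉ O)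
    (nested : ∀ C ∈ O, ∀ D ∈ O, C ⊆ D ∨ D ⊆ C ∨ C ⊆ Dᶜ ∨ Dᶜ ⊆ C)
    (hfin : ∀ x y, {C | C ∈ O ∧ x ∈ C ∧ y ∉ C}.Finite) (x0 : X) :
    ∃ (V : Type) (aV : Γ →* Perm V) (E : V → V → Prop), TreeLike E ∧
      (∀ γ u v, E u v → E (aV γ u) (aV γ v)) ∧
      (∀ g, IsOfFinOrder g → ∃ v, aV g v = v) ∧
      (∀ γ v, aV γ v = v → ∀ C ∈ O, {D | (∃ j : ℤ, D = act (γ ^ j) '' C) ∧ x0 ∉ D}.Finite ∨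
        {D | (∃ j : ℤ, D = act (γ ^ j) '' C) ∧ x0 ∈ D}.Finite) := by
  classical
  let st : Wall O → Wall O := fun a => ⟨a.cᶜ, hcompl _ a.h, !a.i⟩
  let wact : Γ →* Perm (Wall O) := mkAct (fun γ a => ⟨act γ '' a.c, hinv γ _ a.h, a.i⟩)
    (fun a => Wall.ext' (by simp) rfl)
    (fun γ γ' a => Wall.ext' (by
      show act (γ * γ') '' a.c = act γ '' (act γ' '' a.c)
      rw [Set.image_image]; simp) rfl)
  have wc : ∀ γ a, (wact γ a).c = act γ '' a.c := fun γ a => rfl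
  have wi : ∀ γ a, (wact γ a).i = a.i := fun γ a => rfl
  have st2 : ∀ a, st (st a) = a := fun a => Wall.ext' (compl_compl _) (by simp [st])
  have anti : ∀ a b, a ≤ b → st b ≤ st a := by
    intro a b h
    rcases h with h | h
    · exact Or.inl (compl_ssub.2 h)
    · refine Or.inr ⟨by simp [st, h.1], ?_⟩
      have := h.2
      show (!b.i) = true → (!a.i) = true
      cases ha : a.i <;> cases hb : b.i <;> simp_all
  have ne : ∀ a, ¬ a ≤ st a := by
    intro a h
    have : a.c ⊆ a.cᶜ := by
      rcases h with h | h
      · exact h.1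
      · exact h.1.le
    refine hne ?_
    have e : a.c = ∅ := by
      ext x; constructor
      · intro hx; exact absurd hx (this hx)
      · intro h; exact absurd h (by simp)
    rw [← e]; exact a.h
  have nest : ∀ a b, a ≤ b ∨ b ≤ a ∨ a ≤ st b ∨ st b ≤ a := by
    intro a b
    by_cases h1 : a.c = b.c
    · by_cases h : a.i = true → b.i = true
      · exact Or.inl (Or.inr ⟨h1, h⟩)
      · exact Or.inr (Or.inl (Or.inr ⟨h1.symm, by tauto⟩))
    by_cases h2 : a.c = (st b).c
    · by_cases h : a.i = true → (st b).i = true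
      · exact Or.inr (Or.inr (Or.inl (Or.inr ⟨h2, h⟩)))
      · exact Or.inr (Or.inr (Or.inr (Or.inr ⟨h2.symm, by tauto⟩)))
    rcases nested a.c a.h b.c b.h with h | h | h | h
    · exact Or.inl (Or.inl (h.ssubset_of_ne h1))
    · exact Or.inr (Or.inl (Or.inl (h.ssubset_of_ne (Ne.symm h1))))
    · exact Or.inr (Or.inr (Or.inl (Or.inl (h.ssubset_of_ne h2))))
    · exact Or.inr (Or.inr (Or.inr (Or.inl (h.ssubset_of_ne (Ne.symm h2)))))
  let base : Set (Wall O) := {a | x0 ∈ a.c}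
  obtain ⟨V, aV, E, val, hT, hE, hval, hact, hsurj, hinj⟩ := pocset_tree st st2 anti ne nest (fun a => a.i)
    (fun a => rfl) wact
    (fun γ a b h => by
      rcases h with h | h
      · left; rw [wc, wc]; exact (img_ssub (act γ).injective).2 h
      · right; rw [wc, wc, h.1]; exact ⟨rfl, h.2⟩)
    (fun γ a => Wall.ext' (by show act γ '' a.cᶜ = (act γ '' a.c)ᶜ; exact Set.image_compl_eq (act γ).bijective) rfl)
    (fun γ a => rfl) base ⟨fun a => by simp [base, st], fun a ha b hab => by
      rcases hab with h | h
      · exact h.1 ha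
      · show x0 ∈ b.c; rw [← h.1]; exact ha⟩
    (fun γ => by
      refine wall_fin _ _ (hfin (act γ x0) x0) ?_
      rintro _ ⟨⟨a, ha, rfl⟩, h⟩
      exact ⟨(wact γ a).h, ⟨x0, ha, rfl⟩, h⟩)
  refine ⟨V, aV, E, hT, hE, ?_, ?_⟩
  · intro g hg
    haveI : Finite (Subgroup.zpowers g) := hg.finite_zpowers
    let d := Nat.card (Subgroup.zpowers g)
    let M : Set X → Set (Subgroup.zpowers g) := fun C => {h | act (h : Γ) x0 ∈ C}
    let N : Set X → ℕ := fun C => (M C).ncard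
    have Nc : ∀ C, N C + N Cᶜ = d := fun C => Set.ncard_add_ncard_compl (M C)
    have Nmono : ∀ C D, C ⊆ D → N C ≤ N D := fun C D h =>
      Set.ncard_le_ncard (fun x hx => h hx) (Set.toFinite _)
    have Npos : ∀ C, 0 < N C → ∃ h : Subgroup.zpowers g, act (h : Γ) x0 ∈ C := by
      intro C h
      exact (Set.ncard_pos (Set.toFinite _)).1 h
    have Ng : ∀ C, N (act g '' C) = N C := by
      intro C
      have : M (act g '' C) = (fun h => ⟨g, Subgroup.mem_zpowers g⟩ * h) '' M C := by
        ext h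
        constructor
        · rintro ⟨x, hx, e⟩
          refine ⟨⟨g, Subgroup.mem_zpowers g⟩⁻¹ * h, ?_, by simp⟩
          show act (g⁻¹ * h) x0 ∈ C
          rw [map_mul, Perm.mul_apply, ← e]; simpa using hx
        · rintro ⟨h, hh, rfl⟩
          refine ⟨_, hh, ?_⟩
          show _ = act (g * h) x0
          simp
      show (M _).ncard = _
      rw [this, Set.ncard_image_of_injective _ (mul_right_injective _)]
    have hfin1 : ∀ x, {C | C ∈ O ∧ (∃ h : Subgroup.zpowers g, act (h : Γ) x0 ∈ C) ∧ x ∉ C}.Finite := by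
      intro x
      refine (Set.finite_iUnion fun h : Subgroup.zpowers g => hfin (act (h : Γ) x0) x).subset ?_
      rintro C ⟨h1, ⟨h, h2⟩, h3⟩
      exact Set.mem_iUnion.2 ⟨h, h1, h2, h3⟩
    let T : Set (Set X) := {C | C ∈ O ∧ 2 * N C = d}
    have dpos : 0 < d := Nat.card_pos
    have Tfin : T.Finite := by
      refine (Set.finite_iUnion fun h : Subgroup.zpowers g => hfin1 (act (h : Γ) x0)).subset ?_
      rintro C ⟨h1, h2⟩
      have h3 := Nc C
      obtain ⟨h, hh⟩ := Npos Cᶜ (by omega)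
      exact Set.mem_iUnion.2 ⟨h, h1, Npos C (by omega), hh⟩
    have Tc : ∀ C, C ∈ T → Cᶜ ∈ T := fun C hC => ⟨hcompl _ hC.1, by
      have := Nc C
      have := hC.2
      omega⟩
    have Tg : ∀ C, C ∈ T → act g '' C ∈ T := fun C hC => ⟨hinv g _ hC.1, by rw [Ng]; exact hC.2⟩
    have Ng' : ∀ C, N (act g⁻¹ '' C) = N C := by
      intro C
      rw [← Ng (act g⁻¹ '' C), Set.image_image]; simp
    have Tg' : ∀ C, C ∈ T → act g⁻¹ '' C ∈ T := fun C hC => ⟨hinv _ _ hC.1, by rw [Ng']; exact hC.2⟩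
    let bel : Set X → ℕ := fun C => {D | D ∈ T ∧ D ⊂ C}.ncard
    let abv : Set X → ℕ := fun C => {D | D ∈ T ∧ C ⊂ D}.ncard
    have belc : ∀ C, bel Cᶜ = abv C := by
      intro C
      have : {D | D ∈ T ∧ D ⊂ Cᶜ} = compl '' {D | D ∈ T ∧ C ⊂ D} := by
        ext D; constructor
        · rintro ⟨h1, h2⟩
          exact ⟨Dᶜ, ⟨Tc _ h1, by rw [← compl_ssub, compl_compl]; exact h2⟩, compl_compl D⟩
        · rintro ⟨D, ⟨h1, h2⟩, rfl⟩
          exact ⟨Tc _ h1, compl_ssub.2 h2⟩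
      show Set.ncard _ = _
      rw [this, Set.ncard_image_of_injective _ compl_injective]
    have abvc : ∀ C, abv Cᶜ = bel C := fun C => by rw [← belc, compl_compl]
    have himg : ∀ C, act g '' (act g⁻¹ '' C) = C := fun C => by rw [Set.image_image]; simp
    have ginj : Function.Injective fun C : Set X => act g '' C := Set.image_injective.2 (act g).injective
    have belg : ∀ C, bel (act g '' C) = bel C := by
      intro C
      have : {D | D ∈ T ∧ D ⊂ act g '' C} = (fun C => act g '' C) '' {D | D ∈ T ∧ D ⊂ C} := by
        ext D; constructor
        · rintro ⟨h1, h2⟩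
          refine ⟨act g⁻¹ '' D, ⟨Tg' _ h1, ?_⟩, himg D⟩
          rw [← img_ssub (act g).injective, himg]; exact h2
        · rintro ⟨D, ⟨h1, h2⟩, rfl⟩
          exact ⟨Tg _ h1, (img_ssub (act g).injective).2 h2⟩
      show Set.ncard _ = _
      rw [this, Set.ncard_image_of_injective _ ginj]
    have abvg : ∀ C, abv (act g '' C) = abv C := by
      intro C
      rw [← belc, ← Set.image_compl_eq (act g).bijective, belg, belc]
    let o : Set (Wall O) := {a | d < 2 * N a.c ∨ (2 * N a.c = d ∧ (abv a.c < bel a.c ∨ (abv a.c = bel a.c ∧ a.i = true)))}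
    have ho : Ult st o := by
      constructor
      · intro a
        have h1 := Nc a.c
        have h2 := belc a.c
        have h3 := abvc a.c
        show (d < 2 * N a.c ∨ (2 * N a.c = d ∧ (abv a.c < bel a.c ∨ (abv a.c = bel a.c ∧ a.i = true)))) ↔
          ¬ (d < 2 * N a.cᶜ ∨ (2 * N a.cᶜ = d ∧ (abv a.cᶜ < bel a.cᶜ ∨ (abv a.cᶜ = bel a.cᶜ ∧ (!a.i) = true))))
        rw [h2, h3]
        cases a.i <;> simp <;> omega
      · rintro a ha b (h | h)
        · have ha : d < 2 * N a.c ∨ (2 * N a.c = d ∧ (abv a.c < bel a.c ∨ (abv a.c = bel a.c ∧ a.i = true))) := ha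
          have h1 := Nmono _ _ h.1
          by_cases hb : d < 2 * N b.c
          · exact Or.inl hb
          have h2 : 2 * N a.c = d := by omega
          have h3 : 2 * N b.c = d := by omega
          refine Or.inr ⟨h3, Or.inl ?_⟩
          have h4 : bel a.c < bel b.c := by
            refine Set.ncard_lt_ncard ⟨fun D hD => ⟨hD.1, hD.2.trans h⟩, fun hs => ?_⟩ (Tfin.subset fun D hD => hD.1)
            exact (hs (show a.c ∈ {D | D ∈ T ∧ D ⊂ b.c} from ⟨⟨a.h, h2⟩, h⟩)).2.ne rfl
          have h5 : abv b.c < abv a.c := by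
            refine Set.ncard_lt_ncard ⟨fun D hD => ⟨hD.1, h.trans hD.2⟩, fun hs => ?_⟩ (Tfin.subset fun D hD => hD.1)
            exact (hs (show b.c ∈ {D | D ∈ T ∧ a.c ⊂ D} from ⟨⟨b.h, h3⟩, h⟩)).2.ne rfl
          omega
        · have := h.2
          show d < 2 * N b.c ∨ (2 * N b.c = d ∧ (abv b.c < bel b.c ∨ (abv b.c = bel b.c ∧ b.i = true)))
          rw [← h.1]
          rcases ha with ha | ⟨h1, ha | ha⟩
          · exact Or.inl ha
          · exact Or.inr ⟨h1, Or.inl ha⟩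
          · exact Or.inr ⟨h1, Or.inr ⟨ha.1, this ha.2⟩⟩
    obtain ⟨v, hv⟩ := hsurj o ho (by
      refine wall_fin _ _ (hfin1 x0) ?_
      rintro a ⟨ha, hb⟩
      refine ⟨a.h, Npos _ ?_, hb⟩
      rcases ha with ha | ha <;> omega)
    refine ⟨v, hinj ?_⟩
    rw [hact, hv]
    have key : ∀ a, wact g a ∈ o ↔ a ∈ o := by
      intro a
      show (d < 2 * N (act g '' a.c) ∨ (2 * N (act g '' a.c) = d ∧ (abv (act g '' a.c) < bel (act g '' a.c) ∨ (abv (act g '' a.c) = bel (act g '' a.c) ∧ a.i = true)))) ↔ _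
      rw [Ng, belg, abvg]; rfl
    ext a; constructor
    · rintro ⟨b, hb, rfl⟩; exact (key b).2 hb
    · intro h
      refine ⟨wact g⁻¹ a, ?_, by simp⟩
      rw [← key]; simpa using h
  · intro γ v hv C hC
    have hz : ∀ j : ℤ, wact (γ ^ j) '' val v = val v := by
      intro j
      rw [← hact]
      have : γ ^ j ∈ (MulAction.stabilizer (Perm V) v).comap aV := zpow_mem (show γ ∈ _ from hv) j
      exact congrArg val this
    have hmem : ∀ a ∈ val v, ∀ j : ℤ, wact (γ ^ j) a ∈ val v := fun a ha j => hz j ▸ ⟨a, ha, rfl⟩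
    have hf : ((fun a : Wall O => a.c) '' (val v \ base)).Finite := (hval v).2.image _
    have hf' : ((fun a : Wall O => a.cᶜ) '' (val v \ base)).Finite := (hval v).2.image _
    by_cases hw : (⟨C, hC, true⟩ : Wall O) ∈ val v
    · left
      refine hf.subset ?_
      rintro _ ⟨⟨j, rfl⟩, h⟩
      exact ⟨_, ⟨hmem _ hw j, h⟩, rfl⟩
    · right
      have hw' : st ⟨C, hC, true⟩ ∈ val v := by
        by_contra h; exact hw (((hval v).1.1 _).2 h)
      refine hf'.subset ?_
      rintro _ ⟨⟨j, rfl⟩, h⟩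
      have e : (wact (γ ^ j) (st ⟨C, hC, true⟩)).c = (act (γ ^ j) '' C)ᶜ :=
        Set.image_compl_eq (act (γ ^ j)).bijective
      refine ⟨_, ⟨hmem _ hw' j, ?_⟩, ?_⟩
      · intro h'
        have h' : x0 ∈ (wact (γ ^ j) (st ⟨C, hC, true⟩)).c := h'
        rw [e] at h'; exact h' h
      · show (Wall.c _)ᶜ = _
        rw [e, compl_compl]

open Equiv Monoid

def bd {X : Type} (adj : X → X → Prop) (C : Set X) : Set (X × X) := {e | e.1 ∈ C ∧ e.2 ∉ C ∧ adj e.1 e.2}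

def ConnS {X : Type} (adj : X → X → Prop) (C : Set X) : Prop :=
  ∀ Y ⊆ C, Y.Nonempty → (∀ y ∈ Y, ∀ z ∈ C, adj y z → z ∈ Y) → Y = C

def SepU {X : Type} (ℓ : Ultrafilter X × Ultrafilter X) (C : Set X) : Prop := ¬ (C ∈ ℓ.1 ↔ C ∈ ℓ.2)

def IsMinC {X : Type} (adj : X → X → Prop) (ℓ : Ultrafilter X × Ultrafilter X) (C : Set X) : Prop :=
  SepU ℓ C ∧ (bd adj C).Finite ∧ ∀ D, SepU ℓ D → (bd adj D).Finite → (bd adj C).ncard ≤ (bd adj D).ncard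

def Cross {X : Type} (C D : Set X) : Prop :=
  (C ∩ D).Nonempty ∧ (C ∩ Dᶜ).Nonempty ∧ (Cᶜ ∩ D).Nonempty ∧ (Cᶜ ∩ Dᶜ).Nonempty

theorem ncard_add {α : Type} {A A' B B' : Set α} (hB : B.Finite) (hB' : B'.Finite) (h1 : A ∪ A' ⊆ B ∪ B')
    (h2 : A ∩ A' ⊆ B ∩ B') : A.ncard + A'.ncard ≤ B.ncard + B'.ncard ∧
      ((∃ x ∈ B ∪ B', x ∉ A ∪ A') → A.ncard + A'.ncard < B.ncard + B'.ncard) := by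
  have hf := hB.union hB'
  have hA : A.Finite := hf.subset (Set.subset_union_left.trans h1)
  have hA' : A'.Finite := hf.subset (Set.subset_union_right.trans h1)
  rw [← Set.ncard_union_add_ncard_inter A A' hA hA', ← Set.ncard_union_add_ncard_inter B B' hB hB']
  have h3 := Set.ncard_le_ncard h2 (hB.inter_of_left _)
  refine ⟨add_le_add (Set.ncard_le_ncard h1 hf) h3, ?_⟩
  rintro ⟨x, hx, hx'⟩
  exact add_lt_add_of_lt_of_le (Set.ncard_lt_ncard ⟨h1, fun h => hx' (h hx)⟩ hf) h3

section
variable {X : Type} {adj : X → X → Prop}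

theorem bd_compl (hs : ∀ x y, adj x y → adj y x) (C : Set X) : bd adj Cᶜ = Prod.swap '' bd adj C := by
  ext ⟨x, y⟩
  simp only [bd, Set.mem_setOf_eq, Set.mem_compl_iff, not_not, Set.mem_image, Prod.exists, Prod.swap_prod_mk, Prod.mk.injEq]
  constructor
  · rintro ⟨h1, h2, h3⟩; exact ⟨y, x, ⟨h2, h1, hs _ _ h3⟩, rfl, rfl⟩
  · rintro ⟨a, b, ⟨h1, h2, h3⟩, rfl, rfl⟩; exact ⟨h2, h1, hs _ _ h3⟩

theorem bd_compl_fin (hs : ∀ x y, adj x y → adj y x) {C : Set X} (h : (bd adj C).Finite) :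
    (bd adj Cᶜ).Finite := by rw [bd_compl hs]; exact h.image _

theorem bd_compl_card (hs : ∀ x y, adj x y → adj y x) (C : Set X) :
    (bd adj Cᶜ).ncard = (bd adj C).ncard := by
  rw [bd_compl hs, Set.ncard_image_of_injective _ Prod.swap_injective]

theorem SepU.compl {ℓ : Ultrafilter X × Ultrafilter X} {C : Set X} (h : SepU ℓ C) : SepU ℓ Cᶜ := by
  unfold SepU at *
  rw [Ultrafilter.compl_mem_iff_notMem, Ultrafilter.compl_mem_iff_notMem]
  tauto

theorem IsMinC.compl (hs : ∀ x y, adj x y → adj y x) {ℓ : Ultrafilter X × Ultrafilter X} {C : Set X}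
    (h : IsMinC adj ℓ C) : IsMinC adj ℓ Cᶜ :=
  ⟨h.1.compl, bd_compl_fin hs h.2.1, fun D h1 h2 => by rw [bd_compl_card hs]; exact h.2.2 D h1 h2⟩

theorem bd_path {x y : X} (hxy : Relation.ReflTransGen adj x y) (C : Set X) (hx : x ∈ C) (hy : y ∉ C) :
    ∃ e, e ∈ bd adj C := by
  induction hxy with
  | refl => exact absurd hx hy
  | tail _ h ih =>
    rename_i b c _
    by_cases hb : b ∈ C
    · exact ⟨(b, c), hb, hy, h⟩
    · exact ih hb

theorem IsMinC.conn (hs : ∀ x y, adj x y → adj y x) (hc : ∀ x y, Relation.ReflTransGen adj x y)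
    {ℓ : Ultrafilter X × Ultrafilter X} {C : Set X} (h : IsMinC adj ℓ C) : ConnS adj C := by
  -- a proper piece which is a union of components gives a smaller cut
  have key : ∀ W ⊆ C, (C \ W).Nonempty → W.Nonempty → SepU ℓ W →
      (∀ y ∈ W, ∀ z ∈ C, adj y z → z ∈ W) → False := by
    intro W hW ⟨x, hx, hxW⟩ ⟨y, hy⟩ hsep hcl
    have hsub : bd adj W ⊆ bd adj C := fun e he => ⟨hW he.1, fun h2 => he.2.1 (hcl _ he.1 _ h2 he.2.2), he.2.2⟩
    obtain ⟨e, he⟩ := bd_path (hc x y) (C \ W) ⟨hx, hxW⟩ (fun h => h.2 hy)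
    have he' : e ∈ bd adj C := ⟨he.1.1, fun h2 => by
      by_cases hW2 : e.2 ∈ W
      · exact he.1.2 (hcl _ hW2 _ he.1.1 (hs _ _ he.2.2))
      · exact he.2.1 ⟨h2, hW2⟩, he.2.2⟩
    have := h.2.2 W hsep (h.2.1.subset hsub)
    exact absurd (Set.ncard_lt_ncard ⟨hsub, fun hh => he.1.2 (hh he').1⟩ h.2.1) (by omega)
  intro Y hY hYne hcl
  by_contra hne
  have hne' : (C \ Y).Nonempty := by
    rw [Set.sdiff_nonempty]; exact fun h => hne (hY.antisymm h)
  have hcl2 : ∀ y ∈ C \ Y, ∀ z ∈ C, adj y z → z ∈ C \ Y :=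
    fun y hy z hz ha => ⟨hz, fun hzY => hy.2 (hcl z hzY y hy.1 (hs _ _ ha))⟩
  have hCY : C \ (C \ Y) = Y := Set.sdiff_sdiff_cancel_left hY
  have aux : ∀ p : Ultrafilter X, C ∈ p → Y ∈ p ∨ C \ Y ∈ p := by
    intro p hp
    by_cases h : Y ∈ p
    · exact Or.inl h
    · exact Or.inr (Filter.inter_mem hp (Ultrafilter.compl_mem_iff_notMem.2 h))
  have mono : ∀ p : Ultrafilter X, C ∉ p → Y ∉ p ∧ C \ Y ∉ p := fun p hp =>
    ⟨fun h => hp (Filter.mem_of_superset h hY), fun h => hp (Filter.mem_of_superset h Set.sdiff_subset)⟩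
  have hsep := h.1
  unfold SepU at hsep
  by_cases h1 : C ∈ ℓ.1
  · have h2 : C ∉ ℓ.2 := by tauto
    rcases aux _ h1 with h3 | h3
    · exact key Y hY hne' hYne (by have := mono _ h2; unfold SepU; tauto) hcl
    · exact key (C \ Y) Set.sdiff_subset (by rwa [hCY]) hne' (by have := mono _ h2; unfold SepU; tauto) hcl2
  · have h2 : C ∈ ℓ.2 := by tauto
    rcases aux _ h2 with h3 | h3
    · exact key Y hY hne' hYne (by have := mono _ h1; unfold SepU; tauto) hcl
    · exact key (C \ Y) Set.sdiff_subset (by rwa [hCY]) hne' (by have := mono _ h1; unfold SepU; tauto) hcl2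

theorem path_edges {r : X → X → Prop} {x y : X} (h : Relation.ReflTransGen r x y) :
    ∃ L : Finset (X × X), (∀ e ∈ L, r e.1 e.2) ∧ ∀ C : Set X, x ∈ C → y ∉ C → ∃ e ∈ L, e.1 ∈ C ∧ e.2 ∉ C := by
  classical
  induction h with
  | refl => exact ⟨∅, by simp, fun C h h' => absurd h h'⟩
  | tail _ h ih =>
    rename_i b c _
    obtain ⟨L, hL, hL2⟩ := ih
    refine ⟨insert (b, c) L, ?_, fun C hx hy => ?_⟩
    · intro e he
      rcases Finset.mem_insert.1 he with rfl | he
      · exact h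
      · exact hL e he
    · by_cases hb : b ∈ C
      · exact ⟨(b, c), by simp, hb, hy⟩
      · obtain ⟨e, he, h2⟩ := hL2 C hx hb
        exact ⟨e, by simp [he], h2⟩

theorem cut_fin_aux (hs : ∀ x y, adj x y → adj y x) (k : ℕ) : ∀ R : Finset (X × X), R.Nonempty →
    {C : Set X | ConnS adj C ∧ ConnS adj Cᶜ ∧ (bd adj C).Finite ∧ (R : Set (X × X)) ⊆ bd adj C ∧
      (bd adj C \ R).ncard ≤ k}.Finite := by
  classical
  induction k with
  | zero =>
    intro R ⟨⟨a, b⟩, hab⟩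
    let r : X → X → Prop := fun x y => adj x y ∧ (x, y) ∉ R ∧ (y, x) ∉ R
    refine Set.Subsingleton.finite (Set.Subsingleton.anti (t := {{z | Relation.ReflTransGen r a z}}) (by simp) ?_)
    rintro C ⟨h1, h2, h3, h4, h5⟩
    have heq : bd adj C ⊆ R := by
      have := (Set.ncard_eq_zero (h3.subset Set.sdiff_subset)).1 (Nat.le_zero.1 h5)
      exact Set.sdiff_eq_empty.1 this
    have hreach : ∀ z, Relation.ReflTransGen r a z → z ∈ C := by
      intro z hz
      by_contra hzC
      obtain ⟨L, hL, hL2⟩ := path_edges hz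
      obtain ⟨e, he, he1, he2⟩ := hL2 C (h4 hab).1 hzC
      exact (hL e he).2.1 (heq ⟨he1, he2, (hL e he).1⟩)
    refine (h1 {z | Relation.ReflTransGen r a z} hreach ⟨a, .refl⟩ ?_).symm
    intro y hy z hz hyz
    exact Relation.ReflTransGen.tail hy ⟨hyz, fun h => (h4 h).2.1 hz, fun h => (h4 h).2.1 (hreach _ hy)⟩
  | succ k ih =>
    intro R hR
    obtain ⟨⟨a, b⟩, hab⟩ := hR
    let r : X → X → Prop := fun x y => adj x y ∧ (x, y) ∉ R ∧ (y, x) ∉ R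
    by_cases hp : Relation.ReflTransGen r a b
    · obtain ⟨L, hL, hL2⟩ := path_edges hp
      refine (Set.Finite.biUnion (L.finite_toSet) fun e _ => ih (insert e R) ⟨e, by simp⟩).subset ?_
      rintro C ⟨h1, h2, h3, h4, h5⟩
      obtain ⟨e, he, he1, he2⟩ := hL2 C (h4 hab).1 (h4 hab).2.1
      have heb : e ∈ bd adj C := ⟨he1, he2, (hL e he).1⟩
      refine Set.mem_biUnion he ⟨h1, h2, h3, ?_, ?_⟩
      · rw [Finset.coe_insert]; exact Set.insert_subset heb h4
      · have : (bd adj C \ (insert e R : Finset (X × X))) ⊂ (bd adj C \ R) := by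
          rw [Finset.coe_insert]
          refine ⟨fun x hx => ⟨hx.1, fun h => hx.2 (Or.inr h)⟩, fun hh => ?_⟩
          exact (hh ⟨heb, (hL e he).2.1⟩).2 (Or.inl rfl)
        have := Set.ncard_lt_ncard this (h3.subset Set.sdiff_subset)
        omega
    · refine Set.Subsingleton.finite (Set.Subsingleton.anti (t := {{z | Relation.ReflTransGen r a z}}) (by simp) ?_)
      rintro C ⟨h1, h2, h3, h4, h5⟩
      have hin : ∀ D : Set X, ConnS adj D → (∀ e ∈ R, ¬ (e.1 ∈ D ∧ e.2 ∈ D)) → ∀ c ∈ D, ∀ z ∈ D,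
          Relation.ReflTransGen r c z := by
        intro D hD hRD c hc z hz
        have := hD {z | z ∈ D ∧ Relation.ReflTransGen r c z} (fun z hz => hz.1) ⟨c, hc, .refl⟩ (by
          intro y hy z hz hyz
          exact ⟨hz, Relation.ReflTransGen.tail hy.2 ⟨hyz, fun h => hRD _ h ⟨hy.1, hz⟩, fun h => hRD _ h ⟨hz, hy.1⟩⟩⟩)
        rw [← this] at hz
        exact hz.2
      have rs : ∀ x y, r x y → r y x := fun x y h => ⟨hs _ _ h.1, h.2.2, h.2.1⟩
      have rsym : ∀ x y, Relation.ReflTransGen r x y → Relation.ReflTransGen r y x := fun x y h =>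
        haveI : Std.Symm r := ⟨rs⟩
        Std.Symm.symm _ _ h
      show C = _
      ext z
      constructor
      · intro hz
        exact hin C h1 (fun e he h => (h4 he).2.1 h.2) a (h4 hab).1 z hz
      · intro hz
        by_contra hzC
        refine hp (Relation.ReflTransGen.trans hz ?_)
        exact hin Cᶜ h2 (fun e he h => h.1 (h4 he).1) z hzC b (h4 hab).2.1

theorem cut_fin (hs : ∀ x y, adj x y → adj y x) (hc : ∀ x y, Relation.ReflTransGen adj x y) (k : ℕ) (x y : X) :
    {C : Set X | (ConnS adj C ∧ ConnS adj Cᶜ ∧ (bd adj C).Finite ∧ (bd adj C).ncard ≤ k) ∧ x ∈ C ∧ y ∉ C}.Finite := by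
  classical
  obtain ⟨L, hL, hL2⟩ := path_edges (hc x y)
  refine (Set.Finite.biUnion (L.finite_toSet) fun e _ => cut_fin_aux hs k {e} ⟨e, by simp⟩).subset ?_
  rintro C ⟨⟨h1, h2, h3, h4⟩, hx, hy⟩
  obtain ⟨e, he, he1, he2⟩ := hL2 C hx hy
  refine Set.mem_biUnion he ⟨h1, h2, h3, ?_, (Set.ncard_le_ncard Set.sdiff_subset h3).trans h4⟩
  simpa using ⟨he1, he2, hL e he⟩

end

open Equiv Monoid

noncomputable def mCr {X : Type} (M : Set (Set X)) (C : Set X) : ℕ := {Y | Y ∈ M ∧ Cross Y C}.ncard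

def IsOpt {X : Type} (adj : X → X → Prop) (M : Set (Set X)) (ℓ : Ultrafilter X × Ultrafilter X) (C : Set X) : Prop :=
  IsMinC adj ℓ C ∧ ∀ D, IsMinC adj ℓ D → mCr M C ≤ mCr M D

def mvL {X : Type} (σ : Perm X) (ℓ : Ultrafilter X × Ultrafilter X) : Ultrafilter X × Ultrafilter X :=
  (ℓ.1.map σ, ℓ.2.map σ)

section
variable {X : Type} {adj : X → X → Prop}

theorem bd_sub (hs : ∀ x y, adj x y → adj y x) {C D : Set X} (hC : (bd adj C).Finite) (hD : (bd adj D).Finite) :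
    (bd adj (C ∩ D)).Finite ∧ (bd adj (Cᶜ ∩ Dᶜ)).Finite ∧
    (bd adj (C ∩ D)).ncard + (bd adj (Cᶜ ∩ Dᶜ)).ncard ≤ (bd adj C).ncard + (bd adj D).ncard := by
  have h1 : bd adj (C ∩ D) ∪ bd adj (C ∪ D) ⊆ bd adj C ∪ bd adj D := by
    rintro e (⟨h1, h2, h3⟩ | ⟨h1, h2, h3⟩)
    · by_cases h : e.2 ∈ C
      · exact Or.inr ⟨h1.2, fun h' => h2 ⟨h, h'⟩, h3⟩
      · exact Or.inl ⟨h1.1, h, h3⟩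
    · rcases h1 with h1 | h1
      · exact Or.inl ⟨h1, fun h' => h2 (Or.inl h'), h3⟩
      · exact Or.inr ⟨h1, fun h' => h2 (Or.inr h'), h3⟩
  have h2 : bd adj (C ∩ D) ∩ bd adj (C ∪ D) ⊆ bd adj C ∩ bd adj D := by
    rintro e ⟨⟨h1, h2, h3⟩, ⟨h1', h2', h3'⟩⟩
    exact ⟨⟨h1.1, fun h => h2' (Or.inl h), h3⟩, ⟨h1.2, fun h => h2' (Or.inr h), h3⟩⟩
  have hf := (hC.union hD).subset h1
  rw [← Set.compl_union, bd_compl_card hs]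
  exact ⟨hf.subset Set.subset_union_left, bd_compl_fin hs (hf.subset Set.subset_union_right), (ncard_add hC hD h1 h2).1⟩

theorem cross_compl {C D : Set X} : Cross C Dᶜ ↔ Cross C D := by
  unfold Cross; rw [compl_compl]; tauto

theorem cross_compl' {C D : Set X} : Cross Cᶜ D ↔ Cross C D := by
  unfold Cross; rw [compl_compl]; tauto

theorem m_sub {M : Set (Set X)} {C D : Set X} (hC : {Y | Y ∈ M ∧ Cross Y C}.Finite)
    (hD : {Y | Y ∈ M ∧ Cross Y D}.Finite) (hCM : C ∈ M) (hx : Cross C D) :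
    mCr M (C ∩ D) + mCr M (Cᶜ ∩ Dᶜ) < mCr M C + mCr M D := by
  have key : ∀ C D : Set X, (Cᶜ ∩ Dᶜ).Nonempty → ∀ Y, Cross Y (C ∩ D) → Cross Y C ∨ Cross Y D := by
    rintro C D ⟨z, hz1, hz2⟩ Y ⟨⟨a, a1, a2⟩, ⟨b, b1, b2⟩, ⟨c, c1, c2⟩, ⟨d, d1, d2⟩⟩
    by_contra hcon
    have n1 : ¬ ((Y ∩ Cᶜ).Nonempty ∧ (Yᶜ ∩ Cᶜ).Nonempty) := fun h => hcon (Or.inl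
      ⟨⟨a, a1, a2.1⟩, h.1, ⟨c, c1, c2.1⟩, h.2⟩)
    have n2 : ¬ ((Y ∩ Dᶜ).Nonempty ∧ (Yᶜ ∩ Dᶜ).Nonempty) := fun h => hcon (Or.inr
      ⟨⟨a, a1, a2.2⟩, h.1, ⟨c, c1, c2.2⟩, h.2⟩)
    by_cases hzY : z ∈ Y
    · refine n1 ⟨⟨z, hzY, hz1⟩, d, d1, fun h => ?_⟩
      exact n2 ⟨⟨z, hzY, hz2⟩, d, d1, fun h' => d2 ⟨h, h'⟩⟩
    · refine n1 ⟨⟨b, b1, fun h => ?_⟩, ⟨z, hzY, hz1⟩⟩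
      exact n2 ⟨⟨b, b1, fun h' => b2 ⟨h, h'⟩⟩, ⟨z, hzY, hz2⟩⟩
  refine (ncard_add hC hD ?_ ?_).2 ⟨C, Or.inr ⟨hCM, hx⟩, ?_⟩
  · rintro Y (⟨h1, h2⟩ | ⟨h1, h2⟩)
    · exact (key C D hx.2.2.2 Y h2).imp (fun h => ⟨h1, h⟩) (fun h => ⟨h1, h⟩)
    · refine (key Cᶜ Dᶜ (by rw [compl_compl, compl_compl]; exact hx.1) Y h2).imp
        (fun h => ⟨h1, cross_compl.1 h⟩) (fun h => ⟨h1, cross_compl.1 h⟩)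
  · rintro Y ⟨⟨h1, ⟨a, a1, a2⟩, ⟨b, b1, b2⟩, ⟨c, c1, c2⟩, ⟨d, d1, d2⟩⟩, ⟨h1', ⟨a', a1', a2'⟩, ⟨b', b1', b2'⟩, ⟨c', c1', c2'⟩, ⟨d', d1', d2'⟩⟩⟩
    exact ⟨⟨h1, ⟨a, a1, a2.1⟩, ⟨a', a1', a2'.1⟩, ⟨c, c1, c2.1⟩, ⟨c', c1', c2'.1⟩⟩,
      ⟨h1, ⟨a, a1, a2.2⟩, ⟨a', a1', a2'.2⟩, ⟨c, c1, c2.2⟩, ⟨c', c1', c2'.2⟩⟩⟩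
  · rintro (⟨-, -, -, ⟨c, c1, c2⟩, -⟩ | ⟨-, ⟨a, a1, a2⟩, -⟩)
    · exact c1 c2.1
    · exact a2.1 a1

theorem IsOpt.compl (hs : ∀ x y, adj x y → adj y x) {M : Set (Set X)} {ℓ : Ultrafilter X × Ultrafilter X} {C : Set X}
    (h : IsOpt adj M ℓ C) : IsOpt adj M ℓ Cᶜ := by
  refine ⟨h.1.compl hs, ?_⟩
  have : mCr M Cᶜ = mCr M C := by unfold mCr; simp only [cross_compl]
  rw [this]; exact h.2

variable {M : Set (Set X)} {Λ : Set (Ultrafilter X × Ultrafilter X)}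

theorem lemA (hs : ∀ x y, adj x y → adj y x) (hM : ∀ ℓ ∈ Λ, ∀ C, IsMinC adj ℓ C → C ∈ M)
    (hfin : ∀ C, (bd adj C).Finite → {Y | Y ∈ M ∧ Cross Y C}.Finite)
    {ℓ₁ ℓ₂ : Ultrafilter X × Ultrafilter X} (h₁ : ℓ₁ ∈ Λ) {C D : Set X} (hC : IsOpt adj M ℓ₁ C)
    (hD : IsOpt adj M ℓ₂ D) (hx : Cross C D) (s1 : SepU ℓ₁ (C ∩ D)) (s2 : SepU ℓ₂ (Cᶜ ∩ Dᶜ)) : False := by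
  obtain ⟨f1, f2, hle⟩ := bd_sub hs hC.1.2.1 hD.1.2.1
  have a1 := hC.1.2.2 _ s1 f1
  have a2 := hD.1.2.2 _ s2 f2
  have m1 := hC.2 (C ∩ D) ⟨s1, f1, fun D' h h' => by have := hC.1.2.2 D' h h'; omega⟩
  have m2 := hD.2 (Cᶜ ∩ Dᶜ) ⟨s2, f2, fun D' h h' => by have := hD.1.2.2 D' h h'; omega⟩
  have := m_sub (hfin C hC.1.2.1) (hfin D hD.1.2.1) (hM _ h₁ _ hC.1) hx
  omega

theorem lemB (hs : ∀ x y, adj x y → adj y x) (hM : ∀ ℓ ∈ Λ, ∀ C, IsMinC adj ℓ C → C ∈ M)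
    (hfin : ∀ C, (bd adj C).Finite → {Y | Y ∈ M ∧ Cross Y C}.Finite)
    {ℓ₁ ℓ₂ : Ultrafilter X × Ultrafilter X} (h₁ : ℓ₁ ∈ Λ) {C D : Set X} (hC : IsOpt adj M ℓ₁ C)
    (hD : IsOpt adj M ℓ₂ D) (hx : Cross C D) (s1 : SepU ℓ₁ (C ∩ D)) (s2 : SepU ℓ₁ (Cᶜ ∩ Dᶜ))
    (s3 : SepU ℓ₂ (C ∩ Dᶜ)) (s4 : SepU ℓ₂ (Cᶜ ∩ D)) : False := by
  obtain ⟨f1, f2, hle⟩ := bd_sub hs hC.1.2.1 hD.1.2.1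
  have hD' := hD.compl hs
  have hx' := cross_compl.2 hx
  obtain ⟨f3, f4, hle'⟩ := bd_sub hs hC.1.2.1 hD'.1.2.1
  rw [compl_compl] at f4 hle'
  rw [bd_compl_card hs] at hle'
  have a1 := hC.1.2.2 _ s1 f1
  have a2 := hC.1.2.2 _ s2 f2
  have a3 := hD.1.2.2 _ s3 f3
  have a4 := hD.1.2.2 _ s4 f4
  have m1 := hC.2 (C ∩ D) ⟨s1, f1, fun D' h h' => by have := hC.1.2.2 D' h h'; omega⟩
  have m2 := hC.2 (Cᶜ ∩ Dᶜ) ⟨s2, f2, fun D' h h' => by have := hC.1.2.2 D' h h'; omega⟩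
  have m3 := hD.2 (C ∩ Dᶜ) ⟨s3, f3, fun D' h h' => by have := hD.1.2.2 D' h h'; omega⟩
  have m4 := hD.2 (Cᶜ ∩ D) ⟨s4, f4, fun D' h h' => by have := hD.1.2.2 D' h h'; omega⟩
  have k1 := m_sub (hfin C hC.1.2.1) (hfin D hD.1.2.1) (hM _ h₁ _ hC.1) hx
  have k2 := m_sub (hfin C hC.1.2.1) (hfin _ hD'.1.2.1) (hM _ h₁ _ hC.1) hx'
  rw [compl_compl] at k2
  have : mCr M Dᶜ = mCr M D := by unfold mCr; simp only [cross_compl]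
  omega

theorem opt_nested (hs : ∀ x y, adj x y → adj y x) (hM : ∀ ℓ ∈ Λ, ∀ C, IsMinC adj ℓ C → C ∈ M)
    (hfin : ∀ C, (bd adj C).Finite → {Y | Y ∈ M ∧ Cross Y C}.Finite)
    {ℓ₁ ℓ₂ : Ultrafilter X × Ultrafilter X} (h₁ : ℓ₁ ∈ Λ) {C D : Set X} (hC : IsOpt adj M ℓ₁ C)
    (hD : IsOpt adj M ℓ₂ D) (hx : Cross C D) : False := by
  have hC' := hC.compl hs
  have hD' := hD.compl hs
  have A1 := lemA hs hM hfin h₁ hC hD hx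
  have A2 := lemA hs hM hfin h₁ hC hD' (cross_compl.2 hx)
  have A3 := lemA hs hM hfin h₁ hC' hD (cross_compl'.2 hx)
  have A4 := lemA hs hM hfin h₁ hC' hD' (cross_compl'.2 (cross_compl.2 hx))
  have B1 := lemB hs hM hfin h₁ hC hD hx
  have B2 := lemB hs hM hfin h₁ hC hD' (cross_compl.2 hx)
  have s1 := hC.1.1
  have s2 := hD.1.1
  unfold SepU at *
  have im : ∀ (p : Ultrafilter X) (A B : Set X), A ∩ B ∈ p ↔ A ∈ p ∧ B ∈ p := fun p A B => Filter.inter_mem_iff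
  simp only [im, compl_compl, Ultrafilter.compl_mem_iff_notMem] at *
  revert s1 s2 A1 A2 A3 A4 B1 B2
  clear hC hD hC' hD' im
  generalize (C ∈ ℓ₁.1) = c1
  generalize (C ∈ ℓ₁.2) = c2
  generalize (D ∈ ℓ₁.1) = c3
  generalize (D ∈ ℓ₁.2) = c4
  generalize (C ∈ ℓ₂.1) = d1
  generalize (C ∈ ℓ₂.2) = d2
  generalize (D ∈ ℓ₂.1) = d3
  generalize (D ∈ ℓ₂.2) = d4
  by_cases c1 <;> by_cases c2 <;> by_cases c3 <;> by_cases c4 <;> by_cases d1 <;> by_cases d2 <;> by_cases d3 <;> by_cases d4 <;> simp_all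

theorem bd_pre (σ : Perm X) (hσ : ∀ x y, adj (σ x) (σ y) ↔ adj x y) (C : Set X) :
    bd adj (σ ⁻¹' C) = (Equiv.prodCongr σ σ) ⁻¹' bd adj C := by
  ext ⟨x, y⟩
  simp [bd, hσ]

theorem bd_pre_fin (σ : Perm X) (hσ : ∀ x y, adj (σ x) (σ y) ↔ adj x y) (C : Set X) :
    (bd adj (σ ⁻¹' C)).Finite ↔ (bd adj C).Finite := by
  rw [bd_pre σ hσ]
  exact ⟨fun h => by
    have := h.image (Equiv.prodCongr σ σ)
    rwa [Set.image_preimage_eq _ (Equiv.surjective _)] at this, fun h => h.preimage (Equiv.injective _).injOn⟩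

theorem bd_pre_card (σ : Perm X) (hσ : ∀ x y, adj (σ x) (σ y) ↔ adj x y) (C : Set X) :
    (bd adj (σ ⁻¹' C)).ncard = (bd adj C).ncard := by
  rw [bd_pre σ hσ]
  exact Set.ncard_preimage_of_injective_subset_range (Equiv.injective _) (by simp)

theorem minC_pre (σ : Perm X) (hσ : ∀ x y, adj (σ x) (σ y) ↔ adj x y) (ℓ : Ultrafilter X × Ultrafilter X) (C : Set X) :
    IsMinC adj (mvL σ ℓ) C ↔ IsMinC adj ℓ (σ ⁻¹' C) := by
  have h0 : ∀ C, SepU (mvL σ ℓ) C ↔ SepU ℓ (σ ⁻¹' C) := fun C => Iff.rfl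
  unfold IsMinC
  rw [h0, bd_pre_fin σ hσ, bd_pre_card σ hσ]
  refine and_congr Iff.rfl (and_congr Iff.rfl ⟨fun h D h1 h2 => ?_, fun h D h1 h2 => ?_⟩)
  · have e : σ ⁻¹' (σ.symm ⁻¹' D) = D := by ext; simp
    have := h (σ.symm ⁻¹' D) (by rw [h0, e]; exact h1) (by rw [← bd_pre_fin σ hσ, e]; exact h2)
    rwa [← bd_pre_card σ hσ (σ.symm ⁻¹' D), e] at this
  · have := h (σ ⁻¹' D) h1 ((bd_pre_fin σ hσ _).2 h2)
    rwa [bd_pre_card σ hσ] at this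

theorem cross_pre (σ : Perm X) (C D : Set X) : Cross (σ ⁻¹' C) (σ ⁻¹' D) ↔ Cross C D := by
  have : ∀ A : Set X, (σ ⁻¹' A).Nonempty ↔ A.Nonempty := fun A =>
    ⟨fun ⟨x, hx⟩ => ⟨σ x, hx⟩, fun h => h.preimage σ.surjective⟩
  unfold Cross
  simp only [← Set.preimage_compl, ← Set.preimage_inter, this]

theorem exists_minimal_nat {α : Type} (f : α → ℕ) (P : α → Prop) (h : ∃ a, P a) :
    ∃ a, P a ∧ ∀ b, P b → f a ≤ f b := by
  obtain ⟨a, ha⟩ := h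
  have hwf : ({n | ∃ a, P a ∧ f a = n} : Set ℕ).Nonempty := ⟨_, a, ha, rfl⟩
  obtain ⟨b, hb, hb'⟩ := Nat.sInf_mem hwf
  exact ⟨b, hb, fun c hc => by rw [hb']; exact Nat.sInf_le ⟨c, hc, rfl⟩⟩

theorem opt_cuts {Γ : Type} [Group Γ] (act : Γ →* Perm X) (hs : ∀ x y, adj x y → adj y x)
    (hc : ∀ x y, Relation.ReflTransGen adj x y)
    (ha : ∀ γ x y, adj x y → adj (act γ x) (act γ y)) (hΛ : ∀ γ, ∀ ℓ ∈ Λ, mvL (act γ) ℓ ∈ Λ) (k : ℕ)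
    (hk : ∀ ℓ ∈ Λ, ∃ C, SepU ℓ C ∧ (bd adj C).Finite ∧ (bd adj C).ncard ≤ k) :
    ∃ O : Set (Set X), (∀ C ∈ O, Cᶜ ∈ O) ∧ (∀ γ, ∀ C ∈ O, act γ '' C ∈ O) ∧ ∅ ∉ O ∧
      (∀ C ∈ O, ∀ D ∈ O, C ⊆ D ∨ D ⊆ C ∨ C ⊆ Dᶜ ∨ Dᶜ ⊆ C) ∧ (∀ x y, {C | C ∈ O ∧ x ∈ C ∧ y ∉ C}.Finite) ∧
      ∀ ℓ ∈ Λ, ∃ C ∈ O, SepU ℓ C ∧ (bd adj C).Finite := by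
  classical
  set M : Set (Set X) := {C | ∃ ℓ ∈ Λ, IsMinC adj ℓ C} with hMd
  have hM : ∀ ℓ ∈ Λ, ∀ C, IsMinC adj ℓ C → C ∈ M := fun ℓ h C h' => ⟨ℓ, h, h'⟩
  have hMc : ∀ C ∈ M, ConnS adj C ∧ ConnS adj Cᶜ ∧ (bd adj C).Finite ∧ (bd adj C).ncard ≤ k := by
    rintro C ⟨ℓ, h, h'⟩
    obtain ⟨D, d1, d2, d3⟩ := hk ℓ h
    exact ⟨h'.conn hs hc, (h'.compl hs).conn hs hc, h'.2.1, (h'.2.2 D d1 d2).trans d3⟩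
  have hfin : ∀ C, (bd adj C).Finite → {Y | Y ∈ M ∧ Cross Y C}.Finite := by
    intro C hC
    refine (hC.biUnion fun e _ => hC.biUnion fun e' _ => cut_fin hs hc k e.1 e'.1).subset ?_
    rintro Y ⟨hY, hx⟩
    have aux : ∀ Z : Set X, ConnS adj Z → (Z ∩ C).Nonempty → (Z ∩ Cᶜ).Nonempty → ∃ e ∈ bd adj C, e.1 ∈ Z := by
      intro Z hZ h1 ⟨w, w1, w2⟩
      by_contra hcon
      have := hZ (Z ∩ C) Set.inter_subset_left h1 (by
        intro y hy z hz hyz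
        by_contra hzz
        exact hcon ⟨(y, z), ⟨hy.2, fun h => hzz ⟨hz, h⟩, hyz⟩, hy.1⟩)
      rw [← this] at w1
      exact w2 w1.2
    obtain ⟨e, he, he1⟩ := aux Y (hMc Y hY).1 hx.1 hx.2.1
    obtain ⟨e', he', he1'⟩ := aux Yᶜ (hMc Y hY).2.1 hx.2.2.1 hx.2.2.2
    exact Set.mem_biUnion he (Set.mem_biUnion he' ⟨hMc Y hY, he1, he1'⟩)
  have hσ : ∀ γ x y, adj (act γ x) (act γ y) ↔ adj x y := fun γ x y =>
    ⟨fun h => by simpa using ha γ⁻¹ _ _ h, ha γ x y⟩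
  have hMinv : ∀ γ C, (act γ) ⁻¹' C ∈ M ↔ C ∈ M := by
    have h1 : ∀ γ C, (act γ) ⁻¹' C ∈ M → C ∈ M := fun γ C ⟨ℓ, h, h'⟩ =>
      ⟨_, hΛ γ ℓ h, (minC_pre _ (hσ γ) ℓ C).2 h'⟩
    refine fun γ C => ⟨h1 γ C, fun h => h1 γ⁻¹ _ ?_⟩
    rwa [← Set.preimage_comp, show (act γ ∘ act γ⁻¹ : X → X) = id by
      ext x; simp, Set.preimage_id]
  have hm : ∀ γ C, mCr M ((act γ) ⁻¹' C) = mCr M C := by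
    intro γ C
    unfold mCr
    rw [← Set.ncard_image_of_injective {Y | Y ∈ M ∧ Cross Y C} (f := fun Y => (act γ) ⁻¹' Y)
      (Set.preimage_injective.2 (act γ).surjective)]
    congr 1
    ext Y
    constructor
    · rintro ⟨h1, h2⟩
      have e : act γ ⁻¹' ((act γ).symm ⁻¹' Y) = Y := by ext; simp
      exact ⟨(act γ).symm ⁻¹' Y, ⟨(hMinv γ _).1 (by rwa [e]), (cross_pre (act γ) _ _).1 (by rwa [e])⟩, e⟩
    · rintro ⟨Y, ⟨h1, h2⟩, rfl⟩
      exact ⟨(hMinv γ _).2 h1, (cross_pre (act γ) _ _).2 h2⟩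
  have hopt : ∀ γ ℓ C, IsOpt adj M ℓ ((act γ) ⁻¹' C) → IsOpt adj M (mvL (act γ) ℓ) C := by
    intro γ ℓ C h
    refine ⟨(minC_pre _ (hσ γ) _ _).2 h.1, fun D hD => ?_⟩
    have := h.2 _ ((minC_pre _ (hσ γ) _ _).1 hD)
    rwa [hm, hm] at this
  refine ⟨{C | ∃ ℓ ∈ Λ, IsOpt adj M ℓ C}, ?_, ?_, ?_, ?_, ?_, ?_⟩
  · rintro C ⟨ℓ, h, h'⟩; exact ⟨ℓ, h, h'.compl hs⟩
  · rintro γ C ⟨ℓ, h, h'⟩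
    exact ⟨_, hΛ γ ℓ h, hopt γ ℓ _ (by rwa [Set.preimage_image_eq _ (act γ).injective])⟩
  · rintro ⟨ℓ, h, h'⟩
    exact h'.1.1 (by simp)
  · rintro C ⟨ℓ, h, hC⟩ D ⟨ℓ', h', hD⟩
    have := opt_nested hs hM hfin h hC hD
    by_contra hcon
    simp only [not_or] at hcon
    obtain ⟨n1, n2, n3, n4⟩ := hcon
    obtain ⟨x1, a1, b1⟩ := Set.not_subset.1 n1
    obtain ⟨x2, a2, b2⟩ := Set.not_subset.1 n2
    obtain ⟨x3, a3, b3⟩ := Set.not_subset.1 n3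
    obtain ⟨x4, a4, b4⟩ := Set.not_subset.1 n4
    exact this ⟨⟨x3, a3, not_not.1 b3⟩, ⟨x1, a1, b1⟩, ⟨x2, b2, a2⟩, ⟨x4, b4, a4⟩⟩
  · intro x y
    refine (cut_fin hs hc k x y).subset ?_
    rintro C ⟨⟨ℓ, h, h'⟩, hxy⟩
    exact ⟨hMc C (hM ℓ h C h'.1), hxy⟩
  · intro ℓ h
    obtain ⟨D, d1, d2, d3⟩ := hk ℓ h
    have e1 : ∃ C, IsMinC adj ℓ C := by
      obtain ⟨C, hC, hmin⟩ := exists_minimal_nat (fun C => (bd adj C).ncard) (fun C => SepU ℓ C ∧ (bd adj C).Finite) ⟨D, d1, d2⟩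
      exact ⟨C, hC.1, hC.2, fun D h1 h2 => hmin D ⟨h1, h2⟩⟩
    obtain ⟨C, hC, hmin⟩ := exists_minimal_nat (fun C => mCr M C) (fun C => IsMinC adj ℓ C) e1
    exact ⟨C, ⟨ℓ, h, hC, hmin⟩, hC.1, hC.2.1⟩
end

open Equiv Monoid

theorem int_ev (Q : ℤ → Prop) (hfin : {n : ℤ | ¬ (Q n ↔ Q (n + 1))}.Finite) :
    ∃ N : ℕ, (∀ n : ℤ, N ≤ n → (Q n ↔ Q N)) ∧ ∀ n : ℤ, n ≤ -N → (Q n ↔ Q (-N)) := by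
  obtain ⟨M, hM⟩ := hfin.bddAbove
  obtain ⟨m, hm⟩ := hfin.bddBelow
  refine ⟨M.natAbs + m.natAbs + 2, ?_, ?_⟩
  · intro n hn
    induction n, hn using Int.leInduction with
    | base => exact Iff.rfl
    | succ n hn ih =>
      rw [← ih]
      by_contra h
      have := hM (show n ∈ {n : ℤ | ¬ (Q n ↔ Q (n + 1))} from fun h' => h h'.symm)
      omega
  · intro n hn
    induction n, hn using Int.leInductionDown with
    | base => exact Iff.rfl
    | pred n hn ih =>
      rw [← ih]
      by_contra h
      have := hm (show n - 1 ∈ {n : ℤ | ¬ (Q n ↔ Q (n + 1))} from fun h' => h (by simpa using h'))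
      omega

theorem int_lem (Q : ℤ → Prop) (hfin : {n : ℤ | ¬ (Q n ↔ Q (n + 1))}.Finite)
    (hU : ¬ ({n : ℕ | Q n} ∈ Filter.hyperfilter ℕ ↔ {n : ℕ | Q (-n)} ∈ Filter.hyperfilter ℕ)) :
    (∀ d : ℤ, d ≠ 0 → ∃ j, ¬ (Q (j + d) ↔ Q j)) ∧ {j | Q (-j)}.Infinite ∧ {j | ¬ Q (-j)}.Infinite := by
  obtain ⟨N, h1, h2⟩ := int_ev Q hfin
  have evU : ∀ S : Set ℕ, (∀ n, N ≤ n → n ∈ S) → S ∈ Filter.hyperfilter ℕ := fun S hS =>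
    Filter.mem_hyperfilter_of_finite_compl ((Set.finite_lt_nat N).subset fun n hn => by
      by_contra h; exact hn (hS n (not_lt.1 h)))
  have evU' : ∀ S : Set ℕ, (∀ n, N ≤ n → n ∉ S) → S ∉ Filter.hyperfilter ℕ := fun S hS h =>
    Ultrafilter.compl_mem_iff_notMem.1 (evU Sᶜ hS) h
  have e1 : {n : ℕ | Q n} ∈ Filter.hyperfilter ℕ ↔ Q N := by
    by_cases hq : Q N
    · simp only [hq, iff_true]; exact evU _ fun n hn => (h1 n (by exact_mod_cast hn)).2 hq
    · simp only [hq, iff_false]; exact evU' _ fun n hn h => hq ((h1 n (by exact_mod_cast hn)).1 h)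
  have e2 : {n : ℕ | Q (-n)} ∈ Filter.hyperfilter ℕ ↔ Q (-N) := by
    by_cases hq : Q (-N)
    · simp only [hq, iff_true]; exact evU _ fun n hn => (h2 (-n) (by simpa using hn)).2 hq
    · simp only [hq, iff_false]; exact evU' _ fun n hn h => hq ((h2 (-n) (by simpa using hn)).1 h)
  rw [e1, e2] at hU
  have inf1 : ∀ S : Set ℤ, (∀ n : ℤ, N ≤ n → n ∈ S) → S.Infinite := fun S hS h =>
    Set.Ici_infinite (N : ℤ) (h.subset hS)
  have inf2 : ∀ S : Set ℤ, (∀ n : ℤ, n ≤ -N → n ∈ S) → S.Infinite := fun S hS h =>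
    Set.Iic_infinite (-N : ℤ) (h.subset hS)
  refine ⟨fun d hd => ?_, ?_, ?_⟩
  · by_contra! hcon
    have hk : ∀ (k : ℕ) j, Q (j + k * d) ↔ Q j := by
      intro k
      induction k with
      | zero => simp
      | succ k ih => intro j; rw [← ih j, ← hcon (j + k * d)]; push_cast; ring_nf
    have : ∃ k : ℕ, (N : ℤ) + N ≤ k * |d| := ⟨2 * N, by
      have : 1 ≤ |d| := Int.one_le_abs hd
      push_cast; nlinarith⟩
    obtain ⟨k, hk2⟩ := this
    rcases le_total 0 d with h | h
    · rw [abs_of_nonneg h] at hk2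
      exact hU (by rw [← hk k (-N)]; exact (h1 _ (by linarith)).symm)
    · rw [abs_of_nonpos h] at hk2
      exact hU (by rw [← hk k N]; exact h2 _ (by linarith))
  · by_cases hq : Q N
    · exact inf2 _ fun n hn => (h1 _ (by linarith)).2 hq
    · exact inf1 _ fun n hn => (h2 _ (by linarith)).2 (by tauto)
  · by_cases hq : Q N
    · exact inf1 _ fun n hn h => (by tauto : ¬ Q (-N)) ((h2 _ (by linarith)).1 h)
    · exact inf2 _ fun n hn h => hq ((h1 _ (by linarith)).1 h)

def CHd {α : Type} [DecidableEq α] (a : α × Bool) : Set (FreeGroup α) := {x | x.toWord.head? = some a}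

def AF {F : Type} [Group F] (C : Set F) : Prop := ∀ f, {x : F | ¬ (x ∈ C ↔ x * f ∈ C)}.Finite

theorem AF.of_gen {F : Type} [Group F] (C : Set F) (S : Set F) (hS : Subgroup.closure S = ⊤)
    (h : ∀ f ∈ S, {x : F | ¬ (x ∈ C ↔ x * f ∈ C)}.Finite) : AF C := by
  intro f
  have hf : f ∈ Subgroup.closure S := hS ▸ Subgroup.mem_top f
  induction hf using Subgroup.closure_induction with
  | mem x hx => exact h x hx
  | one => simp
  | mul f g _ _ h1 h2 =>
    refine (h1.union (h2.preimage (f := fun x => x * f) (mul_left_injective f).injOn)).subset ?_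
    intro x hx
    by_contra hcon
    simp only [Set.mem_union, Set.mem_preimage, Set.mem_ofPred_eq, not_or, not_not] at hcon
    exact hx (by rw [hcon.1, hcon.2, mul_assoc])
  | inv f _ h1 =>
    refine (h1.preimage (f := fun x => x * f⁻¹) (mul_left_injective _).injOn).subset ?_
    intro x hx h
    exact hx (by simpa using h.symm)

theorem head_step {α : Type} [DecidableEq α] (x : FreeGroup α) (s : α) (hx : 2 ≤ x.toWord.length) :
    (x * FreeGroup.of s).toWord.head? = x.toWord.head? := by
  have hr := FreeGroup.isReduced_toWord (x := x)
  have hxm : x = FreeGroup.mk x.toWord := FreeGroup.mk_toWord.symm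
  rcases List.eq_nil_or_concat x.toWord with h | ⟨L, c, h⟩
  · rw [h] at hx; simp at hx
  · rw [List.concat_eq_append] at h
    by_cases hc : c = (s, false)
    · have : x * FreeGroup.of s = FreeGroup.mk L := by
        rw [hxm, h, hc, FreeGroup.of, ← FreeGroup.mul_mk, mul_assoc, FreeGroup.mul_mk]
        have : FreeGroup.mk ([(s, false)] ++ [(s, true)]) = 1 := by
          rw [FreeGroup.one_eq_mk]; exact FreeGroup.reduce.exact (by simp [FreeGroup.reduce])
        rw [this, mul_one]
      rw [this, FreeGroup.toWord_mk, h]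
      have hL : FreeGroup.IsReduced L := by rw [h] at hr; exact hr.infix ⟨[], [c], by simp⟩
      rw [hL.reduce_eq]
      rw [h] at hx
      cases L with
      | nil => simp at hx
      | cons b L => simp
    · have : x * FreeGroup.of s = FreeGroup.mk (x.toWord ++ [(s, true)]) := by
        rw [← FreeGroup.mul_mk, FreeGroup.mk_toWord]; rfl
      rw [this, FreeGroup.toWord_mk]
      have hL : FreeGroup.IsReduced (x.toWord ++ [(s, true)]) := by
        unfold FreeGroup.IsReduced at hr ⊢
        rw [List.isChain_append]
        refine ⟨hr, by simp, ?_⟩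
        rw [h]
        intro a ha b hb
        simp at ha hb
        subst ha hb
        intro h1
        rcases c with ⟨c1, c2⟩
        simp at h1 hc ⊢
        exact hc h1
      rw [hL.reduce_eq, h]
      cases L <;> simp

theorem CHd_AF {α : Type} [Finite α] [DecidableEq α] (a : α × Bool) : AF (CHd a) := by
  refine AF.of_gen _ _ (FreeGroup.closure_range_of α) ?_
  rintro _ ⟨s, rfl⟩
  have : {L : List (α × Bool) | L.length < 2}.Finite := List.finite_length_lt _ 2
  refine (this.preimage (f := fun x : FreeGroup α => x.toWord) FreeGroup.toWord_injective.injOn).subset ?_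
  intro x hx
  by_contra h
  have := head_step x s (not_lt.1 h)
  exact hx (by simp [CHd, this])

theorem free_axis {α : Type} [DecidableEq α] (f : FreeGroup α) (hf : f ≠ 1) : ∃ (φ c : FreeGroup α) (a : α × Bool),
    f = φ * c * φ⁻¹ ∧ ∀ n : ℕ, c ^ (n + 1) ∈ CHd a ∧ (c⁻¹) ^ (n + 1) ∉ CHd a := by
  set L := f.toWord with hL
  set R := FreeGroup.reduceCyclically L with hR
  have hRc : FreeGroup.IsCyclicallyReduced R :=
    FreeGroup.reduceCyclically.isCyclicallyReduced FreeGroup.isReduced_toWord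
  have hfc : f = FreeGroup.mk (FreeGroup.reduceCyclically.conjugator L) * FreeGroup.mk R *
      (FreeGroup.mk (FreeGroup.reduceCyclically.conjugator L))⁻¹ := by
    rw [FreeGroup.inv_mk, FreeGroup.mul_mk, FreeGroup.mul_mk,
      FreeGroup.reduceCyclically.conj_conjugator_reduceCyclically, FreeGroup.mk_toWord]
  have hne : R ≠ [] := by
    intro h
    apply hf
    rw [hfc, h, ← FreeGroup.one_eq_mk, mul_one, mul_inv_cancel]
  have hw : ∀ n : ℕ, ((FreeGroup.mk R) ^ n).toWord = (List.replicate n R).flatten := by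
    intro n
    rw [FreeGroup.toWord_pow, FreeGroup.toWord_mk, hRc.isReduced.reduce_eq, (hRc.flatten_replicate n).isReduced.reduce_eq]
  refine ⟨_, FreeGroup.mk R, R.head hne, hfc, fun n => ⟨?_, fun h => ?_⟩⟩
  · show List.head? _ = _
    rw [hw, List.head?_flatten_replicate (by simp), List.head?_eq_some_head hne]
  · change List.head? _ = _ at h
    rw [inv_pow, FreeGroup.toWord_inv, hw, FreeGroup.invRev, List.head?_reverse, List.getLast?_map,
      List.getLast?_flatten_replicate (by simp), List.getLast?_eq_some_getLast hne] at h
    simp at h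
    have := hRc.2 (R.getLast hne) (by simp [List.getLast?_eq_some_getLast hne]) (R.head hne) (by simp [List.head?_eq_some_head hne])
    rw [← h] at this
    simp at this

noncomputable def lnU {F : Type} [Group F] (c : F) : Ultrafilter F × Ultrafilter F :=
  ((Filter.hyperfilter ℕ).map (fun n : ℕ => c ^ n), (Filter.hyperfilter ℕ).map (fun n : ℕ => c⁻¹ ^ n))

theorem free_tree (α C : Type) [Finite α] [Group C] [Finite C] (ψ : C →* MulAut (FreeGroup α)) :
    ∃ (V : Type) (aV : (FreeGroup α ⋊[ψ] C) →* Perm V) (E : V → V → Prop), TreeLike E ∧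
      (∀ γ u v, E u v → E (aV γ u) (aV γ v)) ∧
      (∀ g, IsOfFinOrder g → ∃ v, aV g v = v) ∧
      ∀ f v, aV (SemidirectProduct.inl f) v = v → f = 1 := by
  classical
  let act : (FreeGroup α ⋊[ψ] C) →* Perm (FreeGroup α) := mkAct (fun γ x => γ.left * ψ γ.right x)
    (fun x => by simp) (fun γ γ' x => by simp [mul_assoc])
  have hact : ∀ γ x, act γ x = γ.left * ψ γ.right x := fun _ _ => rfl
  let S : Set (FreeGroup α) := (Set.range fun p : C × α => ψ p.1 (FreeGroup.of p.2)) ∪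
    Set.range fun p : C × α => (ψ p.1 (FreeGroup.of p.2))⁻¹
  have hSf : S.Finite := (Set.finite_range _).union (Set.finite_range _)
  have hSi : ∀ s ∈ S, s⁻¹ ∈ S := by
    rintro _ (⟨p, rfl⟩ | ⟨p, rfl⟩)
    · exact Or.inr ⟨p, rfl⟩
    · exact Or.inl ⟨p, by simp⟩
  have hSψ : ∀ c, ∀ s ∈ S, ψ c s ∈ S := by
    rintro c _ (⟨p, rfl⟩ | ⟨p, rfl⟩)
    · exact Or.inl ⟨(c * p.1, p.2), by simp⟩
    · exact Or.inr ⟨(c * p.1, p.2), by simp⟩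
  have hSo : ∀ i, FreeGroup.of i ∈ S := fun i => Or.inl ⟨(1, i), by simp⟩
  let adj : FreeGroup α → FreeGroup α → Prop := fun x y => x⁻¹ * y ∈ S
  have hs : ∀ x y, adj x y → adj y x := fun x y h => by
    have := hSi _ h
    simpa [adj] using this
  have hc : ∀ x y, Relation.ReflTransGen adj x y := by
    have h1 : ∀ f x, Relation.ReflTransGen adj x (x * f) := by
      intro f
      induction f using FreeGroup.induction_on with
      | C1 => intro x; rw [mul_one]
      | of i => intro x; exact .single (by simpa [adj] using hSo i)
      | inv_of i _ => intro x; exact .single (by simpa [adj] using hSi _ (hSo i))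
      | mul f g hf hg => intro x; rw [← mul_assoc]; exact (hf x).trans (hg _)
    intro x y
    simpa using h1 (x⁻¹ * y) x
  have ha : ∀ γ x y, adj x y → adj (act γ x) (act γ y) := by
    intro γ x y h
    have := hSψ γ.right _ h
    simpa [adj, hact, mul_assoc] using this
  have hσ : ∀ γ x y, adj (act γ x) (act γ y) ↔ adj x y := fun γ x y =>
    ⟨fun h => by simpa using ha γ⁻¹ _ _ h, ha γ x y⟩
  have AFbd : ∀ D, AF D → (bd adj D).Finite := by
    intro D hD
    refine (hSf.biUnion fun s _ => (hD s).image fun x => (x, x * s)).subset ?_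
    rintro ⟨x, y⟩ ⟨h1, h2, h3⟩
    refine Set.mem_biUnion h3 ⟨x, fun h => h2 ?_, by simp⟩
    simpa using h.1 h1
  have bdAF : ∀ D, (bd adj D).Finite → AF D := by
    intro D hD
    have hgen : Subgroup.closure S = ⊤ := by
      rw [eq_top_iff, ← FreeGroup.closure_range_of, Subgroup.closure_le]
      rintro _ ⟨i, rfl⟩
      exact Subgroup.subset_closure (hSo i)
    refine AF.of_gen D S hgen fun s hs' => ((hD.image Prod.fst).union (hD.image Prod.snd)).subset ?_
    intro x hx
    by_cases hxD : x ∈ D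
    · exact Or.inl ⟨(x, x * s), ⟨hxD, fun h => hx ⟨fun _ => h, fun _ => hxD⟩, by simpa [adj] using hs'⟩, rfl⟩
    · refine Or.inr ⟨(x * s, x), ⟨?_, hxD, by simpa [adj] using hSi s hs'⟩, rfl⟩
      by_contra h
      exact hx ⟨fun h' => absurd h' hxD, fun h' => absurd h' h⟩
  let Λ : Set (Ultrafilter (FreeGroup α) × Ultrafilter (FreeGroup α)) := {ℓ | ∃ γ c a,
    (∀ n : ℕ, c ^ (n + 1) ∈ CHd a ∧ (c⁻¹) ^ (n + 1) ∉ CHd a) ∧ ℓ = mvL (act γ) (lnU c)}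
  have hΛ : ∀ γ, ∀ ℓ ∈ Λ, mvL (act γ) ℓ ∈ Λ := by
    rintro γ _ ⟨γ', c, a, h, rfl⟩
    refine ⟨γ * γ', c, a, h, ?_⟩
    simp only [mvL, Ultrafilter.map_map, map_mul]
    rfl
  obtain ⟨k, hk⟩ := (Set.finite_range fun a : α × Bool => (bd adj (CHd a)).ncard).bddAbove
  have hkΛ : ∀ ℓ ∈ Λ, ∃ C, SepU ℓ C ∧ (bd adj C).Finite ∧ (bd adj C).ncard ≤ k := by
    rintro _ ⟨γ, c, a, h, rfl⟩
    have e : act γ ⁻¹' (act γ '' CHd a) = CHd a := Set.preimage_image_eq _ (act γ).injective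
    refine ⟨act γ '' CHd a, ?_, ?_, ?_⟩
    · show SepU (lnU c) (act γ ⁻¹' (act γ '' CHd a))
      rw [e]
      have evU : ∀ S : Set ℕ, (∀ n, n + 1 ∈ S) → S ∈ Filter.hyperfilter ℕ := fun S hS =>
        Filter.mem_hyperfilter_of_finite_compl ((Set.finite_singleton 0).subset fun n hn => by
          cases n with
          | zero => rfl
          | succ n => exact absurd (hS n) hn)
      have m1 : CHd a ∈ (lnU c).1 := evU {n | c ^ n ∈ CHd a} fun n => (h n).1
      have m2 : CHd a ∉ (lnU c).2 := Ultrafilter.compl_mem_iff_notMem.1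
        (evU {n | c⁻¹ ^ n ∉ CHd a} fun n => (h n).2)
      exact fun h => m2 (h.1 m1)
    · rw [← bd_pre_fin (act γ) (hσ γ), e]; exact AFbd _ (CHd_AF a)
    · rw [← bd_pre_card (act γ) (hσ γ), e]; exact hk ⟨a, rfl⟩
  obtain ⟨O, o1, o2, o3, o4, o5, o6⟩ := opt_cuts act hs hc ha hΛ k hkΛ
  obtain ⟨V, aV, E, t1, t2, t3, t4⟩ := cuts_tree act O o1 o2 o3 o4 o5 1
  refine ⟨V, aV, E, t1, t2, t3, fun f v hv => ?_⟩
  by_contra hf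
  obtain ⟨φ, c, a, hfc, hca⟩ := free_axis f hf
  obtain ⟨D, hDO, hDs, hDb⟩ := o6 _ ⟨SemidirectProduct.inl φ, c, a, hca, rfl⟩
  have hD := bdAF D hDb
  have hinj : Function.Injective fun n : ℤ => f ^ n := injective_zpow_iff_not_isOfFinOrder.2
    (not_isOfFinOrder_of_isMulTorsionFree hf)
  let Q : ℤ → Prop := fun n => f ^ n ∈ D
  have hQfin : {n : ℤ | ¬ (Q n ↔ Q (n + 1))}.Finite := by
    refine ((hD f).preimage (f := fun n : ℤ => f ^ n) hinj.injOn).subset ?_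
    intro n hn
    simpa [Q, zpow_add_one] using hn
  have hconj : ∀ n : ℤ, f ^ n * φ = φ * c ^ n := by
    intro n; rw [hfc, conj_zpow]; simp
  have hfin2 : {n : ℤ | ¬ (Q n ↔ φ * c ^ n ∈ D)}.Finite := by
    refine ((hD φ).preimage (f := fun n : ℤ => f ^ n) hinj.injOn).subset ?_
    intro n hn
    rw [Set.mem_preimage, Set.mem_ofPred_eq, hconj]; exact hn
  have hUc : ∀ (A B : Set ℕ), {n | ¬ (n ∈ A ↔ n ∈ B)}.Finite → (A ∈ Filter.hyperfilter ℕ ↔ B ∈ Filter.hyperfilter ℕ) := by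
    intro A B h
    have := Filter.mem_hyperfilter_of_finite_compl (s := {n | (n ∈ A ↔ n ∈ B)}) (by simpa [Set.compl_def] using h)
    constructor
    · intro h1; filter_upwards [this, h1] with n h2 h3 using h2.1 h3
    · intro h1; filter_upwards [this, h1] with n h2 h3 using h2.2 h3
  have hU : ¬ ({n : ℕ | Q n} ∈ Filter.hyperfilter ℕ ↔ {n : ℕ | Q (-n)} ∈ Filter.hyperfilter ℕ) := by
    intro hcon
    apply hDs
    have q1 := hUc {n : ℕ | Q n} {n : ℕ | φ * c ^ n ∈ D} (by
      refine (hfin2.preimage (f := fun n : ℕ => (n : ℤ)) (by intro a _ b _ h; simpa using h)).subset ?_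
      intro n hn; simpa using hn)
    have q2 := hUc {n : ℕ | Q (-n)} {n : ℕ | φ * c⁻¹ ^ n ∈ D} (by
      refine (hfin2.preimage (f := fun n : ℕ => (-n : ℤ)) (by intro a _ b _ h; simpa using h)).subset ?_
      intro n hn; simpa using hn)
    have w1 : D ∈ (mvL (act (SemidirectProduct.inl φ)) (lnU c)).1 ↔ {n : ℕ | φ * c ^ n ∈ D} ∈ Filter.hyperfilter ℕ := by
      show {n : ℕ | act (SemidirectProduct.inl φ) (c ^ n) ∈ D} ∈ Filter.hyperfilter ℕ ↔ _
      simp [hact]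
    have w2 : D ∈ (mvL (act (SemidirectProduct.inl φ)) (lnU c)).2 ↔ {n : ℕ | φ * c⁻¹ ^ n ∈ D} ∈ Filter.hyperfilter ℕ := by
      show {n : ℕ | act (SemidirectProduct.inl φ) (c⁻¹ ^ n) ∈ D} ∈ Filter.hyperfilter ℕ ↔ _
      simp [hact]
    rw [w1, w2, ← q1, ← q2]; exact hcon
  obtain ⟨r1, r2, r3⟩ := int_lem Q hQfin hU
  have hpow : ∀ (j : ℤ) x, act ((SemidirectProduct.inl f) ^ j) x = f ^ j * x := by
    intro j x; rw [← map_zpow SemidirectProduct.inl f j, hact, SemidirectProduct.left_inl, SemidirectProduct.right_inl, map_one]; rfl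
  have hmem : ∀ (j : ℤ) x, x ∈ act ((SemidirectProduct.inl f) ^ j) '' D ↔ f ^ (-j) * x ∈ D := by
    intro j x
    constructor
    · rintro ⟨y, hy, rfl⟩; rw [hpow]; simpa using hy
    · intro h; exact ⟨_, h, by rw [hpow]; simp⟩
  have himg : Function.Injective fun j : ℤ => act ((SemidirectProduct.inl f) ^ j) '' D := by
    intro i j hij
    by_contra hne
    obtain ⟨n, hn⟩ := r1 (i - j) (sub_ne_zero.2 hne)
    apply hn
    have := hmem i (f ^ (n + i))
    simp only at hij
    rw [hij, hmem j, ← zpow_add, ← zpow_add] at this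
    show f ^ _ ∈ D ↔ f ^ _ ∈ D
    rw [show n + (i - j) = -j + (n + i) by ring, this, show -i + (n + i) = n by ring]
  rcases t4 _ v hv D hDO with h | h
  · refine r3 ((h.preimage himg.injOn).subset ?_)
    intro j hj
    refine ⟨⟨j, rfl⟩, fun h1 => hj ?_⟩
    have := (hmem j 1).1 h1
    rwa [mul_one] at this
  · refine r2 ((h.preimage himg.injOn).subset ?_)
    intro j hj
    exact ⟨⟨j, rfl⟩, (hmem j 1).2 (by rw [mul_one]; exact hj)⟩

open Equiv Monoid

theorem T_exists (C : Type) [Group C] [Finite C] (hcomm : ∀ x y : C, x * y = y * x) :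
    ∃ (T : Type) (_ : Finite T) (ρ : C →* Perm T) (adm : Prop → T → Prop),
      (∀ β c t, adm β (ρ c t) ↔ adm β t) ∧ (∀ t, adm True t → ∃ c, ρ c t ≠ t) ∧
      (∀ P : Subgroup C, P ≠ ⊤ → ∃ t, (∀ β, adm β t) ∧ ∀ c, ρ c t = t ↔ c ∈ P) ∧
      (∃ t, adm False t ∧ ∀ c, ρ c t = t) ∧
      (∀ Q : Subgroup C, Q ≠ ⊤ → ∃ e : Perm T, (∀ β t, adm (¬ β) (e t) ↔ adm β t) ∧
        ∀ c ∈ Q, ∀ t, e (ρ c t) = ρ c (e t)) := by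
  classical
  let PS := {Q : Subgroup C // Q ≠ ⊤}
  haveI : Finite (Subgroup C) := Finite.of_injective (fun Q : Subgroup C => (Q : Set C)) SetLike.coe_injective
  haveI : Fintype PS := Fintype.ofFinite _
  let T := (Σ Q : PS, C ⧸ Q.1) ⊕ (∀ Q : PS, ZMod 2 × (C ⧸ Q.1))
  haveI : Finite T := inferInstance
  let f : C → T → T := fun c t => Sum.elim (fun x => Sum.inl ⟨x.1, c • x.2⟩)
    (fun a => Sum.inr fun Q => ((a Q).1, if (a Q).1 = 0 then (a Q).2 else c • (a Q).2)) t
  let ρ : C →* Perm T := mkAct f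
    (fun t => by rcases t with x | a <;> simp [f])
    (fun c c' t => by
      rcases t with x | a
      · simp [f, mul_smul]
      · simp only [f, Sum.elim_inr, mul_smul]
        congr 1; funext Q
        by_cases h : (a Q).1 = 0 <;> simp [h])
  have hl : ∀ c x, ρ c (Sum.inl x) = Sum.inl ⟨x.1, c • x.2⟩ := fun _ _ => rfl
  have hr : ∀ c a, ρ c (Sum.inr a) = Sum.inr fun Q => ((a Q).1, if (a Q).1 = 0 then (a Q).2 else c • (a Q).2) :=
    fun _ _ => rfl
  have fixq : ∀ (Q : Subgroup C) (c : C) (x : C ⧸ Q), c • x = x ↔ c ∈ Q := by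
    intro Q c x
    induction x using QuotientGroup.induction_on with
    | H y =>
      rw [MulAction.Quotient.smul_coe, QuotientGroup.eq, smul_eq_mul, ← inv_mem_iff]
      rw [show ((c * y)⁻¹ * y)⁻¹ = c by rw [hcomm c y]; group]
  let adm : Prop → T → Prop := fun β t => Sum.elim (fun _ => True) (fun a => (∑ Q, (a Q).1 = 1) ↔ β) t
  refine ⟨T, inferInstance, ρ, adm, ?_, ?_, ?_, ?_, ?_⟩
  · rintro β c (x | a)
    · rw [hl]
      exact Iff.rfl
    · rw [hr]
      exact Iff.rfl
  · rintro (x | a) h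
    · by_contra! hcon
      apply x.1.2
      rw [eq_top_iff]
      intro c _
      have := hcon c
      rw [hl] at this
      have h2 := Sum.inl_injective this
      rcases x with ⟨Q, x⟩
      simp only [Sigma.mk.injEq, heq_eq_eq, true_and] at h2
      exact (fixq _ _ _).1 h2
    · by_contra! hcon
      have hodd : ∑ Q, (a Q).1 = 1 := h.2 trivial
      obtain ⟨Q, -, hQ⟩ := Finset.exists_ne_zero_of_sum_ne_zero (s := Finset.univ) (f := fun Q => (a Q).1)
        (by rw [hodd]; decide)
      apply Q.2
      rw [eq_top_iff]
      intro c _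
      have := hcon c
      rw [hr] at this
      have h2 := congrFun (Sum.inr_injective this) Q
      have h3 := congrArg Prod.snd h2
      simp only [hQ, if_false] at h3
      exact (fixq _ _ _).1 h3
  · intro P hP
    refine ⟨Sum.inl ⟨⟨P, hP⟩, ((1 : C) : C ⧸ P)⟩, fun _ => trivial, fun c => ?_⟩
    rw [hl, ← fixq P c ((1 : C) : C ⧸ P)]
    constructor
    · intro h
      have h2 := Sum.inl_injective h
      simpa only [Sigma.mk.injEq, heq_eq_eq, true_and] using h2
    · intro h
      show Sum.inl _ = Sum.inl _
      rw [h]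
  · refine ⟨Sum.inr fun Q => (0, ((1 : C) : C ⧸ Q.1)), ?_, fun c => ?_⟩
    · show (∑ Q : PS, (0 : ZMod 2) = 1) ↔ False
      simp
    · rw [hr]; simp
  · intro Q hQ
    let tg : T → T := fun t => Sum.elim (fun x => Sum.inl x)
      (fun a => Sum.inr fun Q' => ((a Q').1 + (if Q' = ⟨Q, hQ⟩ then 1 else 0), (a Q').2)) t
    have tg2 : ∀ t, tg (tg t) = t := by
      rintro (x | a)
      · rfl
      · simp only [tg, Sum.elim_inr]
        congr 1; funext Q'
        rw [add_assoc, CharTwo.add_self_eq_zero, add_zero]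
    refine ⟨⟨tg, tg, tg2, tg2⟩, ?_, ?_⟩
    · rintro β (x | a)
      · exact Iff.rfl
      · show (∑ Q', ((a Q').1 + (if Q' = ⟨Q, hQ⟩ then 1 else 0)) = 1 ↔ ¬ β) ↔ (∑ Q, (a Q).1 = 1 ↔ β)
        rw [Finset.sum_add_distrib, Finset.sum_ite_eq' Finset.univ]
        simp only [Finset.mem_univ, if_true]
        generalize ∑ Q, (a Q).1 = z
        have : z + 1 = 1 ↔ ¬ z = 1 := by revert z; decide
        tauto
    · rintro c hc (x | a)
      · rfl
      · show tg (ρ c (Sum.inr a)) = ρ c (tg (Sum.inr a))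
        rw [hr]
        simp only [tg, Sum.elim_inr, hr]
        congr 1; funext Q'
        by_cases h : Q' = ⟨Q, hQ⟩
        · subst h
          have := (fixq Q c (a ⟨Q, hQ⟩).2).2 hc
          simp [this]
        · simp [h]

theorem eq_choice {Δ X T : Type} [Group Δ] (a : Δ →* Perm X) (b : Δ →* Perm T) (P : X → T → Prop)
    (hP : ∀ γ x t, P x t → P (a γ x) (b γ t)) (h : ∀ x, ∃ t, P x t ∧ ∀ γ, a γ x = x → b γ t = t) :
    ∃ f : X → T, (∀ x, P x (f x)) ∧ ∀ γ x, f (a γ x) = b γ (f x) := by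
  obtain ⟨rep, u, hu, hrep⟩ := orbit_reps a
  choose t ht hfix using h
  refine ⟨fun x => b (u x) (t (rep x)), fun x => ?_, fun γ x => ?_⟩
  · have := hP (u x) _ _ (ht (rep x))
    rwa [hu] at this
  · have key : a ((u x)⁻¹ * γ⁻¹ * u (a γ x)) (rep x) = rep x := by
      have h1 := hu (a γ x)
      rw [hrep] at h1
      rw [map_mul, map_mul, Perm.mul_apply, Perm.mul_apply, h1, map_inv, map_inv, Perm.inv_eq_iff_eq,
        Perm.inv_eq_iff_eq, hu]
    have h2 := hfix _ _ key
    simp only [hrep]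
    rw [map_mul, map_mul, Perm.mul_apply, Perm.mul_apply, map_inv, map_inv, Perm.inv_eq_iff_eq,
        Perm.inv_eq_iff_eq] at h2
    exact h2

def RR {B W : Type} (e : Perm W) (S : Set B) (εu εv : B → W) (x y : W × Bool) : Prop :=
  (∃ b ∈ S, x = (εu b, false) ∧ y = (εv b, false)) ∨ (∃ w, w ∉ εu '' S ∧ x = (w, false) ∧ y = (e w, true)) ∨
  (∃ w, ∃ b ∈ S, e w = εv b ∧ x = (w, true) ∧ y = (e (εu b), true)) ∨
  (∃ w, e w ∉ εv '' S ∧ x = (w, true) ∧ y = (e w, false))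

theorem RR.swap {B W : Type} {e : Perm W} {S : Set B} {εu εv : B → W} {x y : W × Bool}
    (h : RR e S εu εv x y) : RR e⁻¹ S εv εu y x := by
  rcases h with ⟨b, hb, rfl, rfl⟩ | ⟨w, hw, rfl, rfl⟩ | ⟨w, b, hb, h1, rfl, rfl⟩ | ⟨w, hw, rfl, rfl⟩
  · exact Or.inl ⟨b, hb, rfl, rfl⟩
  · exact Or.inr (Or.inr (Or.inr ⟨e w, by simpa using hw, rfl, by simp⟩))
  · exact Or.inr (Or.inr (Or.inl ⟨e (εu b), b, hb, by simp, rfl, by rw [← h1]; simp⟩))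
  · exact Or.inr (Or.inl ⟨e w, hw, rfl, by simp⟩)

theorem RR.uniq {B W : Type} {e : Perm W} {S : Set B} {εu εv : B → W} (hu : Set.InjOn εu S)
    (hv : Set.InjOn εv S) {x y y' : W × Bool} (h : RR e S εu εv x y) (h' : RR e S εu εv x y') : y = y' := by
  rcases h with ⟨b, hb, h1, rfl⟩ | ⟨w, hw, h1, rfl⟩ | ⟨w, b, hb, h0, h1, rfl⟩ | ⟨w, hw, h1, rfl⟩ <;>
  rcases h' with ⟨b', hb', h1', rfl⟩ | ⟨w', hw', h1', rfl⟩ | ⟨w', b', hb', h0', h1', rfl⟩ | ⟨w', hw', h1', rfl⟩ <;>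
  rw [h1] at h1' <;> simp only [Prod.mk.injEq, Bool.false_eq_true, Bool.true_eq_false, and_false, and_true] at h1'
  · rw [hu hb hb' h1']
  · exact absurd ⟨b, hb, h1'⟩ hw'
  · exact absurd ⟨b', hb', h1'.symm⟩ hw
  · rw [h1']
  · rw [h1', h0'] at h0
    rw [hv hb' hb h0]
  · exact absurd ⟨b, hb, by rw [← h0, h1']⟩ hw'
  · exact absurd ⟨b', hb', by rw [← h0', h1']⟩ hw
  · rw [h1']

theorem RR.tot {B W : Type} (e : Perm W) (S : Set B) (εu εv : B → W) (x : W × Bool) :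
    ∃ y, RR e S εu εv x y := by
  rcases x with ⟨w, i⟩
  cases i
  · by_cases h : w ∈ εu '' S
    · obtain ⟨b, hb, rfl⟩ := h
      exact ⟨_, Or.inl ⟨b, hb, rfl, rfl⟩⟩
    · exact ⟨_, Or.inr (Or.inl ⟨w, h, rfl, rfl⟩)⟩
  · by_cases h : e w ∈ εv '' S
    · obtain ⟨b, hb, h⟩ := h
      exact ⟨_, Or.inr (Or.inr (Or.inl ⟨w, b, hb, h.symm, rfl, rfl⟩))⟩
    · exact ⟨_, Or.inr (Or.inr (Or.inr ⟨w, h, rfl, rfl⟩))⟩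

theorem RR.uniq' {B W : Type} {e : Perm W} {S : Set B} {εu εv : B → W} (hu : Set.InjOn εu S)
    (hv : Set.InjOn εv S) {x x' y : W × Bool} (h : RR e S εu εv x y) (h' : RR e S εu εv x' y) : x = x' :=
  RR.uniq hv hu h.swap h'.swap

theorem RR.tot' {B W : Type} (e : Perm W) (S : Set B) (εu εv : B → W) (y : W × Bool) :
    ∃ x, RR e S εu εv x y := by
  obtain ⟨x, h⟩ := RR.tot e⁻¹ S εv εu y
  exact ⟨x, by simpa using h.swap⟩

/-- sections of a system of bi-unique, bi-total relations along the edges of a tree -/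
theorem tree_sections {V W : Type} (E : V → V → Prop) (hE : TreeLike E) (R : V → V → W → W → Prop)
    (ht : ∀ u v x, ∃ y, R u v x y) (ht' : ∀ u v y, ∃ x, R u v x y)
    (hu : ∀ u v x y y', R u v x y → R u v x y' → y = y') (hu' : ∀ u v x x' y, R u v x y → R u v x' y → x = x')
    (A : V → W → Prop) (hA : ∀ u v x y, R u v x y → (A u x ↔ A v y)) (r : V) :
    (∀ w, A r w → ∃ s : V → W, s r = w ∧ (∀ v, A v (s v)) ∧ ∀ u v, E u v → R u v (s u) (s v)) ∧
    (∀ s s' : V → W, (∀ u v, E u v → R u v (s u) (s v)) → (∀ u v, E u v → R u v (s' u) (s' v)) → s r = s' r → s = s') := by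
  obtain ⟨hasym, hroot⟩ := hE
  obtain ⟨n, h1, h2, h3, h4⟩ := hroot r
  let N : V → V → W → W → Prop := fun u v x y => (E u v ∧ R u v x y) ∨ (E v u ∧ R v u y x)
  have Nt : ∀ u v, (E u v ∨ E v u) → ∀ x, ∃ y, N u v x y := by
    rintro u v (h | h) x
    · obtain ⟨y, hy⟩ := ht u v x; exact ⟨y, Or.inl ⟨h, hy⟩⟩
    · obtain ⟨y, hy⟩ := ht' v u x; exact ⟨y, Or.inr ⟨h, hy⟩⟩
  have Nu : ∀ u v x y y', N u v x y → N u v x y' → y = y' := by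
    rintro u v x y y' (⟨h, h'⟩ | ⟨h, h'⟩) (⟨k, k'⟩ | ⟨k, k'⟩)
    · exact hu _ _ _ _ _ h' k'
    · exact absurd k (hasym _ _ h)
    · exact absurd k (hasym _ _ h)
    · exact hu' _ _ _ _ _ h' k'
  have NA : ∀ u v x y, N u v x y → (A u x ↔ A v y) := by
    rintro u v x y (⟨h, h'⟩ | ⟨h, h'⟩)
    · exact hA _ _ _ _ h'
    · exact (hA _ _ _ _ h').symm
  constructor
  · intro w hw
    have ex : ∀ k, ∃ s : V → W, s r = w ∧ ∀ v, v ≠ r → n v ≤ k → ∀ u, (E u v ∨ E v u) → n u < n v → N u v (s u) (s v) := by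
      classical
      intro k
      induction k with
      | zero => exact ⟨fun _ => w, rfl, fun v _ hv u _ hlt => by omega⟩
      | succ k ih =>
        obtain ⟨s, hs1, hs2⟩ := ih
        choose par hpar using h1
        choose tr htr using Nt
        refine ⟨fun v => if h : v ≠ r ∧ n v = k + 1 then tr _ _ (hpar v h.1).1 (s (par v h.1)) else s v, ?_, ?_⟩
        · simp [hs1]
        · intro v hv hvk u huv hlt
          have hunk : ¬ (u ≠ r ∧ n u = k + 1) := fun h => by omega
          simp only [hunk, dif_neg, not_false_eq_true]
          by_cases h : n v = k + 1
          · simp only [hv, h, ne_eq, not_false_eq_true, and_self, dif_pos]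
            have hp := hpar v hv
            have hpe : par v hv = u := h4 v _ _ hp.1 huv hp.2 hlt
            have := htr _ _ hp.1 (s (par v hv))
            subst hpe
            exact this
          · simp only [h, and_false, dif_neg, not_false_eq_true]
            exact hs2 v hv (by omega) u huv hlt
    choose s hs1 hs2 using ex
    have stab : ∀ m v, n v = m → ∀ k k', m ≤ k → m ≤ k' → s k v = s k' v := by
      intro m
      induction m using Nat.strong_induction_on with
      | _ m ih =>
        intro v hv k k' hk hk'
        by_cases hvr : v = r
        · rw [hvr, hs1, hs1]
        · obtain ⟨u, huv, hlt⟩ := h1 v hvr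
          have a1 := hs2 k v hvr (by omega) u huv hlt
          have a2 := hs2 k' v hvr (by omega) u huv hlt
          rw [ih (n u) (by omega) u rfl k k' (by omega) (by omega)] at a1
          exact Nu _ _ _ _ _ a1 a2
    have hN : ∀ u v, (E u v ∨ E v u) → n u < n v → N u v (s (n u) u) (s (n v) v) := by
      intro u v huv hlt
      have hvr : v ≠ r := fun h => by rw [h, h3] at hlt; omega
      have := hs2 (n v) v hvr le_rfl u huv hlt
      rwa [stab (n u) u rfl (n v) (n u) hlt.le le_rfl] at this
    refine ⟨fun v => s (n v) v, hs1 _, ?_, ?_⟩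
    · have : ∀ m v, n v = m → A v (s (n v) v) := by
        intro m
        induction m using Nat.strong_induction_on with
        | _ m ih =>
          intro v hv
          by_cases hvr : v = r
          · rw [hvr, hs1]; exact hw
          · obtain ⟨u, huv, hlt⟩ := h1 v hvr
            exact (NA _ _ _ _ (hN u v huv hlt)).1 (ih (n u) (by omega) u rfl)
      exact fun v => this _ v rfl
    · intro u v huv
      rcases lt_or_gt_of_ne (h2 u v huv) with h | h
      · rcases hN u v (Or.inl huv) h with h' | h'
        · exact h'.2
        · exact absurd h'.1 (hasym _ _ huv)
      · rcases hN v u (Or.inr huv) h with h' | h'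
        · exact absurd h'.1 (hasym _ _ huv)
        · exact h'.2
  · intro s s' hs hs' hr
    have : ∀ m v, n v = m → s v = s' v := by
      intro m
      induction m using Nat.strong_induction_on with
      | _ m ih =>
        intro v hv
        by_cases hvr : v = r
        · rw [hvr, hr]
        · obtain ⟨u, huv, hlt⟩ := h1 v hvr
          have e1 := ih (n u) (by omega) u rfl
          rcases huv with h | h
          · have a1 := hs u v h
            rw [e1] at a1
            exact hu _ _ _ _ _ a1 (hs' u v h)
          · have a1 := hs v u h
            rw [e1] at a1
            exact hu' _ _ _ _ _ a1 (hs' v u h)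
    funext v
    exact this _ v rfl

open Equiv Monoid

theorem pp_data {Δ V C B : Type} [Group Δ] [Group C] [Finite C] (hcomm : ∀ x y : C, x * y = y * x)
    (aV : Δ →* Perm V) (pr : Δ →* C) (hinj : ∀ v γ, aV γ v = v → pr γ = 1 → γ = 1) (g : Δ)
    (hg : Subgroup.zpowers (pr g) = ⊤) (aB : Δ →* Perm B) (hgB : ∀ x b, aB (x⁻¹ * g * x) b ≠ b) :
    ∃ (T : Type) (_ : Finite T) (σ : Δ →* Perm T) (ok : V → T → Prop) (pt : V → B → T) (e : V → V → Perm T),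
      (∀ γ v t, ok (aV γ v) (σ γ t) ↔ ok v t) ∧ (∀ v t, aV g v = v → ok v t → σ g t ≠ t) ∧
      (∀ v b, ok v (pt v b)) ∧ (∀ γ v b, pt (aV γ v) (aB γ b) = σ γ (pt v b)) ∧
      (∀ γ v b, aV γ v = v → σ γ (pt v b) = pt v b → aB γ b = b) ∧
      (∀ γ u v t, e (aV γ u) (aV γ v) (σ γ t) = σ γ (e u v t)) ∧
      (∀ u v t, ok u t ↔ ok v (e u v t)) := by
  obtain ⟨T, hT, ρ, adm, t1, t2, t3, t4, t5⟩ := T_exists C hcomm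
  have hinj2 : ∀ v γ δ, aV γ v = v → aV δ v = v → pr γ = pr δ → γ = δ := by
    intro v γ δ h1 h2 h3
    have := hinj v (γ⁻¹ * δ) (by rw [map_mul, map_inv, Perm.mul_apply, h2, Perm.inv_eq_iff_eq, h1])
      (by rw [map_mul, map_inv, h3]; simp)
    exact inv_mul_eq_one.1 this
  let bad : V → Prop := fun v => ∃ x, aV (x⁻¹ * g * x) v = v
  have badi : ∀ γ v, bad (aV γ v) ↔ bad v := by
    have : ∀ γ v, bad v → bad (aV γ v) := by
      rintro γ v ⟨x, hx⟩
      refine ⟨x * γ⁻¹, ?_⟩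
      rw [← Perm.mul_apply, ← map_mul]
      rw [show (x * γ⁻¹)⁻¹ * g * (x * γ⁻¹) * γ = γ * (x⁻¹ * g * x) by group, map_mul, Perm.mul_apply, hx]
    intro γ v
    refine ⟨fun h => ?_, this γ v⟩
    have := this γ⁻¹ _ h
    rwa [← Perm.mul_apply, ← map_mul, inv_mul_cancel, map_one] at this
  have badp : ∀ γ v, bad (aV γ v) = bad v := fun γ v => propext (badi γ v)
  have ρc : ∀ c d t, ρ c (ρ d t) = ρ d (ρ c t) := by
    intro c d t
    rw [← Perm.mul_apply, ← Perm.mul_apply, ← map_mul, ← map_mul, hcomm]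
  let a2 : Δ →* Perm (V × B) := mkAct (fun γ x => (aV γ x.1, aB γ x.2)) (by intro x; simp) (by intro γ δ x; simp)
  have a2a : ∀ γ v b, a2 γ (v, b) = (aV γ v, aB γ b) := fun _ _ _ => rfl
  let a3 : Δ →* Perm (V × V) := mkAct (fun γ x => (aV γ x.1, aV γ x.2)) (by intro x; simp) (by intro γ δ x; simp)
  have a3a : ∀ γ v b, a3 γ (v, b) = (aV γ v, aV γ b) := fun _ _ _ => rfl
  let σ : Δ →* Perm T := ρ.comp pr
  have σa : ∀ γ t, σ γ t = ρ (pr γ) t := fun _ _ => rfl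
  obtain ⟨pt, hp1, hp2⟩ := eq_choice a2 σ
    (fun x t => adm (bad x.1) t ∧ ∀ c, ρ c t = t ↔ ∃ δ, a2 δ x = x ∧ pr δ = c) (by
      rintro γ ⟨v, b⟩ t ⟨h1, h2⟩
      refine ⟨?_, fun c => ?_⟩
      · show adm (bad (aV γ v)) _
        rw [badp, σa, t1]; exact h1
      · rw [σa, ρc, (ρ (pr γ)).apply_eq_iff_eq, h2]
        constructor
        · rintro ⟨δ, hδ, rfl⟩
          refine ⟨γ * δ * γ⁻¹, ?_, ?_⟩
          · rw [← Perm.mul_apply, ← map_mul, inv_mul_cancel_right, map_mul, Perm.mul_apply, hδ]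
          · rw [map_mul, map_mul, hcomm, map_inv, inv_mul_cancel_left]
        · rintro ⟨δ, hδ, rfl⟩
          refine ⟨γ⁻¹ * δ * γ, ?_, ?_⟩
          · rw [map_mul, map_mul, Perm.mul_apply, Perm.mul_apply, hδ, map_inv, Perm.inv_eq_iff_eq]
          · rw [map_mul, map_mul, hcomm, map_inv, mul_inv_cancel_left]) (by
      rintro ⟨v, b⟩
      let P : Subgroup C := ((MulAction.stabilizer (Perm (V × B)) (v, b)).comap a2).map pr
      have hP : ∀ c, c ∈ P ↔ ∃ δ, a2 δ (v, b) = (v, b) ∧ pr δ = c := by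
        intro c
        simp only [P, Subgroup.mem_map, Subgroup.mem_comap, MulAction.mem_stabilizer_iff, Perm.smul_def]
      by_cases hPt : P = ⊤
      · have hb : bad v = False := by
          apply eq_false
          rintro ⟨x, hx⟩
          obtain ⟨δ, hδ, hδ2⟩ := (hP (pr (x⁻¹ * g * x))).1 (by rw [hPt]; trivial)
          rw [a2a, Prod.mk.injEq] at hδ
          have := hinj2 v _ _ hδ.1 hx hδ2
          rw [this] at hδ
          exact hgB x b hδ.2
        obtain ⟨t, ht, ht2⟩ := t4
        refine ⟨t, ⟨?_, fun c => ?_⟩, fun γ _ => ht2 _⟩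
        · show adm (bad v) t
          rw [hb]; exact ht
        · rw [← hP, hPt]; simp [ht2]
      · obtain ⟨t, ht, ht2⟩ := t3 P hPt
        refine ⟨t, ⟨ht _, fun c => ?_⟩, fun γ hγ => ?_⟩
        · rw [ht2, hP]
        · rw [σa, ht2, hP]; exact ⟨γ, hγ, rfl⟩)
  obtain ⟨e, he1, he2⟩ := eq_choice a3
    (mkAct (fun γ (f : Perm T) => σ γ * f * (σ γ)⁻¹) (by intro x; simp) (by intro γ δ x; simp [mul_assoc]))
    (fun x f => ∀ t, adm (bad x.1) t ↔ adm (bad x.2) (f t)) (by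
      rintro γ ⟨u, v⟩ f hf t
      show adm (bad (aV γ u)) t ↔ adm (bad (aV γ v)) (σ γ (f ((σ γ)⁻¹ t)))
      rw [badp, badp, σa, t1, ← hf]
      conv_lhs => rw [show t = ρ (pr γ) ((σ γ)⁻¹ t) by rw [← σa]; simp]
      rw [t1]) (by
      rintro ⟨u, v⟩
      by_cases huv : bad u ↔ bad v
      · have huv' : bad u = bad v := propext huv
        refine ⟨1, fun t => ?_, fun γ _ => ?_⟩
        · show adm (bad u) t ↔ adm (bad v) t
          rw [huv']
        · show σ γ * 1 * (σ γ)⁻¹ = 1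
          simp
      · let Q : Subgroup C := ((MulAction.stabilizer (Perm (V × V)) (u, v)).comap a3).map pr
        have hQ : ∀ c, c ∈ Q ↔ ∃ δ, (aV δ u = u ∧ aV δ v = v) ∧ pr δ = c := by
          intro c
          simp only [Q, Subgroup.mem_map, Subgroup.mem_comap, MulAction.mem_stabilizer_iff, Perm.smul_def, a3a,
            Prod.mk.injEq]
        have hQt : Q ≠ ⊤ := by
          intro hQt
          apply huv
          constructor
          · rintro ⟨x, hx⟩
            obtain ⟨δ, hδ, hδ2⟩ := (hQ (pr (x⁻¹ * g * x))).1 (by rw [hQt]; trivial)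
            have := hinj2 u _ _ hδ.1 hx hδ2
            rw [this] at hδ
            exact ⟨x, hδ.2⟩
          · rintro ⟨x, hx⟩
            obtain ⟨δ, hδ, hδ2⟩ := (hQ (pr (x⁻¹ * g * x))).1 (by rw [hQt]; trivial)
            have := hinj2 v _ _ hδ.2 hx hδ2
            rw [this] at hδ
            exact ⟨x, hδ.1⟩
        obtain ⟨f, hf1, hf2⟩ := t5 Q hQt
        refine ⟨f, fun t => ?_, fun γ hγ => ?_⟩
        · show adm (bad u) t ↔ adm (bad v) (f t)
          have : bad v = ¬ bad u := propext (by tauto)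
          rw [this, hf1]
        · show σ γ * f * (σ γ)⁻¹ = f
          rw [mul_inv_eq_iff_eq_mul]
          ext t
          rw [Perm.mul_apply, Perm.mul_apply, σa, σa, hf2]
          rw [a3a, Prod.mk.injEq] at hγ
          exact (hQ _).2 ⟨γ, hγ, rfl⟩)
  refine ⟨T, hT, σ, fun v t => adm (bad v) t, fun v b => pt (v, b), fun u v => e (u, v), ?_, ?_, ?_, ?_, ?_, ?_, ?_⟩
  · intro γ v t
    show adm (bad (aV γ v)) _ ↔ adm (bad v) _
    rw [badp, σa, t1]
  · intro v t hv ht hfix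
    have hb : bad v = True := eq_true ⟨1, by simpa using hv⟩
    have ht : adm (bad v) t := ht
    rw [hb] at ht
    obtain ⟨c, hc⟩ := t2 t ht
    apply hc
    have : c ∈ Subgroup.zpowers (pr g) := by rw [hg]; trivial
    have h2 : Subgroup.zpowers (pr g) ≤ (MulAction.stabilizer (Perm T) t).comap ρ := by
      rw [Subgroup.zpowers_le]
      exact hfix
    exact h2 this
  · exact fun v b => (hp1 (v, b)).1
  · exact fun γ v b => hp2 γ (v, b)
  · intro γ v b hv hf
    obtain ⟨δ, hδ, hδ2⟩ := ((hp1 (v, b)).2 (pr γ)).1 hf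
    rw [a2a, Prod.mk.injEq] at hδ
    have := hinj2 v _ _ hδ.1 hv hδ2
    rw [this] at hδ
    exact hδ.2
  · intro γ u v t
    have := he2 γ (u, v)
    rw [a3a] at this
    show e (aV γ u, aV γ v) (σ γ t) = _
    rw [this]
    show σ γ (e (u, v) ((σ γ)⁻¹ (σ γ t))) = _
    simp
  · exact fun u v t => he1 (u, v) t

theorem RR.map {B W : Type} {e e' : Perm W} {S S' : Set B} {εu εv εu' εv' : B → W} (φ : Perm W) (π : Perm B)
    (hS : ∀ b, π b ∈ S' ↔ b ∈ S) (hu : ∀ b, εu' (π b) = φ (εu b)) (hv : ∀ b, εv' (π b) = φ (εv b))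
    (he : ∀ w, e' (φ w) = φ (e w)) {x y : W × Bool} (h : RR e S εu εv x y) :
    RR e' S' εu' εv' (φ x.1, x.2) (φ y.1, y.2) := by
  have im : ∀ (ε ε' : B → W), (∀ b, ε' (π b) = φ (ε b)) → ∀ w, w ∉ ε '' S → φ w ∉ ε' '' S' := by
    rintro ε ε' hε w hw ⟨b, hb, hb2⟩
    obtain ⟨b, rfl⟩ := π.surjective b
    rw [hε, φ.apply_eq_iff_eq] at hb2
    exact hw ⟨b, (hS b).1 hb, hb2⟩
  rcases h with ⟨b, hb, rfl, rfl⟩ | ⟨w, hw, rfl, rfl⟩ | ⟨w, b, hb, h1, rfl, rfl⟩ | ⟨w, hw, rfl, rfl⟩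
  · exact Or.inl ⟨π b, (hS b).2 hb, by rw [hu], by rw [hv]⟩
  · exact Or.inr (Or.inl ⟨φ w, im _ _ hu _ hw, rfl, by rw [he]⟩)
  · exact Or.inr (Or.inr (Or.inl ⟨φ w, π b, (hS b).2 hb, by rw [he, h1, hv], rfl, by rw [hu, he]⟩))
  · exact Or.inr (Or.inr (Or.inr ⟨φ w, by rw [he]; exact im _ _ hv _ hw, rfl, by rw [he]⟩))

theorem tree_closure {V : Type} (E : V → V → Prop) (n : V → ℕ) (r : V)
    (h1 : ∀ v, v ≠ r → ∃ u, (E u v ∨ E v u) ∧ n u < n v) (h3 : n r = 0)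
    (h4 : ∀ v u u', (E u v ∨ E v u) → (E u' v ∨ E v u') → n u < n v → n u' < n v → u = u') (F : Finset V) :
    ∃ L : Finset V, F ⊆ L ∧ ∀ v ∈ L, ∀ u, (E u v ∨ E v u) → n u < n v → u ∈ L := by
  classical
  have one : ∀ m v, n v = m → ∃ L : Finset V, v ∈ L ∧ ∀ v ∈ L, ∀ u, (E u v ∨ E v u) → n u < n v → u ∈ L := by
    intro m
    induction m using Nat.strong_induction_on with
    | _ m ih =>
      intro v hv
      by_cases hvr : v = r
      · refine ⟨{v}, by simp, ?_⟩
        intro w hw u _ hlt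
        rw [Finset.mem_singleton] at hw
        subst hw; subst hvr
        omega
      · obtain ⟨u, hu, hlt⟩ := h1 v hvr
        obtain ⟨L, hL1, hL2⟩ := ih (n u) (by omega) u rfl
        refine ⟨insert v L, Finset.mem_insert_self _ _, ?_⟩
        intro w hw u' hu' hlt'
        rcases Finset.mem_insert.1 hw with h | h
        · subst h
          rw [h4 w u' u hu' hu hlt' hlt]
          exact Finset.mem_insert_of_mem hL1
        · exact Finset.mem_insert_of_mem (hL2 w h u' hu' hlt')
  choose L hL1 hL2 using fun v => one (n v) v rfl
  refine ⟨F.biUnion L, fun v hv => Finset.mem_biUnion.2 ⟨v, hv, hL1 v⟩, ?_⟩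
  intro v hv u hu hlt
  obtain ⟨w, hw, hvw⟩ := Finset.mem_biUnion.1 hv
  exact Finset.mem_biUnion.2 ⟨w, hw, hL2 w v hvw u hu hlt⟩

open Equiv Monoid

theorem tree_cd {Δ V C : Type} [Group Δ] [Group C] [Finite C] (hcomm : ∀ x y : C, x * y = y * x)
    (aV : Δ →* Perm V) (pr : Δ →* C) (hinj : ∀ v γ, aV γ v = v → pr γ = 1 → γ = 1) (g : Δ)
    (hg : Subgroup.zpowers (pr g) = ⊤) (E : V → V → Prop) (hE : TreeLike E)
    (hEi : ∀ γ u v, E u v → E (aV γ u) (aV γ v)) (r : V) (hr : aV g r = r) : CD Δ g := by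
  classical
  intro H hH hgH
  obtain ⟨S, hS⟩ := hH
  obtain ⟨aB, haB⟩ := cosetHom_exists H
  let p : Δ ⧸ H := ((1 : Δ) : Δ ⧸ H)
  have hgB : ∀ x b, aB (x⁻¹ * g * x) b ≠ b := by
    intro x b hb
    induction b using QuotientGroup.induction_on with
    | H y =>
      rw [fix_coset H aB haB] at hb
      apply hgH (x * y)
      rwa [show (x * y)⁻¹ * g * (x * y) = y⁻¹ * (x⁻¹ * g * x) * y by group]
  have hp : ∀ h ∈ H, aB h p = p := fun h hh => (fix_coset H aB haB h 1).2 (by simpa using hh)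
  clear_value p
  clear haB
  generalize (Δ ⧸ H) = B at *
  obtain ⟨T, hT, σ, ok, pt, e, k1, k2, k3, k4, k5, k6, k7⟩ := pp_data hcomm aV pr hinj g hg aB hgB
  obtain ⟨n, h1, h2, h3, h4⟩ := hE.2 r
  obtain ⟨L, hL1, hL2⟩ := tree_closure E n r h1 h3 h4 (insert r (S.image fun h => aV h⁻¹ r))
  have hrL : r ∈ L := hL1 (Finset.mem_insert_self _ _)
  have hSL : ∀ h ∈ S, aV h⁻¹ r ∈ L := fun h hh =>
    hL1 (Finset.mem_insert_of_mem (Finset.mem_image_of_mem _ hh))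
  let a2 : Δ →* Perm (V × B) := mkAct (fun γ x => (aV γ x.1, aB γ x.2)) (by intro x; simp) (by intro γ δ x; simp)
  have a2a : ∀ γ v b, a2 γ (v, b) = (aV γ v, aB γ b) := fun _ _ _ => rfl
  obtain ⟨rep, u, hu, hrep⟩ := orbit_reps a2
  let BB : V → B → Prop := fun v b => ∃ l : {l // l ∈ L}, rep (l, p) = rep (v, b)
  have hrep' : ∀ γ v b, rep (aV γ v, aB γ b) = rep (v, b) := fun γ v b => hrep γ (v, b)
  have BBi : ∀ γ v b, BB (aV γ v) (aB γ b) ↔ BB v b := fun γ v b => by simp only [BB, hrep']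
  let lab0 : V × B → {l // l ∈ L} := fun x => if h : ∃ l : {l // l ∈ L}, rep (l, p) = x then h.choose else ⟨r, hrL⟩
  let lab : V → B → {l // l ∈ L} := fun v b => lab0 (rep (v, b))
  have labi : ∀ γ v b, lab (aV γ v) (aB γ b) = lab v b := fun γ v b => by simp only [lab, hrep']
  have labs : ∀ v b, BB v b → rep (lab v b, p) = rep (v, b) := by
    intro v b h
    have h' : ∃ l : {l // l ∈ L}, rep (l, p) = rep (v, b) := h
    simp only [lab, lab0, dif_pos h']
    exact h'.choose_spec
  let W := {l // l ∈ L} × T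
  let ε : V → B → W := fun v b => (lab v b, pt v b)
  let τ : Δ →* Perm W := mkAct (fun γ w => (w.1, σ γ w.2)) (by intro x; simp) (by intro γ δ x; simp)
  have εi : ∀ γ v b, ε (aV γ v) (aB γ b) = τ γ (ε v b) := by
    intro γ v b
    show (lab _ _, pt _ _) = (lab v b, σ γ (pt v b))
    rw [labi, k4]
  have εinj : ∀ v b b', BB v b → BB v b' → ε v b = ε v b' → b = b' := by
    intro v b b' hb hb' h
    obtain ⟨h1, h2⟩ := Prod.mk.inj h
    have e1 : rep (v, b) = rep (v, b') := by rw [← labs v b hb, ← labs v b' hb', h1]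
    have e2 : a2 (u (v, b') * (u (v, b))⁻¹) (v, b) = (v, b') := by
      rw [map_mul, Perm.mul_apply, map_inv]
      conv_lhs => rw [← hu (v, b)]
      rw [hu (v, b)]
      have : (a2 (u (v, b)))⁻¹ (v, b) = rep (v, b) := by rw [Perm.inv_eq_iff_eq, hu]
      rw [this, e1, hu]
    rw [a2a, Prod.mk.injEq] at e2
    have e3 := k4 (u (v, b') * (u (v, b))⁻¹) v b
    rw [e2.1, e2.2, ← h2] at e3
    rw [← e2.2, k5 _ v b e2.1 e3.symm]
  let ee : V → V → Perm W := fun u v => Equiv.prodCongr (Equiv.refl _) (e u v)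
  let R : V → V → W × Bool → W × Bool → Prop := fun u v =>
    RR (ee u v) {b | BB u b ∧ BB v b} (ε u) (ε v)
  let A : V → W × Bool → Prop := fun v x => ok v x.1.2
  have iu : ∀ u v, Set.InjOn (ε u) {b | BB u b ∧ BB v b} := fun u v b hb b' hb' h => εinj u b b' hb.1 hb'.1 h
  have iv : ∀ u v, Set.InjOn (ε v) {b | BB u b ∧ BB v b} := fun u v b hb b' hb' h => εinj v b b' hb.2 hb'.2 h
  have ru : ∀ u v x y y', R u v x y → R u v x y' → y = y' := fun u v x y y' h h' => RR.uniq (iu u v) (iv u v) h h'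
  have ru' : ∀ u v x x' y, R u v x y → R u v x' y → x = x' := fun u v x y y' h h' => RR.uniq' (iu u v) (iv u v) h h'
  have rA : ∀ u v x y, R u v x y → (A u x ↔ A v y) := by
    intro u v x y h
    rcases h with ⟨b, hb, rfl, rfl⟩ | ⟨w, hw, rfl, rfl⟩ | ⟨w, b, hb, h1, rfl, rfl⟩ | ⟨w, hw, rfl, rfl⟩
    · exact iff_of_true (k3 u b) (k3 v b)
    · exact k7 u v w.2
    · refine iff_of_true ?_ ?_
      · show ok u w.2
        rw [k7 u v]
        have : e u v w.2 = pt v b := congrArg Prod.snd h1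
        rw [this]; exact k3 v b
      · show ok v (e u v (pt u b))
        rw [← k7]; exact k3 u b
    · exact k7 u v w.2
  obtain ⟨sec, uni⟩ := tree_sections E hE R (fun u v x => RR.tot _ _ _ _ x) (fun u v x => RR.tot' _ _ _ _ x)
    ru ru' A rA r
  have Ri : ∀ γ u v x y, R u v x y → R (aV γ u) (aV γ v) (τ γ x.1, x.2) (τ γ y.1, y.2) := by
    intro γ u v x y h
    refine RR.map (τ γ) (aB γ) ?_ ?_ ?_ ?_ h
    · intro b
      show BB _ _ ∧ BB _ _ ↔ BB _ _ ∧ BB _ _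
      rw [BBi, BBi]
    · exact fun b => εi γ u b
    · exact fun b => εi γ v b
    · intro w
      show (w.1, e _ _ (σ γ w.2)) = (w.1, σ γ (e u v w.2))
      rw [k6]
  let Z := {s : V → W × Bool // (∀ v, A v (s v)) ∧ ∀ u v, E u v → R u v (s u) (s v)}
  have hinv : ∀ γ v, aV γ (aV γ⁻¹ v) = v := by
    intro γ v
    rw [← Perm.mul_apply, ← map_mul, mul_inv_cancel, map_one, Perm.one_apply]
  have finZ : Finite Z := by
    refine Finite.of_injective (fun s : Z => s.1 r) fun s s' h => Subtype.ext (uni _ _ s.2.2 s'.2.2 h)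
  let aZ : Δ →* Perm Z := mkAct (fun γ s => ⟨fun v => (τ γ (s.1 (aV γ⁻¹ v)).1, (s.1 (aV γ⁻¹ v)).2), by
      refine ⟨fun v => ?_, fun u v huv => ?_⟩
      · have := (k1 γ (aV γ⁻¹ v) (s.1 (aV γ⁻¹ v)).1.2).2 (s.2.1 (aV γ⁻¹ v))
        rwa [hinv] at this
      · have := Ri γ _ _ _ _ (s.2.2 _ _ (hEi γ⁻¹ _ _ huv))
        rwa [hinv, hinv] at this⟩)
    (by intro s; apply Subtype.ext; funext v; simp)
    (by intro γ δ s; apply Subtype.ext; funext v; simp)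
  have aZa : ∀ γ s v, (aZ γ s).1 v = (τ γ (s.1 (aV γ⁻¹ v)).1, (s.1 (aV γ⁻¹ v)).2) := fun _ _ _ => rfl
  obtain ⟨ζ0, z1, z2, z3⟩ := sec (ε r p, false) (k3 r p)
  have hBB : ∀ l ∈ L, BB l p := fun l hl => ⟨⟨l, hl⟩, rfl⟩
  have zL : ∀ m v, n v = m → v ∈ L → ζ0 v = (ε v p, false) := by
    intro m
    induction m using Nat.strong_induction_on with
    | _ m ih =>
      intro v hv hvL
      by_cases hvr : v = r
      · rw [hvr, z1]
      · obtain ⟨u, huv, hlt⟩ := h1 v hvr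
        have huL := hL2 v hvL u huv hlt
        have e1 := ih (n u) (by omega) u rfl huL
        rcases huv with h | h
        · have a1 := z3 u v h
          rw [e1] at a1
          exact ru _ _ _ _ _ a1 (Or.inl ⟨p, ⟨hBB u huL, hBB v hvL⟩, rfl, rfl⟩)
        · have a1 := z3 v u h
          rw [e1] at a1
          exact ru' _ _ _ _ _ a1 (Or.inl ⟨p, ⟨hBB v hvL, hBB u huL⟩, rfl, rfl⟩)
  let ζ : Z := ⟨ζ0, z2, z3⟩
  refine ⟨(MulAction.stabilizer (Perm Z) ζ).comap aZ, ?_, stab_fi aZ ζ, ?_⟩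
  · rw [← hS, Subgroup.closure_le]
    intro h hh
    show aZ h ζ = ζ
    refine Subtype.ext (uni _ _ (aZ h ζ).2.2 ζ.2.2 ?_)
    rw [aZa]
    show (τ h (ζ0 _).1, (ζ0 _).2) = ζ0 r
    rw [zL _ _ rfl (hSL h hh), z1]
    show (τ h (ε _ p), false) = _
    rw [← εi, hinv, hp h (by rw [← hS]; exact Subgroup.subset_closure hh)]
  · intro x hx
    have hx : aZ (x⁻¹ * g * x) ζ = ζ := hx
    rw [map_mul, map_mul, map_inv, Perm.mul_apply, Perm.mul_apply, Perm.inv_eq_iff_eq] at hx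
    generalize aZ x ζ = s at hx
    have h5 := congrArg (fun s : Z => (s.1 r).1.2) hx
    have hr' : aV g⁻¹ r = r := by rw [map_inv, Perm.inv_eq_iff_eq, hr]
    have h6 : σ g (s.1 (aV g⁻¹ r)).1.2 = (s.1 r).1.2 := h5
    rw [hr'] at h6
    exact k2 r _ hr (s.2.1 r) h6

open Equiv Monoid

theorem free_fg_finite (S : Type) (h : Group.FG (FreeGroup S)) : Finite S := by
  classical
  obtain ⟨F, hF⟩ := Group.fg_def.1 h
  have key : ∀ x : FreeGroup S, ∃ S0 : Finset S, ∀ φ : FreeGroup S →* Multiplicative ℤ,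
      (∀ s ∈ S0, φ (FreeGroup.of s) = 1) → φ x = 1 := by
    intro x
    induction x using FreeGroup.induction_on with
    | C1 => exact ⟨∅, fun φ _ => map_one φ⟩
    | of s => exact ⟨{s}, fun φ h => h s (by simp)⟩
    | inv_of s ih => exact ⟨{s}, fun φ h => by rw [map_inv, h s (by simp), inv_one]⟩
    | mul x y hx hy =>
      obtain ⟨A, hA⟩ := hx
      obtain ⟨B, hB⟩ := hy
      refine ⟨A ∪ B, fun φ h => ?_⟩
      rw [map_mul, hA φ fun s hs => h s (by simp [hs]), hB φ fun s hs => h s (by simp [hs]), one_mul]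
  choose S0 hS0 using key
  let φ : FreeGroup S →* Multiplicative ℤ :=
    FreeGroup.lift fun s => if s ∈ F.biUnion S0 then 1 else Multiplicative.ofAdd 1
  have hφ : ∀ s, φ (FreeGroup.of s) = if s ∈ F.biUnion S0 then 1 else Multiplicative.ofAdd 1 :=
    fun s => FreeGroup.lift_apply_of
  have hk : (⊤ : Subgroup (FreeGroup S)) ≤ φ.ker := by
    rw [← hF, Subgroup.closure_le]
    intro x hx
    refine hS0 x φ fun s hs => ?_
    rw [hφ, if_pos (Finset.mem_biUnion.2 ⟨x, hx, hs⟩)]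
  refine Set.finite_univ_iff.1 ((F.biUnion S0).finite_toSet.subset fun s _ => ?_)
  by_contra hs
  have h1 : φ (FreeGroup.of s) = 1 := hk (Subgroup.mem_top _)
  rw [hφ, if_neg (by simpa using hs)] at h1
  exact absurd (congrArg Multiplicative.toAdd h1) (by decide)

theorem vf_setup {Γ : Type} [Group Γ] [Group.FG Γ]
    (h : ∃ A : Subgroup Γ, A.FiniteIndex ∧ ∃ S : Type, Nonempty (A ≃* FreeGroup S)) :
    ∃ (α : Type) (_ : Finite α) (N : Subgroup Γ) (_ : N.Normal) (_ : N.FiniteIndex), Nonempty (N ≃* FreeGroup α) := by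
  obtain ⟨A, hA, S, ⟨e⟩⟩ := h
  let N := A.normalCore
  let f : N →* FreeGroup S := e.toMonoidHom.comp (Subgroup.inclusion A.normalCore_le)
  have hf : Function.Injective f := e.injective.comp (Subgroup.inclusion_injective _)
  let e1 : N ≃* f.range := MonoidHom.ofInjective hf
  let e2 := e1.trans (IsFreeGroup.toFreeGroup f.range)
  haveI : Group.FG N := Subgroup.fg_of_index_ne_zero _
  haveI : Group.FG (FreeGroup (IsFreeGroup.Generators f.range)) := Group.fg_of_surjective (f := e2.toMonoidHom) e2.surjective
  exact ⟨_, free_fg_finite _ this, N, inferInstance, inferInstance, ⟨e2⟩⟩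

theorem vf_main {Γ : Type} [Group Γ] [Group.FG Γ]
    (h : ∃ A : Subgroup Γ, A.FiniteIndex ∧ ∃ S : Type, Nonempty (A ≃* FreeGroup S)) :
    LERF Γ ∧ ∀ g, CD Γ g := by
  obtain ⟨α, hα, N, hN, hNi, ⟨e⟩⟩ := vf_setup h
  let j : FreeGroup α →* Γ := N.subtype.comp e.symm.toMonoidHom
  have ja : ∀ f, j f = (e.symm f : Γ) := fun _ => rfl
  have hj : Function.Injective j := Subtype.val_injective.comp e.symm.injective
  have hr : j.range = N := by
    ext x
    constructor
    · rintro ⟨y, rfl⟩; exact (e.symm y).2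
    · intro hx; exact ⟨e ⟨x, hx⟩, by rw [ja]; simp⟩
  have hri : j.range.FiniteIndex := by rw [hr]; exact hNi
  have hL : LERF Γ := lerf_of_fi j hj hri (free_approx α)
  refine ⟨hL, fun g => ?_⟩
  have hd : g ^ N.index ∈ j.range := by rw [hr]; exact N.pow_index_mem g
  obtain ⟨w, hw⟩ := hd
  by_cases hw1 : w = 1
  · have hgo : IsOfFinOrder g := by
      rw [hw1, map_one] at hw
      exact isOfFinOrder_iff_pow_eq_one.2 ⟨N.index, Nat.pos_of_ne_zero hNi.index_ne_zero, hw.symm⟩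
    let C := Subgroup.zpowers g
    haveI : Finite C := by
      have := hgo.finite_zpowers
      exact this
    let ψ : C →* MulAut (FreeGroup α) :=
      ((MulAut.congr e).toMonoidHom.comp (MulAut.conjNormal (H := N))).comp C.subtype
    have hψ : ∀ c : C, ∀ f, j (ψ c f) = c * j f * (c : Γ)⁻¹ := by
      intro c f
      rw [ja, ja]
      show ((e.symm (e (MulAut.conjNormal (c : Γ) (e.symm f))) : N) : Γ) = _
      rw [e.symm_apply_apply, MulAut.conjNormal_apply]
    let k : FreeGroup α ⋊[ψ] C →* Γ := SemidirectProduct.lift j C.subtype (by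
      intro c; ext f; simp [hψ])
    have kl : ∀ f, k (SemidirectProduct.inl f) = j f := fun f => SemidirectProduct.lift_inl _ _ _ _
    have kr : ∀ c, k (SemidirectProduct.inr c) = c := fun f => SemidirectProduct.lift_inr _ _ _ _
    have hk : Function.Injective k := by
      rw [injective_iff_map_eq_one]
      intro x hx
      rw [← SemidirectProduct.inl_left_mul_inr_right x, map_mul, kl, kr] at hx
      have h1 : j x.left = (((x.right)⁻¹ : C) : Γ) := by
        rw [Subgroup.coe_inv]; exact eq_inv_of_mul_eq_one_left hx
      have h2 : IsOfFinOrder (j x.left) := by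
        rw [h1]
        exact C.subtype.isOfFinOrder (isOfFinOrder_of_finite (x.right)⁻¹)
      have h3 : x.left = 1 := by
        by_contra hne
        exact not_isOfFinOrder_of_isMulTorsionFree hne (hj.isOfFinOrder_iff.1 h2)
      rw [h3, map_one, one_mul] at hx
      exact SemidirectProduct.ext h3 (Subtype.ext hx)
    have hki : k.range.FiniteIndex := by
      haveI := hri
      refine Subgroup.finiteIndex_of_le (H := j.range) ?_
      rintro _ ⟨f, rfl⟩
      exact ⟨_, kl f⟩
    have hii : (SemidirectProduct.inl : FreeGroup α →* FreeGroup α ⋊[ψ] C).range.FiniteIndex := by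
      rw [SemidirectProduct.range_inl_eq_ker_rightHom]
      exact Subgroup.finiteIndex_ker _
    have hLΔ : LERF (FreeGroup α ⋊[ψ] C) :=
      lerf_of_fi SemidirectProduct.inl SemidirectProduct.inl_injective hii (free_approx α)
    obtain ⟨V, aV, E, t1, t2, t3, t4⟩ := free_tree α C ψ
    let c0 : C := ⟨g, Subgroup.mem_zpowers g⟩
    have hc : IsOfFinOrder (SemidirectProduct.inr c0 : FreeGroup α ⋊[ψ] C) :=
      MonoidHom.isOfFinOrder _ (isOfFinOrder_of_finite c0)
    obtain ⟨r, hr⟩ := t3 _ hc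
    have hcd : CD (FreeGroup α ⋊[ψ] C) (SemidirectProduct.inr c0) := by
      refine tree_cd (C := C) (by
        rintro ⟨_, n, rfl⟩ ⟨_, m, rfl⟩
        exact Subtype.ext (zpow_mul_comm g n m)) aV SemidirectProduct.rightHom ?_ _ ?_ E t1 t2 r hr
      · intro v γ h1 h2
        have : γ ∈ (SemidirectProduct.inl : FreeGroup α →* FreeGroup α ⋊[ψ] C).range := by
          rw [SemidirectProduct.range_inl_eq_ker_rightHom]; exact h2
        obtain ⟨f, rfl⟩ := this
        rw [t4 f v h1, map_one]
      · rw [SemidirectProduct.rightHom_inr, eq_top_iff]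
        rintro ⟨x, hx⟩ -
        obtain ⟨n, rfl⟩ := hx
        exact ⟨n, Subtype.ext (by simp [c0])⟩
    have := cd_of_fi_cdx k hk hki _ (hLΔ.cdx hcd)
    rwa [kr] at this
  · exact cd_of_fi_rb j hj hri hL g _ w hw (free_rb α w hw1)

theorem CD.conj {Γ : Type} [Group Γ] {g : Γ} (t : Γ) (h : CD Γ (t * g * t⁻¹)) : CD Γ g := by
  intro H hH hg
  obtain ⟨K, h1, h2, h3⟩ := h H hH (fun x hx => hg (t⁻¹ * x) (by
    rwa [show (t⁻¹ * x)⁻¹ * g * (t⁻¹ * x) = x⁻¹ * (t * g * t⁻¹) * x by group]))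
  refine ⟨K, h1, h2, fun x hx => h3 (t * x) ?_⟩
  rwa [show (t * x)⁻¹ * (t * g * t⁻¹) * (t * x) = x⁻¹ * g * x by group]

theorem main_aux {ι : Type} [Finite ι] {G : ι → Type} [∀ i, Group (G i)]
    (h : ∀ i, LERF (G i) ∧ ∀ g, CD (G i) g) (g : CoprodI G) (h1 : g ≠ 1) : CD (CoprodI G) g := by
  have hA : ∀ i, Approx (G i) := fun i => (h i).1.approx
  by_cases hg : ∀ t : CoprodI G, ∀ i, ∀ y : G i, t * g * t⁻¹ ≠ CoprodI.of y
  · exact (fp_rb hA g h1 hg).cdx.cd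
  · push Not at hg
    obtain ⟨t, i, y, hy⟩ := hg
    refine CD.conj t ?_
    rw [hy]
    exact (fp_cdx hA i y ((h i).1.cdx ((h i).2 y))).cd

/-- let `G = G₁ ∗ ⋯ ∗ G_m` be a free product of finitely many
finitely generated groups, each virtually abelian or virtually free.  Then
every finitely generated subgroup `H` of `G` is conjugacy distinguished: for
every `g ∈ G` no conjugate of which lies in `H`, there are a finite group `Q`
and a homomorphism `φ : G →* Q` such that no conjugate of `φ g` lies in
`φ(H)`. -/
theorem fg_subgroup_conjugacy_distinguished_in_free_product
    (m : ℕ) (G : Fin m → Type) [∀ i, Group (G i)]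
    (hfg : ∀ i, Group.FG (G i))
    (hva : ∀ i, VirtuallyAbelian (G i) ∨ VirtuallyFree (G i))
    (H : Subgroup (Monoid.CoprodI G)) (hH : H.FG)
    (g : Monoid.CoprodI G) (hg : ∀ x : Monoid.CoprodI G, x⁻¹ * g * x ∉ H) :
    ∃ (Q : Type) (_ : Group Q) (_ : Finite Q) (φ : Monoid.CoprodI G →* Q),
      ∀ q : Q, q⁻¹ * φ g * q ∉ Subgroup.map φ H := by
  refine CD.final (main_aux (fun i => ?_) g ?_) H hH hg
  · haveI := hfg i
    rcases hva i with h | h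
    · exact ⟨va_lerf h, va_cd h⟩
    · exact vf_main h
  · rintro rfl
    exact hg 1 (by simp)
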